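/- Let n ≥ 2 and 1 < m < n. There exists a constant C > 0 such that for every Schwartz function f(t,x) on ℝ^{1+n}, ‖⟨x⟩^{-m/2} ⟨D_x⟩^{m-1} Gf‖_{L²(ℝ^{1+n})} ≤ C ‖⟨x⟩^{m/2} f‖_{L²(ℝ^{1+n})}, where Gf(t,x) = ∫₀ᵗ e^{i(t-s)p(D_x)} f(s,·)(x) ds. -/

import Mathlib

open MeasureTheory Real Complex RealInnerProductSpace

noncomputable section

/-- Fourier transform with convention `(2π)^(-n/2) ∫ e^(-ix·ξ) f(x) dx`. -/
def FT (n : ℕ) (f : EuclideanSpace ℝ (Fin n) → ℂ) (ξ : EuclideanSpace ℝ (Fin n)) : ℂ :=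
  ((2 * π) ^ (-(n : ℝ) / 2) : ℝ) •
    ∫ x : EuclideanSpace ℝ (Fin n), Complex.exp (-Complex.I * ((⟪x, ξ⟫ : ℝ) : ℂ)) * f x

/-- Inverse Fourier transform. -/
def IFT (n : ℕ) (F : EuclideanSpace ℝ (Fin n) → ℂ) (x : EuclideanSpace ℝ (Fin n)) : ℂ :=
  ((2 * π) ^ (-(n : ℝ) / 2) : ℝ) •
    ∫ ξ : EuclideanSpace ℝ (Fin n), Complex.exp (Complex.I * ((⟪x, ξ⟫ : ℝ) : ℂ)) * F ξ

/-- Fourier multiplier with symbol `q`: `q(D_x) f = IFT (q · FT f)`. -/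
def mult (n : ℕ) (q : EuclideanSpace ℝ (Fin n) → ℂ) (f : EuclideanSpace ℝ (Fin n) → ℂ) :
    EuclideanSpace ℝ (Fin n) → ℂ :=
  IFT n fun ξ => q ξ * FT n f ξ

open scoped FourierTransform ENNReal SchwartzMap ContDiff ComplexConjugate

/-- The `L²` Fourier transform agrees with the integral one on `L¹ ∩ L²`. -/
theorem coeFn_fourier_toLp_ae_eq {V : Type*} [NormedAddCommGroup V] [InnerProductSpace ℝ V]
    [FiniteDimensional ℝ V] [MeasurableSpace V] [BorelSpace V] {f : V → ℂ}
    (hf : Integrable f) (hf2 : MemLp f 2) :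
    (𝓕 (hf2.toLp f) : Lp ℂ 2 (volume : Measure V)) =ᵐ[volume] 𝓕 f := by
  set g : Lp ℂ 2 (volume : Measure V) := hf2.toLp f with hg
  have hgf : g =ᵐ[volume] f := hf2.coeFn_toLp
  apply ae_eq_of_integral_contDiff_smul_eq
  · exact (Lp.memLp _).locallyIntegrable (by norm_num)
  · exact (VectorFourier.fourierIntegral_continuous continuous_fourierChar
      continuous_inner hf).locallyIntegrable
  · intro φ hφ hφc
    have hc : HasCompactSupport (fun x => (φ x : ℂ)) := hφc.comp_left Complex.ofReal_zero
    have hd : ContDiff ℝ ∞ (fun x => (φ x : ℂ)) := Complex.ofRealCLM.contDiff.comp hφ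
    set ψ : 𝓢(V, ℂ) := hc.toSchwartzMap hd with hψ
    have h1 := Lp.fourier_toTemperedDistribution_eq g
    have h2 := congrArg (fun T => T ψ) h1
    rw [TemperedDistribution.fourier_apply,
      Lp.toTemperedDistribution_apply (μ := (volume : Measure V)),
      Lp.toTemperedDistribution_apply (μ := (volume : Measure V))] at h2
    have h3 := VectorFourier.integral_fourierIntegral_smul_eq_flip (L := innerₗ V)
      continuous_fourierChar continuous_inner (ψ.integrable (μ := volume)) hf
    have e1 : ∀ x, φ x • (𝓕 g : Lp ℂ 2 (volume : Measure V)) x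
        = ψ x • (𝓕 g : Lp ℂ 2 (volume : Measure V)) x := by
      intro x; simp [hψ]
    have e2 : ∀ x, φ x • 𝓕 f x = ψ x • 𝓕 f x := by
      intro x; simp [hψ]
    simp_rw [e1, e2]
    rw [← h2]
    rw [flip_innerₗ] at h3
    refine Eq.trans ?_ h3
    apply integral_congr_ae
    filter_upwards [hgf] with x hx
    rw [hx]; rfl

/-- Plancherel's identity for functions in `L¹ ∩ L²`. -/
theorem lintegral_enorm_fourier_sq {V : Type*} [NormedAddCommGroup V] [InnerProductSpace ℝ V]
    [FiniteDimensional ℝ V] [MeasurableSpace V] [BorelSpace V] {f : V → ℂ}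
    (hf : Integrable f) (hf2 : MemLp f 2) :
    ∫⁻ ξ, ‖𝓕 f ξ‖ₑ ^ 2 = ∫⁻ x, ‖f x‖ₑ ^ 2 := by
  set g : Lp ℂ 2 (volume : Measure V) := hf2.toLp f with hg
  have hgf : g =ᵐ[volume] f := hf2.coeFn_toLp
  have key := coeFn_fourier_toLp_ae_eq hf hf2
  have h4 := Lp.norm_fourier_eq g
  have h5 : ‖(𝓕 g : Lp ℂ 2 (volume : Measure V))‖ₑ = ‖g‖ₑ := by
    rw [← ofReal_norm, ← ofReal_norm, h4]
  rw [Lp.enorm_def, Lp.enorm_def, eLpNorm_congr_ae key, eLpNorm_congr_ae hgf] at h5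
  rw [eLpNorm_eq_lintegral_rpow_enorm_toReal (by norm_num) (by norm_num),
    eLpNorm_eq_lintegral_rpow_enorm_toReal (by norm_num) (by norm_num)] at h5
  have h6 := congrArg (fun z : ℝ≥0∞ => z ^ (2 : ℝ)) h5
  simp only [← ENNReal.rpow_mul, ENNReal.toReal_ofNat] at h6
  norm_num at h6
  exact h6

/-- Cauchy–Schwarz for the lower Lebesgue integral, in squared form. -/
theorem sq_lintegral_mul_le {α : Type*} [MeasurableSpace α] {μ : Measure α} {f g : α → ℝ≥0∞}
    (hf : AEMeasurable f μ) (hg : AEMeasurable g μ) :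
    (∫⁻ x, f x * g x ∂μ) ^ 2 ≤ (∫⁻ x, f x ^ 2 ∂μ) * ∫⁻ x, g x ^ 2 ∂μ := by
  have h := ENNReal.lintegral_mul_le_Lp_mul_Lq μ Real.HolderConjugate.two_two hf hg
  calc _ ≤ ((∫⁻ x, f x ^ (2 : ℝ) ∂μ) ^ (1 / 2 : ℝ) * (∫⁻ x, g x ^ (2 : ℝ) ∂μ) ^ (1 / 2 : ℝ)) ^ 2 := by
        gcongr; exact h
    _ = _ := by
        rw [mul_pow, ← ENNReal.rpow_natCast, ← ENNReal.rpow_natCast, ← ENNReal.rpow_mul,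
          ← ENNReal.rpow_mul]
        norm_num

/-- Parseval's identity for functions in `L¹ ∩ L²`. -/
theorem integral_conj_fourier_mul_fourier {V : Type*} [NormedAddCommGroup V]
    [InnerProductSpace ℝ V] [FiniteDimensional ℝ V] [MeasurableSpace V] [BorelSpace V]
    {f g : V → ℂ} (hf : Integrable f) (hf2 : MemLp f 2) (hg : Integrable g) (hg2 : MemLp g 2) :
    ∫ ξ, 𝓕 g ξ * conj (𝓕 f ξ) = ∫ x, g x * conj (f x) := by
  have h := Lp.inner_fourier_eq (hf2.toLp f) (hg2.toLp g)
  rw [L2.inner_def, L2.inner_def] at h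
  calc _ = ∫ ξ, inner ℂ ((𝓕 (hf2.toLp f) : Lp ℂ 2 (volume : Measure V)) ξ)
        ((𝓕 (hg2.toLp g) : Lp ℂ 2 (volume : Measure V)) ξ) := by
        apply integral_congr_ae
        filter_upwards [coeFn_fourier_toLp_ae_eq hf hf2, coeFn_fourier_toLp_ae_eq hg hg2]
          with ξ h1 h2
        rw [h1, h2]; simp
    _ = _ := h
    _ = _ := by
        apply integral_congr_ae
        filter_upwards [hf2.coeFn_toLp, hg2.coeFn_toLp] with x h1 h2
        rw [h1, h2]; simp

section Polar

variable {E : Type*} [NormedAddCommGroup E] [InnerProductSpace ℝ E] [FiniteDimensional ℝ E]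
  [MeasurableSpace E] [BorelSpace E]

/-- Polar coordinates: lower Lebesgue integral. -/
theorem lintegral_eq_lintegral_sphere_Ioi [Nontrivial E] {F : E → ℝ≥0∞} (hF : Measurable F) :
    ∫⁻ x, F x = ∫⁻ θ : Metric.sphere (0 : E) 1, (∫⁻ r in Set.Ioi (0 : ℝ),
      ENNReal.ofReal (r ^ (Module.finrank ℝ E - 1)) * F (r • (θ : E)))
        ∂(volume : Measure E).toSphere := by
  calc ∫⁻ x, F x = ∫⁻ x : ({0}ᶜ : Set E), F x.1 ∂((volume : Measure E).comap Subtype.val) := by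
        rw [lintegral_subtype_comap (measurableSet_singleton _).compl F, restrict_compl_singleton]
    _ = ∫⁻ z : Metric.sphere (0 : E) 1 × Set.Ioi (0 : ℝ), F (z.2.1 • (z.1 : E))
        ∂((volume : Measure E).toSphere.prod (.volumeIoiPow (Module.finrank ℝ E - 1))) := by
        rw [← (volume : Measure E).measurePreserving_homeomorphUnitSphereProd.lintegral_comp_emb
          (Homeomorph.measurableEmbedding _)]
        congr 1 with x
        have := congrArg Subtype.val ((homeomorphUnitSphereProd E).symm_apply_apply x)
        rw [homeomorphUnitSphereProd_symm_apply_coe] at this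
        rw [this]
    _ = _ := by
        rw [lintegral_prod _ (by fun_prop)]
        congr 1 with θ
        rw [Measure.volumeIoiPow, lintegral_withDensity_eq_lintegral_mul _ (by fun_prop)
          (by fun_prop)]
        exact lintegral_subtype_comap measurableSet_Ioi
          (fun r : ℝ => ENNReal.ofReal (r ^ (Module.finrank ℝ E - 1)) * F (r • (θ : E)))

/-- Polar coordinates: Bochner integral. -/
theorem integral_eq_integral_sphere_Ioi [Nontrivial E] {F : E → ℂ} (hF : Integrable F) :
    ∫ x, F x = ∫ θ : Metric.sphere (0 : E) 1, (∫ r in Set.Ioi (0 : ℝ),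
      (r ^ (Module.finrank ℝ E - 1)) • F (r • (θ : E))) ∂(volume : Measure E).toSphere := by
  have e1 : ∀ x : ({0}ᶜ : Set E), (fun z : Metric.sphere (0 : E) 1 × Set.Ioi (0 : ℝ) =>
      F (z.2.1 • (z.1 : E))) (homeomorphUnitSphereProd E x) = F x.1 := by
    intro x
    have := congrArg Subtype.val ((homeomorphUnitSphereProd E).symm_apply_apply x)
    rw [homeomorphUnitSphereProd_symm_apply_coe] at this
    simp only [this]
  have hI : Integrable (fun z : Metric.sphere (0 : E) 1 × Set.Ioi (0 : ℝ) => F (z.2.1 • (z.1 : E)))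
      ((volume : Measure E).toSphere.prod (.volumeIoiPow (Module.finrank ℝ E - 1))) := by
    rw [← (volume : Measure E).measurePreserving_homeomorphUnitSphereProd.integrable_comp_emb
          (Homeomorph.measurableEmbedding _)]
    refine Integrable.congr (f := fun x : ({0}ᶜ : Set E) => F x.1) ?_
      (.of_forall fun x => (e1 x).symm)
    exact (integrableOn_iff_comap_subtypeVal (measurableSet_singleton _).compl).1 hF.integrableOn
  calc ∫ x, F x = ∫ x : ({0}ᶜ : Set E), F x.1 ∂((volume : Measure E).comap Subtype.val) := by
        rw [integral_subtype_comap (measurableSet_singleton _).compl F, restrict_compl_singleton]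
    _ = ∫ z : Metric.sphere (0 : E) 1 × Set.Ioi (0 : ℝ), F (z.2.1 • (z.1 : E))
        ∂((volume : Measure E).toSphere.prod (.volumeIoiPow (Module.finrank ℝ E - 1))) := by
        rw [← (volume : Measure E).measurePreserving_homeomorphUnitSphereProd.integral_comp
          (Homeomorph.measurableEmbedding _)]
        congr 1 with x
        exact (e1 x).symm
    _ = _ := by
        rw [integral_prod _ hI]
        congr 1 with θ
        simp only [Measure.volumeIoiPow, ENNReal.ofReal]
        rw [integral_withDensity_eq_integral_smul (by fun_prop),
          integral_subtype_comap measurableSet_Ioi (fun r : ℝ =>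
            Real.toNNReal (r ^ (Module.finrank ℝ E - 1)) • F (r • (θ : E)))]
        refine setIntegral_congr_fun measurableSet_Ioi fun r hr => ?_
        simp only [NNReal.smul_def, Real.coe_toNNReal _ (pow_nonneg (le_of_lt hr) _)]

/-- The point on the ray of `θ` at which `a ^ m` takes the value `μ`. -/
def polarMap (a : E → ℝ) (m : ℝ) (θ : Metric.sphere (0 : E) 1) (μ : ℝ) : E :=
  (μ ^ (1 / m) / a θ) • (θ : E)

/-- The Jacobian of the coordinates `polarMap`. -/
def polarJac (a : E → ℝ) (m : ℝ) (θ : Metric.sphere (0 : E) 1) (μ : ℝ) : ℝ :=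
  a θ ^ (-(Module.finrank ℝ E : ℝ)) * μ ^ ((Module.finrank ℝ E : ℝ) / m - 1) / m

theorem polar_substitution {N : ℕ} (hN : 0 < N) {c m μ : ℝ} (hc : 0 < c) (hm : 0 < m)
    (hμ : 0 < μ) :
    (1 / m) * μ ^ (1 / m - 1) / c * (μ ^ (1 / m) / c) ^ (N - 1)
      = c ^ (-(N : ℝ)) * μ ^ ((N : ℝ) / m - 1) / m := by
  obtain ⟨k, rfl⟩ : ∃ k, N = k + 1 := ⟨_, (Nat.sub_add_cancel hN).symm⟩
  rw [Nat.add_sub_cancel, div_pow, ← Real.rpow_natCast (μ ^ (1 / m)) k, ← Real.rpow_mul hμ.le,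
    Real.rpow_neg hc.le, Real.rpow_natCast]
  have : μ ^ (((k + 1 : ℕ) : ℝ) / m - 1) = μ ^ (1 / m - 1) * μ ^ (1 / m * (k : ℝ)) := by
    rw [← Real.rpow_add hμ]; congr 1; push_cast; ring
  rw [this]
  field_simp
  ring

theorem image_rpow_div_Ioi {c m : ℝ} (hc : 0 < c) (hm : 0 < m) :
    (fun μ : ℝ => μ ^ (1 / m) / c) '' Set.Ioi 0 = Set.Ioi 0 := by
  ext r
  constructor
  · rintro ⟨μ, hμ, rfl⟩
    exact div_pos (Real.rpow_pos_of_pos hμ _) hc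
  · intro hr
    have hr' : (0 : ℝ) < r * c := mul_pos hr hc
    refine ⟨(r * c) ^ m, Real.rpow_pos_of_pos hr' _, ?_⟩
    simp only
    rw [← Real.rpow_mul hr'.le, mul_one_div_cancel hm.ne', Real.rpow_one]
    field_simp

theorem injOn_rpow_div_Ioi {c m : ℝ} (hc : 0 < c) (hm : 0 < m) :
    Set.InjOn (fun μ : ℝ => μ ^ (1 / m) / c) (Set.Ioi 0) := by
  intro x hx y hy h
  have h' : x ^ (1 / m) = y ^ (1 / m) := by
    have := congrArg (· * c) h
    simpa [hc.ne'] using this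
  exact (Real.rpow_left_inj (le_of_lt hx) (le_of_lt hy) (by positivity)).1 h'

theorem hasDerivWithinAt_rpow_div {c m : ℝ} {μ : ℝ} (hμ : 0 < μ) (s : Set ℝ) :
    HasDerivWithinAt (fun μ : ℝ => μ ^ (1 / m) / c) ((1 / m) * μ ^ (1 / m - 1) / c) s μ :=
  ((Real.hasDerivAt_rpow_const (Or.inl hμ.ne')).div_const c).hasDerivWithinAt

theorem lintegral_eq_lintegral_polarMap [Nontrivial E] {a : E → ℝ} {m : ℝ} (hm : 0 < m)
    (ha_pos : ∀ ξ, ξ ≠ 0 → 0 < a ξ) {F : E → ℝ≥0∞} (hF : Measurable F) :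
    ∫⁻ x, F x = ∫⁻ θ : Metric.sphere (0 : E) 1, (∫⁻ μ in Set.Ioi (0 : ℝ),
      ENNReal.ofReal (polarJac a m θ μ) * F (polarMap a m θ μ)) ∂(volume : Measure E).toSphere := by
  rw [lintegral_eq_lintegral_sphere_Ioi hF]
  congr 1 with θ
  have hc : 0 < a θ := ha_pos _ (ne_zero_of_mem_unit_sphere θ)
  conv_lhs => rw [← image_rpow_div_Ioi hc hm]
  rw [lintegral_image_eq_lintegral_abs_deriv_mul measurableSet_Ioi
    (fun μ hμ => hasDerivWithinAt_rpow_div hμ _) (injOn_rpow_div_Ioi hc hm)]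
  refine setLIntegral_congr_fun measurableSet_Ioi fun μ hμ => ?_
  have hμ' : 0 < μ := hμ
  have h0 : 0 ≤ (1 / m) * μ ^ (1 / m - 1) / a θ := by positivity
  rw [← mul_assoc, abs_of_nonneg h0, ← ENNReal.ofReal_mul h0,
    polar_substitution (Module.finrank_pos (R := ℝ) (M := E)) hc hm hμ', polarJac, polarMap]

theorem integral_eq_integral_polarMap [Nontrivial E] {a : E → ℝ} {m : ℝ} (hm : 0 < m)
    (ha_pos : ∀ ξ, ξ ≠ 0 → 0 < a ξ) {F : E → ℂ} (hF : Integrable F) :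
    ∫ x, F x = ∫ θ : Metric.sphere (0 : E) 1, (∫ μ in Set.Ioi (0 : ℝ),
      polarJac a m θ μ • F (polarMap a m θ μ)) ∂(volume : Measure E).toSphere := by
  rw [integral_eq_integral_sphere_Ioi hF]
  congr 1 with θ
  have hc : 0 < a θ := ha_pos _ (ne_zero_of_mem_unit_sphere θ)
  conv_lhs => rw [← image_rpow_div_Ioi hc hm]
  rw [integral_image_eq_integral_abs_deriv_smul measurableSet_Ioi
    (fun μ hμ => hasDerivWithinAt_rpow_div hμ _) (injOn_rpow_div_Ioi hc hm)]
  refine setIntegral_congr_fun measurableSet_Ioi fun μ hμ => ?_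
  have hμ' : 0 < μ := hμ
  have h0 : 0 ≤ (1 / m) * μ ^ (1 / m - 1) / a θ := by positivity
  rw [smul_smul, abs_of_nonneg h0, polar_substitution (Module.finrank_pos (R := ℝ) (M := E)) hc hm hμ', polarJac, polarMap]

end Polar

/-- The function `log r + r`, whose level sets of unit length have size `min r 1`. -/
def logAdd (r : ℝ) : ℝ := Real.log r + r

theorem measurable_logAdd : Measurable logAdd := by
  unfold logAdd; fun_prop

theorem hasDerivAt_logAdd {r : ℝ} (hr : 0 < r) : HasDerivAt logAdd ((1 + r) / r) r := by
  have := (Real.hasDerivAt_log hr.ne').add (hasDerivAt_id r)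
  have e : (1 + r) / r = r⁻¹ + 1 := by field_simp
  rw [e]; exact this

theorem strictMonoOn_logAdd : StrictMonoOn logAdd (Set.Ioi 0) := by
  intro x hx y hy h
  have := Real.log_lt_log hx h
  unfold logAdd; linarith

theorem image_logAdd_Ioi : logAdd '' Set.Ioi 0 = Set.univ := by
  refine Set.eq_univ_of_forall fun y => ?_
  set u := Real.exp (-|y| - 1) with hu
  have hu1 : u ≤ 1 := Real.exp_le_one_iff.2 (by linarith [abs_nonneg y])
  have hu0 : 0 < u := Real.exp_pos _
  have h1 : logAdd u ≤ y := by
    unfold logAdd; rw [hu, Real.log_exp, ← hu]; linarith [neg_abs_le y]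
  have h2 : y ≤ logAdd (|y| + 1) := by
    unfold logAdd
    have : 0 ≤ Real.log (|y| + 1) := Real.log_nonneg (by linarith [abs_nonneg y])
    linarith [le_abs_self y]
  have hc : ContinuousOn logAdd (Set.Icc u (|y| + 1)) := fun x hx =>
    (hasDerivAt_logAdd (hu0.trans_le hx.1)).continuousAt.continuousWithinAt
  obtain ⟨x, hx, rfl⟩ := intermediate_value_Icc (by linarith [abs_nonneg y]) hc ⟨h1, h2⟩
  exact ⟨x, hu0.trans_le hx.1, rfl⟩

theorem lintegral_logAdd_sub (F : ℝ → ℝ≥0∞) (c : ℝ) :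
    ∫⁻ ρ in Set.Ioi (0 : ℝ), ENNReal.ofReal ((1 + ρ) / ρ) * F (c - logAdd ρ) = ∫⁻ z, F z := by
  have h := lintegral_image_eq_lintegral_abs_deriv_mul measurableSet_Ioi
    (fun ρ hρ => (hasDerivAt_logAdd hρ).hasDerivWithinAt) strictMonoOn_logAdd.injOn
    (fun z => F (c - z))
  rw [image_logAdd_Ioi, Measure.restrict_univ, lintegral_sub_left_eq_self] at h
  rw [h]
  refine setLIntegral_congr_fun measurableSet_Ioi fun ρ hρ => ?_
  have hρ' : 0 < ρ := hρ
  rw [abs_of_nonneg (by positivity)]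

set_option linter.unusedSectionVars false

section Partition

variable {E : Type*} [NormedAddCommGroup E] [InnerProductSpace ℝ E] [FiniteDimensional ℝ E]
  [MeasurableSpace E] [BorelSpace E]

theorem apply_polarMap {a : E → ℝ} {m : ℝ}
    (ha_hom : ∀ t : ℝ, 0 < t → ∀ ξ, a (t • ξ) = t * a ξ)
    (ha_pos : ∀ ξ, ξ ≠ 0 → 0 < a ξ) (θ : Metric.sphere (0 : E) 1) {μ : ℝ} (hμ : 0 < μ) :
    a (polarMap a m θ μ) = μ ^ (1 / m) := by
  have hc : 0 < a θ := ha_pos _ (ne_zero_of_mem_unit_sphere θ)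
  rw [polarMap, ha_hom _ (by positivity)]
  field_simp

/-- Localising an integral to the shells where `logAdd ∘ a` is close to a constant. -/
theorem mul_enorm_integral_le_lintegral_shell [Nontrivial E] {a : E → ℝ} {m : ℝ} (hm : 0 < m)
    (ha_meas : Measurable a) (ha_hom : ∀ t : ℝ, 0 < t → ∀ ξ, a (t • ξ) = t * a ξ)
    (ha_pos : ∀ ξ, ξ ≠ 0 → 0 < a ξ) {b : ℝ → ℝ} (hb : Continuous b) (hbc : HasCompactSupport b)
    (hb1 : ∀ z, |b z| ≤ 1)    {Q : E → ℂ} (hQ : Integrable Q) :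
    (∫⁻ z, ENNReal.ofReal (b z ^ 2)) * ‖∫ ξ, Q ξ‖ₑ ≤
      ∫⁻ ρ in Set.Ioi (0 : ℝ), ENNReal.ofReal ((1 + ρ) / ρ) *
        ∫⁻ θ : Metric.sphere (0 : E) 1, ‖∫ μ in Set.Ioi (0 : ℝ),
          (polarJac a m θ μ * b (logAdd (μ ^ (1 / m)) - logAdd ρ) ^ 2) •
            Q (polarMap a m θ μ)‖ₑ ∂(volume : Measure E).toSphere := by
  have hb2 : Integrable (fun z => b z ^ 2) :=
    (hb.pow 2).integrable_of_hasCompactSupport (by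
      simpa [pow_two] using hbc.mul_left (f := b))
  have hbm : Measurable b := hb.measurable
  have hbB : ∀ z, ‖b z ^ 2‖ ≤ 1 := fun z => by
    rw [norm_pow]; exact pow_le_one₀ (norm_nonneg _) (hb1 z)
  set k : E → ℝ → ℝ := fun ξ ρ => (1 + ρ) / ρ * b (logAdd (a ξ) - logAdd ρ) ^ 2 with hk
  set ν : Measure ℝ := volume.restrict (Set.Ioi 0) with hν
  have hkm : Measurable (fun z : E × ℝ => k z.1 z.2) := by
    have := measurable_logAdd
    simp only [hk]; fun_prop
  have hk0 : ∀ ξ, ∀ ρ ∈ Set.Ioi (0 : ℝ), 0 ≤ k ξ ρ := fun ξ ρ hρ => by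
    have : (0 : ℝ) < ρ := hρ
    simp only [hk]; positivity
  have hl : ∀ ξ, ∫⁻ ρ, ENNReal.ofReal (k ξ ρ) ∂ν = ∫⁻ z, ENNReal.ofReal (b z ^ 2) := fun ξ => by
    rw [← lintegral_logAdd_sub (fun z => ENNReal.ofReal (b z ^ 2)) (logAdd (a ξ))]
    refine setLIntegral_congr_fun measurableSet_Ioi fun ρ hρ => ?_
    have : (0 : ℝ) < ρ := hρ
    simp only [hk]
    rw [ENNReal.ofReal_mul (by positivity)]
  have hfin : ∫⁻ z, ENNReal.ofReal (b z ^ 2) ≠ ⊤ := by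
    rw [← ofReal_integral_eq_lintegral_ofReal hb2 (.of_forall fun z => sq_nonneg _)]
    exact ENNReal.ofReal_ne_top
  have hki : ∀ ξ, ∫ ρ, k ξ ρ ∂ν = (∫⁻ z, ENNReal.ofReal (b z ^ 2)).toReal := fun ξ => by
    rw [integral_eq_lintegral_of_nonneg_ae, hl]
    · filter_upwards [ae_restrict_mem measurableSet_Ioi] with ρ hρ using hk0 ξ ρ hρ
    · exact (hkm.comp measurable_prodMk_left).aestronglyMeasurable
  have hint : Integrable (fun z : E × ℝ => k z.1 z.2 • Q z.1) (volume.prod ν) := by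
    refine ⟨hkm.aestronglyMeasurable.smul hQ.1.comp_fst, ?_⟩
    rw [hasFiniteIntegral_iff_enorm, lintegral_prod _ (by
      exact (hkm.aestronglyMeasurable.smul hQ.1.comp_fst).enorm)]
    calc _ = ∫⁻ ξ, (∫⁻ z, ENNReal.ofReal (b z ^ 2)) * ‖Q ξ‖ₑ := by
          congr 1 with ξ
          rw [← hl ξ, ← lintegral_mul_const _ (by
            exact (hkm.comp measurable_prodMk_left).ennreal_ofReal)]
          refine setLIntegral_congr_fun measurableSet_Ioi fun ρ hρ => ?_
          simp only [enorm_smul]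
          rw [Real.enorm_of_nonneg (hk0 ξ ρ hρ)]
      _ < ⊤ := by
          rw [lintegral_const_mul' _ _ hfin]
          exact ENNReal.mul_lt_top hfin.lt_top hQ.2
  have h1 : (∫⁻ z, ENNReal.ofReal (b z ^ 2)) * ‖∫ ξ, Q ξ‖ₑ
      = ‖∫ ρ, (∫ ξ, k ξ ρ • Q ξ) ∂ν‖ₑ := by
    rw [← integral_integral_swap hint]
    simp_rw [integral_smul_const, hki, integral_smul, enorm_smul]
    rw [Real.enorm_of_nonneg ENNReal.toReal_nonneg, ENNReal.ofReal_toReal hfin]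
  rw [h1]
  refine (enorm_integral_le_lintegral_enorm _).trans ?_
  refine setLIntegral_mono' measurableSet_Ioi fun ρ hρ => ?_
  have hρ' : (0 : ℝ) < ρ := hρ
  simp only [hk, mul_smul]
  rw [integral_smul, enorm_smul, Real.enorm_of_nonneg (by positivity)]
  gcongr
  have hIb : Integrable (fun ξ => b (logAdd (a ξ) - logAdd ρ) ^ 2 • Q ξ) := by
    refine hQ.bdd_smul 1 ?_ (.of_forall fun ξ => hbB _)
    have := measurable_logAdd
    exact Measurable.aestronglyMeasurable (by fun_prop)
  rw [integral_eq_integral_polarMap hm ha_pos hIb]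
  refine (enorm_integral_le_lintegral_enorm _).trans ?_
  refine lintegral_mono fun θ => le_of_eq ?_
  congr 1
  refine setIntegral_congr_fun measurableSet_Ioi fun μ hμ => ?_
  simp only [apply_polarMap ha_hom ha_pos θ hμ]

end Partition

theorem fourier_fourierChar_mul (v : ℝ → ℂ) (τ y : ℝ) :
    𝓕 (fun μ => (𝐞 (τ * μ) : ℂ) * v μ) y = 𝓕 v (y - τ) := by
  rw [Real.fourier_eq', Real.fourier_eq']
  congr 1 with μ
  simp only [smul_eq_mul, Real.fourierChar_apply, ← mul_assoc, ← Complex.exp_add]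
  congr 2
  simp
  ring

theorem enorm_integral_fourierChar_mul_conj_le {v u : ℝ → ℂ} (hv : Integrable v) (hv2 : MemLp v 2)
    (hu : Integrable u) (hu2 : MemLp u 2) (τ : ℝ) :
    ‖∫ μ, (𝐞 (τ * μ) : ℂ) * (v μ * conj (u μ))‖ₑ ≤ ∫⁻ y, ‖𝓕 v (y - τ)‖ₑ * ‖𝓕 u y‖ₑ := by
  have hm : AEStronglyMeasurable (fun μ : ℝ => (𝐞 (τ * μ) : ℂ)) volume :=
    Continuous.aestronglyMeasurable (by fun_prop)
  have hw : Integrable (fun μ => (𝐞 (τ * μ) : ℂ) * v μ) :=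
    hv.bdd_mul (c := 1) hm (.of_forall fun μ => (Circle.norm_coe _).le)
  have hw2 : MemLp (fun μ => (𝐞 (τ * μ) : ℂ) * v μ) 2 :=
    hv2.of_le (hm.mul hv2.1) (.of_forall fun μ => by
      rw [norm_mul, Circle.norm_coe, one_mul])
  have h := integral_conj_fourier_mul_fourier hu hu2 hw hw2
  simp only [mul_assoc] at h
  rw [← h]
  refine (enorm_integral_le_lintegral_enorm _).trans (le_of_eq ?_)
  congr 1 with y
  have := fourier_fourierChar_mul v τ y
  rw [this, enorm_mul]
  congr 1
  rw [← ofReal_norm, ← ofReal_norm, RCLike.norm_conj]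

theorem lintegral_shear_le {V U : ℝ → ℝ → ℝ≥0∞} (hV : Measurable (Function.uncurry V))
    (hU : Measurable (Function.uncurry U)) :
    ∫⁻ t, ∫⁻ s, ∫⁻ y, V s (y - (t - s)) * U t y ≤
      (∫⁻ y, (∫⁻ s, V s y ^ 2) ^ (1 / 2 : ℝ)) * ∫⁻ y, (∫⁻ t, U t y ^ 2) ^ (1 / 2 : ℝ) := by
  have mV : ∀ {α : Type} [MeasurableSpace α] {p q : α → ℝ}, Measurable p → Measurable q →
      Measurable (fun z => V (p z) (q z)) := fun hp hq => hV.comp (hp.prodMk hq)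
  have mU : ∀ {α : Type} [MeasurableSpace α] {p q : α → ℝ}, Measurable p → Measurable q →
      Measurable (fun z => U (p z) (q z)) := fun hp hq => hU.comp (hp.prodMk hq)
  calc ∫⁻ t, ∫⁻ s, ∫⁻ y, V s (y - (t - s)) * U t y
      = ∫⁻ t, ∫⁻ y, ∫⁻ z, V (t + (z - y)) z * U t y := by
        congr 1 with t
        rw [lintegral_lintegral_swap (by
          exact ((mV measurable_fst (by fun_prop)).mul
            (mU measurable_const measurable_snd)).aemeasurable)]
        congr 1 with y
        rw [← lintegral_add_right_eq_self (μ := volume) (fun z => V (t + (z - y)) z * U t y)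
          (y - t)]
        congr 1 with s
        congr 2 <;> ring
    _ = ∫⁻ y, ∫⁻ z, ∫⁻ t, V (t + (z - y)) z * U t y := by
        rw [lintegral_lintegral_swap (by
          refine Measurable.aemeasurable ?_
          refine Measurable.lintegral_prod_right' (f := fun w : (ℝ × ℝ) × ℝ =>
            V (w.1.1 + (w.2 - w.1.2)) w.2 * U w.1.1 w.1.2) ?_
          exact (mV (by fun_prop) (by fun_prop)).mul (mU (by fun_prop) (by fun_prop)))]
        congr 1 with y
        rw [lintegral_lintegral_swap (by
          exact ((mV (by fun_prop) (by fun_prop)).mul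
            (mU (by fun_prop) (by fun_prop))).aemeasurable)]
    _ ≤ ∫⁻ y, ∫⁻ z, (∫⁻ s, V s z ^ 2) ^ (1 / 2 : ℝ) * (∫⁻ t, U t y ^ 2) ^ (1 / 2 : ℝ) := by
        refine lintegral_mono fun y => lintegral_mono fun z => ?_
        have h := ENNReal.lintegral_mul_le_Lp_mul_Lq volume Real.HolderConjugate.two_two
          (f := fun t => V (t + (z - y)) z) (g := fun t => U t y)
          (mV (by fun_prop) (by fun_prop)).aemeasurable
          (mU (by fun_prop) (by fun_prop)).aemeasurable
        simp only [ENNReal.rpow_ofNat, Pi.mul_apply] at h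
        rwa [lintegral_add_right_eq_self (μ := volume) (fun t => V t z ^ 2) (z - y)] at h
    _ = _ := by
        have m1 : Measurable fun z => (∫⁻ s, V s z ^ 2) ^ (1 / 2 : ℝ) :=
          (Measurable.lintegral_prod_left' (f := fun w : ℝ × ℝ => V w.1 w.2 ^ 2)
            ((mV (by fun_prop) (by fun_prop)).pow_const 2)).pow_const _
        have m2 : Measurable fun z => (∫⁻ s, U s z ^ 2) ^ (1 / 2 : ℝ) :=
          (Measurable.lintegral_prod_left' (f := fun w : ℝ × ℝ => U w.1 w.2 ^ 2)
            ((mU (by fun_prop) (by fun_prop)).pow_const 2)).pow_const _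
        simp_rw [lintegral_mul_const _ m1]
        rw [lintegral_const_mul _ m2]

/-- The `L¹` norm of a square root is controlled by a weighted `L¹` norm. -/
theorem exists_sq_lintegral_sqrt_le {q : ℝ} (hq : 1 < q) :
    ∃ C : ℝ≥0∞, C ≠ ⊤ ∧ ∀ {M : ℝ}, 0 < M → ∀ {P : ℝ → ℝ≥0∞}, Measurable P →
      (∫⁻ y, P y ^ (1 / 2 : ℝ)) ^ 2 ≤
        C * (ENNReal.ofReal M⁻¹ * ∫⁻ y, ENNReal.ofReal ((1 + M * |y|) ^ q) * P y) := by
  have hI : Integrable (fun y : ℝ => (1 + |y|) ^ (-q)) :=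
    integrable_one_add_norm (by simpa using hq)
  refine ⟨∫⁻ y : ℝ, ENNReal.ofReal ((1 + |y|) ^ (-q)), ?_, ?_⟩
  · rw [← ofReal_integral_eq_lintegral_ofReal hI (.of_forall fun y => by positivity)]
    exact ENNReal.ofReal_ne_top
  intro M hM P hP
  have h0 : ∀ y : ℝ, 0 < 1 + M * |y| := fun y => by positivity
  have hs : ∫⁻ y : ℝ, ENNReal.ofReal ((1 + M * |y|) ^ (-q)) =
      ENNReal.ofReal M⁻¹ * ∫⁻ y : ℝ, ENNReal.ofReal ((1 + |y|) ^ (-q)) := by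
    have := (integrable_comp_mul_left_iff (fun y : ℝ => (1 + |y|) ^ (-q)) hM.ne').2 hI
    have e : ∀ y : ℝ, 1 + M * |y| = 1 + |M * y| := fun y => by rw [abs_mul, abs_of_pos hM]
    simp_rw [e]
    rw [← ofReal_integral_eq_lintegral_ofReal this (.of_forall fun y => by positivity),
      ← ofReal_integral_eq_lintegral_ofReal hI (.of_forall fun y => by positivity),
      Measure.integral_comp_mul_left (fun y : ℝ => (1 + |y|) ^ (-q)), smul_eq_mul,
      abs_of_pos (inv_pos.2 hM), ENNReal.ofReal_mul (by positivity)]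
  calc (∫⁻ y, P y ^ (1 / 2 : ℝ)) ^ 2
      = (∫⁻ y, ENNReal.ofReal ((1 + M * |y|) ^ (-q / 2)) *
          (ENNReal.ofReal ((1 + M * |y|) ^ (q / 2)) * P y ^ (1 / 2 : ℝ))) ^ 2 := by
        congr 2 with y
        rw [← mul_assoc, ← ENNReal.ofReal_mul (by positivity), ← Real.rpow_add (h0 y)]
        simp [neg_div]
    _ ≤ (∫⁻ y, ENNReal.ofReal ((1 + M * |y|) ^ (-q / 2)) ^ 2) *
          ∫⁻ y, (ENNReal.ofReal ((1 + M * |y|) ^ (q / 2)) * P y ^ (1 / 2 : ℝ)) ^ 2 :=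
        sq_lintegral_mul_le (by fun_prop) (by fun_prop)
    _ = (∫⁻ y, ENNReal.ofReal ((1 + M * |y|) ^ (-q))) *
          ∫⁻ y, ENNReal.ofReal ((1 + M * |y|) ^ q) * P y := by
        congr 2
        · ext y
          rw [← ENNReal.ofReal_pow (by positivity), ← Real.rpow_natCast, ← Real.rpow_mul (h0 y).le]
          congr 2; push_cast; ring
        · ext y
          rw [mul_pow, ← ENNReal.ofReal_pow (by positivity), ← Real.rpow_natCast,
            ← Real.rpow_mul (h0 y).le, ← ENNReal.rpow_natCast, ← ENNReal.rpow_mul]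
          norm_num
    _ = _ := by rw [hs]; ring

section Shell

theorem le_exp_mul_of_logAdd_sub_le {r ρ : ℝ} (hρ : 0 < ρ)
    (h : logAdd r - logAdd ρ ≤ 1) : r ≤ Real.exp 1 * ρ := by
  by_contra! hlt
  have h1 : ρ < r := by
    refine lt_of_le_of_lt ?_ hlt
    nlinarith [Real.add_one_le_exp (1 : ℝ)]
  have h2 : Real.log (Real.exp 1 * ρ) < Real.log r := Real.log_lt_log (by positivity) hlt
  rw [Real.log_mul (Real.exp_pos _).ne' hρ.ne', Real.log_exp] at h2
  unfold logAdd at h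
  linarith

theorem sub_le_of_logAdd_sub_le {r ρ : ℝ} (hρ : 0 < ρ)
    (h : logAdd r - logAdd ρ ≤ 1) : r - ρ ≤ 1 := by
  by_contra! hlt
  have h2 : Real.log ρ < Real.log r := Real.log_lt_log hρ (by linarith)
  unfold logAdd at h
  linarith

theorem div_rpow_le_of_logAdd_sub_le {r ρ m x y : ℝ} (hr : 0 < r) (hρ : 0 < ρ) (hm : 0 < m)
    (h : logAdd ρ - logAdd r ≤ 1) (hx : x ≤ Real.exp 1 * y) (hy : 0 ≤ y) :
    x / r ^ m ≤ Real.exp (m + 1) * (y / ρ ^ m) := by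
  have h1 := le_exp_mul_of_logAdd_sub_le hr h
  have h2 : ρ ^ m ≤ Real.exp m * r ^ m := by
    calc ρ ^ m ≤ (Real.exp 1 * r) ^ m := by gcongr
      _ = _ := by rw [Real.mul_rpow (Real.exp_pos _).le hr.le, ← Real.exp_mul, one_mul]
  have hr' : 0 < r ^ m := by positivity
  have hρ' : 0 < ρ ^ m := by positivity
  rw [div_le_iff₀ hr', Real.exp_add, mul_div_assoc', div_mul_eq_mul_div, le_div_iff₀ hρ']
  calc x * ρ ^ m ≤ (Real.exp 1 * y) * ρ ^ m := by gcongr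
    _ ≤ (Real.exp 1 * y) * (Real.exp m * r ^ m) := by gcongr
    _ = _ := by ring

end Shell

section Profile

variable {E : Type*} [NormedAddCommGroup E] [InnerProductSpace ℝ E] [FiniteDimensional ℝ E]
  [MeasurableSpace E] [BorelSpace E]

/-- The square root of the Jacobian times the symbol `(1 + k |ξ|²) ^ ((m - 1) / 2)`. -/
def amplitude (a : E → ℝ) (m k : ℝ) (θ : Metric.sphere (0 : E) 1) (μ : ℝ) : ℝ :=
  √(polarJac a m θ μ * (1 + k * ‖polarMap a m θ μ‖ ^ 2) ^ ((m - 1) / 2))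

/-- The restriction of `G` to the ray of `θ`, localised to a shell. -/
def profile (b : ℝ → ℝ) (a : E → ℝ) (m k ρ : ℝ) (θ : Metric.sphere (0 : E) 1) (G : E → ℂ) :
    ℝ → ℂ :=
  (Set.Ioi (0 : ℝ)).indicator fun μ =>
    ((b (logAdd (μ ^ (1 / m)) - logAdd ρ) * amplitude a m k θ μ : ℝ) : ℂ) * G (polarMap a m θ μ)

/-- The points at which `logAdd ∘ a` is close to `logAdd ρ`. -/
def shell (a : E → ℝ) (ρ : ℝ) : Set E := {η | 0 < a η ∧ |logAdd (a η) - logAdd ρ| ≤ 1}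

theorem polarJac_nonneg {a : E → ℝ} {m : ℝ} (hm : 0 < m) {θ : Metric.sphere (0 : E) 1}
    (ha : 0 < a θ) {μ : ℝ} (hμ : 0 < μ) : 0 < polarJac a m θ μ := by
  unfold polarJac; positivity

theorem norm_polarMap {a : E → ℝ} {m : ℝ} {θ : Metric.sphere (0 : E) 1}
    (ha : 0 < a θ) {μ : ℝ} (hμ : 0 < μ) : ‖polarMap a m θ μ‖ = μ ^ (1 / m) / a θ := by
  rw [polarMap, norm_smul, norm_eq_of_mem_sphere θ, mul_one, Real.norm_of_nonneg (by positivity)]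

theorem exists_hasDerivAt_amplitude {a : E → ℝ} {m k : ℝ} (hm : 1 < m) (hk : 0 ≤ k)
    {θ : Metric.sphere (0 : E) 1} (ha : 0 < a θ) {μ : ℝ} (hμ : 0 < μ) :
    ∃ d, HasDerivAt (amplitude a m k θ) d μ ∧
      |d| ≤ ((Module.finrank ℝ E : ℝ) / m + 2) * (amplitude a m k θ μ / μ) := by
  set n : ℝ := (Module.finrank ℝ E : ℝ) with hn
  have hm0 : 0 < m := by linarith
  set K : ℝ := k / a θ ^ 2 with hK
  have hK0 : 0 ≤ K := by positivity
  set c : ℝ := a θ ^ (-n) / m with hc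
  have hc0 : 0 < c := by positivity
  set D : ℝ → ℝ := fun μ => c * μ ^ (n / m - 1) * (1 + K * μ ^ (2 / m)) ^ ((m - 1) / 2) with hD
  have hamp : ∀ μ : ℝ, 0 < μ → amplitude a m k θ μ = √(D μ) := by
    intro μ hμ
    have e : (μ ^ (1 / m)) ^ 2 = μ ^ (2 / m) := by
      rw [← Real.rpow_natCast, ← Real.rpow_mul hμ.le]; congr 1; push_cast; ring
    rw [amplitude, norm_polarMap ha hμ, polarJac, div_pow, e]
    simp only [hD, hc, hK]
    congr 2
    · ring
    · congr 1; ring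
  have hp : 0 < 1 + K * μ ^ (2 / m) := by positivity
  have hD0 : 0 < D μ := by simp only [hD]; positivity
  have d1 : HasDerivAt (fun μ : ℝ => c * μ ^ (n / m - 1)) (c * ((n / m - 1) * μ ^ (n / m - 1 - 1))) μ :=
    (Real.hasDerivAt_rpow_const (Or.inl hμ.ne')).const_mul c
  have d2 : HasDerivAt (fun μ : ℝ => 1 + K * μ ^ (2 / m)) (K * ((2 / m) * μ ^ (2 / m - 1))) μ :=
    ((Real.hasDerivAt_rpow_const (Or.inl hμ.ne')).const_mul K).const_add 1
  have d3 := d2.rpow_const (p := (m - 1) / 2) (Or.inl hp.ne')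
  have d4 : HasDerivAt D _ μ := d1.mul d3
  have d5 := d4.sqrt hD0.ne'
  have hev : amplitude a m k θ =ᶠ[nhds μ] fun μ => √(D μ) := by
    filter_upwards [Ioi_mem_nhds hμ] with x hx using hamp x hx
  refine ⟨_, d5.congr_of_eventuallyEq hev, ?_⟩
  have e1 : c * ((n / m - 1) * μ ^ (n / m - 1 - 1)) * (1 + K * μ ^ (2 / m)) ^ ((m - 1) / 2) +
      c * μ ^ (n / m - 1) * (K * ((2 / m) * μ ^ (2 / m - 1)) * ((m - 1) / 2) *
        (1 + K * μ ^ (2 / m)) ^ ((m - 1) / 2 - 1)) =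
      D μ * (((n / m - 1) + (m - 1) / m * (K * μ ^ (2 / m) / (1 + K * μ ^ (2 / m)))) / μ) := by
    rw [Real.rpow_sub_one hμ.ne' (n / m - 1), Real.rpow_sub_one hμ.ne' (2 / m),
      Real.rpow_sub_one hp.ne']
    simp only [hD]
    field_simp
  rw [e1, hamp μ hμ]
  have hs : 0 < √(D μ) := Real.sqrt_pos.2 hD0
  have e2 : D μ * (((n / m - 1) + (m - 1) / m * (K * μ ^ (2 / m) / (1 + K * μ ^ (2 / m)))) / μ) /
      (2 * √(D μ)) = √(D μ) / μ *
        (((n / m - 1) + (m - 1) / m * (K * μ ^ (2 / m) / (1 + K * μ ^ (2 / m)))) / 2) := by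
    nth_rewrite 1 [← Real.mul_self_sqrt hD0.le]
    field_simp
  rw [e2, abs_mul, abs_of_pos (div_pos hs hμ), mul_comm]
  gcongr
  have f1 : 0 ≤ K * μ ^ (2 / m) / (1 + K * μ ^ (2 / m)) := by positivity
  have f2 : K * μ ^ (2 / m) / (1 + K * μ ^ (2 / m)) ≤ 1 := by
    rw [div_le_one hp]; linarith
  have f3 : 0 ≤ (m - 1) / m := div_nonneg (by linarith) hm0.le
  have f4 : (m - 1) / m ≤ 1 := by rw [div_le_one hm0]; linarith
  have f5 : 0 ≤ n / m := by positivity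
  have f6 := mul_nonneg f3 f1
  have f7 := mul_le_one₀ f4 f1 f2
  rw [abs_le]
  constructor <;> linarith

end Profile

section ProfileDeriv

variable {E : Type*} [NormedAddCommGroup E] [InnerProductSpace ℝ E] [FiniteDimensional ℝ E]
  [MeasurableSpace E] [BorelSpace E]

/-- The values of `a ^ m` on the shell of size `ρ`. -/
def levels (m ρ : ℝ) : Set ℝ := {μ | 0 < μ ∧ |logAdd (μ ^ (1 / m)) - logAdd ρ| ≤ 1}

theorem rpow_one_div_rpow {m μ : ℝ} (hm : 0 < m) (hμ : 0 < μ) : (μ ^ (1 / m)) ^ m = μ := by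
  rw [← Real.rpow_mul hμ.le, one_div_mul_cancel hm.ne', Real.rpow_one]

theorem levels_subset_Icc {m ρ : ℝ} (hm : 0 < m) (hρ : 0 < ρ) :
    levels m ρ ⊆ Set.Icc ((ρ / Real.exp 1) ^ m) ((Real.exp 1 * ρ) ^ m) := by
  rintro μ ⟨hμ, h⟩
  have hr : 0 < μ ^ (1 / m) := by positivity
  rw [abs_le] at h
  have h1 := le_exp_mul_of_logAdd_sub_le hρ h.2
  have h2 := le_exp_mul_of_logAdd_sub_le (r := ρ) hr (by linarith [h.1])
  rw [← rpow_one_div_rpow hm hμ]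
  constructor
  · gcongr
    rw [div_le_iff₀ (Real.exp_pos _)]; linarith
  · gcongr

theorem hasDerivAt_polarMap {a : E → ℝ} {m : ℝ} (θ : Metric.sphere (0 : E) 1) {μ : ℝ}
    (hμ : 0 < μ) :
    HasDerivAt (polarMap a m θ) (((1 / m) * μ ^ (1 / m - 1) / a θ) • (θ : E)) μ :=
  ((Real.hasDerivAt_rpow_const (Or.inl hμ.ne')).div_const (a θ)).smul_const (θ : E)

theorem profile_eq_zero {b : ℝ → ℝ} (hb0 : ∀ z, 1 < |z| → b z = 0) {a : E → ℝ} {m k ρ : ℝ}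
    {θ : Metric.sphere (0 : E) 1} {G : E → ℂ} {μ : ℝ} (hμ : μ ∉ levels m ρ) :
    profile b a m k ρ θ G μ = 0 := by
  by_cases h : 0 < μ
  · have : 1 < |logAdd (μ ^ (1 / m)) - logAdd ρ| := by
      by_contra! h'
      exact hμ ⟨h, h'⟩
    rw [profile, Set.indicator_of_mem (Set.mem_Ioi.2 h), hb0 _ this]; simp
  · simp [profile, h]

theorem profile_eventuallyEq_zero {b : ℝ → ℝ} (hb0 : ∀ z, 1 < |z| → b z = 0) {a : E → ℝ}
    {m k ρ : ℝ} (hm : 0 < m) (hρ : 0 < ρ)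
    {θ : Metric.sphere (0 : E) 1} {G : E → ℂ} {μ : ℝ} (hμ : μ ∉ levels m ρ) :
    profile b a m k ρ θ G =ᶠ[nhds μ] 0 := by
  by_cases h : 0 < μ
  · have h1 : 1 < |logAdd (μ ^ (1 / m)) - logAdd ρ| := by
      by_contra! h'
      exact hμ ⟨h, h'⟩
    have hr : 0 < μ ^ (1 / m) := by positivity
    have hc : ContinuousAt (fun μ : ℝ => |logAdd (μ ^ (1 / m)) - logAdd ρ|) μ := by
      have := (hasDerivAt_logAdd hr).continuousAt.comp
        (f := fun μ : ℝ => μ ^ (1 / m)) (Real.continuousAt_rpow_const μ _ (Or.inl h.ne'))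
      exact (this.sub continuousAt_const).abs
    filter_upwards [hc.eventually (lt_mem_nhds h1)] with x hx
    exact profile_eq_zero hb0 fun hx' => not_lt.2 hx'.2 hx
  · have : μ < (ρ / Real.exp 1) ^ m := lt_of_le_of_lt (not_lt.1 h) (by positivity)
    filter_upwards [Iio_mem_nhds this] with x hx
    exact profile_eq_zero hb0 fun hx' => not_lt.2 (levels_subset_Icc hm hρ hx').1 hx

theorem norm_profile_le {b : ℝ → ℝ} (hb1 : ∀ z, |b z| ≤ 1) (hb0 : ∀ z, 1 < |z| → b z = 0)
    {a : E → ℝ} {m k ρ : ℝ} {θ : Metric.sphere (0 : E) 1} {G : E → ℂ} (μ : ℝ) :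
    ‖profile b a m k ρ θ G μ‖ ≤
      (levels m ρ).indicator (fun μ => amplitude a m k θ μ * ‖G (polarMap a m θ μ)‖) μ := by
  by_cases hμ : μ ∈ levels m ρ
  · have hμ0 : 0 < μ := hμ.1
    have h0 : 0 ≤ amplitude a m k θ μ := Real.sqrt_nonneg _
    rw [Set.indicator_of_mem hμ, profile, Set.indicator_of_mem (Set.mem_Ioi.2 hμ0), norm_mul,
      Complex.norm_real, norm_mul, Real.norm_of_nonneg h0]
    gcongr
    exact mul_le_of_le_one_left h0 (hb1 _)
  · rw [Set.indicator_of_notMem hμ, profile_eq_zero hb0 hμ, norm_zero]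

theorem exists_hasDerivAt_profile {b : ℝ → ℝ} (hb : ContDiff ℝ 1 b) (hb1 : ∀ z, |b z| ≤ 1)
    (hb0 : ∀ z, 1 < |z| → b z = 0) {B : ℝ} (hB : ∀ z, |deriv b z| ≤ B)
    {a : E → ℝ} {m k a₀ : ℝ} (hm : 1 < m) (hk : 0 ≤ k) (ha₀ : 0 < a₀)
    {θ : Metric.sphere (0 : E) 1} (ha : a₀ ≤ a θ) {ρ : ℝ} (hρ : 0 < ρ) {G : E → ℂ}
    (hG : Differentiable ℝ G) (μ : ℝ) :
    ∃ d, HasDerivAt (profile b a m k ρ θ G) d μ ∧ ‖d‖ ≤ (levels m ρ).indicator (fun μ =>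
      (Real.exp (m + 1) * (B + ((Module.finrank ℝ E : ℝ) / m + 2) + 1 / a₀)) * ((1 + ρ) / ρ ^ m) *
        (amplitude a m k θ μ *
        (‖G (polarMap a m θ μ)‖ + ρ / (1 + ρ) * ‖fderiv ℝ G (polarMap a m θ μ)‖))) μ := by
  have hm0 : 0 < m := by linarith
  by_cases hμ : μ ∈ levels m ρ
  swap
  · refine ⟨0, (hasDerivAt_const μ (0 : ℂ)).congr_of_eventuallyEq
      (profile_eventuallyEq_zero hb0 hm0 hρ hμ), ?_⟩
    rw [Set.indicator_of_notMem hμ, norm_zero]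
  obtain ⟨hμ0, hs⟩ := id hμ
  rw [Set.indicator_of_mem hμ]
  have hr : 0 < μ ^ (1 / m) := by positivity
  have haθ : 0 < a θ := ha₀.trans_le ha
  set r := μ ^ (1 / m) with hrdef
  have hrm : r ^ m = μ := rpow_one_div_rpow hm0 hμ0
  have hr' : μ ^ (1 / m - 1) = r / μ := Real.rpow_sub_one hμ0.ne' _
  obtain ⟨d, hd, hdle⟩ := exists_hasDerivAt_amplitude (a := a) (k := k) hm hk haθ hμ0
  set A := amplitude a m k θ μ with hA
  have hA0 : 0 ≤ A := Real.sqrt_nonneg _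
  have e1 : HasDerivAt (fun μ : ℝ => μ ^ (1 / m)) (1 / m * (r / μ)) μ := by
    rw [← hr']; exact Real.hasDerivAt_rpow_const (Or.inl hμ0.ne')
  have e2 : HasDerivAt (fun μ : ℝ => logAdd (μ ^ (1 / m)) - logAdd ρ)
      ((1 + r) / r * (1 / m * (r / μ))) μ :=
    ((hasDerivAt_logAdd hr).comp μ e1).sub_const _
  have e3 : HasDerivAt (fun μ : ℝ => b (logAdd (μ ^ (1 / m)) - logAdd ρ))
      (deriv b (logAdd r - logAdd ρ) * ((1 + r) / r * (1 / m * (r / μ)))) μ :=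
    ((hb.differentiable one_ne_zero _).hasDerivAt).comp μ e2
  have e4 := (e3.mul hd).ofReal_comp
  have e5 := hasDerivAt_polarMap (a := a) (m := m) θ hμ0
  rw [hr'] at e5
  have e6 : HasDerivAt (fun μ => G (polarMap a m θ μ)) _ μ :=
    (hG _).hasFDerivAt.comp_hasDerivAt μ e5
  have e7 := e4.mul e6
  have hev : profile b a m k ρ θ G =ᶠ[nhds μ] fun μ =>
      ((b (logAdd (μ ^ (1 / m)) - logAdd ρ) * amplitude a m k θ μ : ℝ) : ℂ) *
        G (polarMap a m θ μ) := by
    filter_upwards [Ioi_mem_nhds hμ0] with x hx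
    rw [profile, Set.indicator_of_mem hx]
  refine ⟨_, HasDerivAt.congr_of_eventuallyEq e7 hev, ?_⟩
  rw [abs_le] at hs
  have hr2 : 0 < 1 + r := by positivity
  have g1 : r ≤ Real.exp 1 * ρ := le_exp_mul_of_logAdd_sub_le hρ hs.2
  have g2 : 1 + r ≤ Real.exp 1 * (1 + ρ) := by
    have := Real.add_one_le_exp (1 : ℝ)
    linarith
  have g3 := div_rpow_le_of_logAdd_sub_le hr hρ hm0 (by linarith [hs.1]) g2 (by positivity)
  have g4 := div_rpow_le_of_logAdd_sub_le hr hρ hm0 (by linarith [hs.1]) g1 hρ.le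
  rw [hrm] at g3 g4
  set X := (1 + ρ) / ρ ^ m with hX
  have hX0 : 0 < X := by positivity
  have hB0 : 0 ≤ B := (abs_nonneg _).trans (hB 0)
  have hbz : |b (logAdd r - logAdd ρ)| ≤ 1 := hb1 _
  have hinv : 1 / m ≤ 1 := by rw [div_le_one hm0]; exact hm.le
  have k1 : |deriv b (logAdd r - logAdd ρ) * ((1 + r) / r * (1 / m * (r / μ)))|
      ≤ B * (Real.exp (m + 1) * X) := by
    rw [abs_mul]
    have : (1 + r) / r * (1 / m * (r / μ)) = 1 / m * ((1 + r) / μ) := by field_simp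
    rw [this, abs_of_nonneg (by positivity : 0 ≤ 1 / m * ((1 + r) / μ))]
    have h1 : 1 / m * ((1 + r) / μ) ≤ Real.exp (m + 1) * X :=
      (mul_le_of_le_one_left (by positivity) hinv).trans g3
    gcongr
    exact hB _
  have k2 : |d| ≤ ((Module.finrank ℝ E : ℝ) / m + 2) * (A * (Real.exp (m + 1) * X)) := by
    refine hdle.trans ?_
    have h1 : μ⁻¹ ≤ (1 + r) / μ := by rw [← one_div]; gcongr; linarith
    rw [div_eq_mul_inv A μ]
    exact mul_le_mul_of_nonneg_left (mul_le_mul_of_nonneg_left (h1.trans g3) hA0) (by positivity)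
  have k3 : 1 / m * (r / μ) / a θ ≤ 1 / a₀ * (Real.exp (m + 1) * (ρ / (1 + ρ) * X)) := by
    have h1 : ρ / (1 + ρ) * X = ρ / ρ ^ m := by rw [hX]; field_simp
    rw [h1, div_eq_mul_one_div, mul_comm]
    exact mul_le_mul (one_div_le_one_div_of_le ha₀ ha)
      ((mul_le_of_le_one_left (by positivity) hinv).trans g4) (by positivity) (by positivity)
  set g := ‖G (polarMap a m θ μ)‖ with hg
  set g' := ‖fderiv ℝ G (polarMap a m θ μ)‖ with hg'
  have k4 : ‖(fderiv ℝ G (polarMap a m θ μ)) ((1 / m * (r / μ) / a θ) • (θ : E))‖ ≤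
      g' * (1 / a₀ * (Real.exp (m + 1) * (ρ / (1 + ρ) * X))) := by
    refine (ContinuousLinearMap.le_opNorm _ _).trans ?_
    rw [norm_smul, norm_eq_of_mem_sphere θ, mul_one,
      Real.norm_of_nonneg (by positivity : 0 ≤ 1 / m * (r / μ) / a θ)]
    gcongr
  refine (norm_add_le _ _).trans ?_
  rw [norm_mul, norm_mul, Complex.norm_real, Complex.norm_real, ← hg]
  have k5 : ‖deriv b (logAdd r - logAdd ρ) * ((1 + r) / r * (1 / m * (r / μ))) * A +
      b (logAdd r - logAdd ρ) * d‖ ≤ B * (Real.exp (m + 1) * X) * A +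
        ((Module.finrank ℝ E : ℝ) / m + 2) * (A * (Real.exp (m + 1) * X)) := by
    refine (norm_add_le _ _).trans ?_
    rw [norm_mul _ A, norm_mul _ d, Real.norm_of_nonneg hA0]
    refine add_le_add (mul_le_mul_of_nonneg_right k1 hA0) ?_
    exact (mul_le_of_le_one_left (abs_nonneg d) hbz).trans k2
  have k6 : ‖b (logAdd r - logAdd ρ) * A‖ ≤ A := by
    rw [norm_mul, Real.norm_of_nonneg hA0]
    exact mul_le_of_le_one_left hA0 hbz
  have hn : 0 ≤ (Module.finrank ℝ E : ℝ) / m := by positivity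
  calc _ ≤ (B * (Real.exp (m + 1) * X) * A +
        ((Module.finrank ℝ E : ℝ) / m + 2) * (A * (Real.exp (m + 1) * X))) * g +
        A * (g' * (1 / a₀ * (Real.exp (m + 1) * (ρ / (1 + ρ) * X)))) := by
        gcongr
        exact k6
    _ ≤ _ := by
        have p1 : 0 ≤ Real.exp (m + 1) * X * A * g * (1 / a₀) := by positivity
        have p2 : 0 ≤ Real.exp (m + 1) * X * A * (ρ / (1 + ρ) * g') *
          (B + ((Module.finrank ℝ E : ℝ) / m + 2)) := by positivity
        linarith

end ProfileDeriv

theorem integrable_and_memLp_two_of_norm_le_indicator {f : ℝ → ℂ} (hf : Measurable f) {c d K : ℝ}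
    (h : ∀ x, ‖f x‖ ≤ (Set.Icc c d).indicator (fun _ => K) x) :
    Integrable f ∧ MemLp f 2 := by
  have h1 : ∀ p : ℝ≥0∞, MemLp ((Set.Icc c d).indicator (fun _ : ℝ => K)) p := fun p =>
    memLp_indicator_const p measurableSet_Icc K (Or.inr (by simp))
  exact ⟨memLp_one_iff_integrable.1 ((h1 1).mono' hf.aestronglyMeasurable (.of_forall h)),
    (h1 2).mono' hf.aestronglyMeasurable (.of_forall h)⟩

theorem measurableSet_levels (m ρ : ℝ) : MeasurableSet (levels m ρ) := by
  have := measurable_logAdd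
  have h : Measurable fun μ : ℝ => |logAdd (μ ^ (1 / m)) - logAdd ρ| :=
    ((this.comp (measurable_id.pow_const _)).sub_const _).norm
  exact (measurableSet_lt measurable_const measurable_id).inter
    (measurableSet_le h measurable_const)

section ShellPlancherel

variable {E : Type*} [NormedAddCommGroup E] [InnerProductSpace ℝ E] [FiniteDimensional ℝ E]
  [MeasurableSpace E] [BorelSpace E]

theorem measurableSet_shell {a : E → ℝ} (ha : Measurable a) (ρ : ℝ) :
    MeasurableSet (shell a ρ) := by
  have h : Measurable fun η : E => |logAdd (a η) - logAdd ρ| :=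
    ((measurable_logAdd.comp ha).sub_const _).norm
  exact (measurableSet_lt measurable_const ha).inter
    (measurableSet_le h measurable_const)

theorem Measurable.polarMap {α : Type*} [MeasurableSpace α] {a : E → ℝ} {m : ℝ} (ha : Measurable a)
    {θ : α → Metric.sphere (0 : E) 1} {μ : α → ℝ} (hθ : Measurable θ) (hμ : Measurable μ) :
    Measurable fun z => polarMap a m (θ z) (μ z) := by
  unfold _root_.polarMap
  exact Measurable.smul (by fun_prop) (by fun_prop)

theorem Measurable.amplitude {α : Type*} [MeasurableSpace α] {a : E → ℝ} {m k : ℝ}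
    (ha : Measurable a) {θ : α → Metric.sphere (0 : E) 1} {μ : α → ℝ} (hθ : Measurable θ)
    (hμ : Measurable μ) : Measurable fun z => amplitude a m k (θ z) (μ z) := by
  have := Measurable.polarMap (m := m) ha hθ hμ
  unfold _root_.amplitude polarJac
  fun_prop

theorem Measurable.profile {α : Type*} [MeasurableSpace α] {b : ℝ → ℝ} (hb : Measurable b)
    {a : E → ℝ} {m k : ℝ} (ha : Measurable a) {ρ : α → ℝ} {θ : α → Metric.sphere (0 : E) 1}
    {G : α → E → ℂ} {μ : α → ℝ} (hρ : Measurable ρ) (hθ : Measurable θ) (hμ : Measurable μ)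
    (hG : Measurable fun z => G z (_root_.polarMap a m (θ z) (μ z))) :
    Measurable fun z => profile b a m k (ρ z) (θ z) (G z) (μ z) := by
  have h1 := Measurable.amplitude (m := m) (k := k) ha hθ hμ
  have h2 := measurable_logAdd
  have : (fun z => _root_.profile b a m k (ρ z) (θ z) (G z) (μ z)) =
      {z | 0 < μ z}.indicator fun z =>
        ((b (logAdd (μ z ^ (1 / m)) - logAdd (ρ z)) * _root_.amplitude a m k (θ z) (μ z) : ℝ) : ℂ) *
          G z (_root_.polarMap a m (θ z) (μ z)) := by
    ext z
    by_cases h : 0 < μ z <;> simp [_root_.profile, h]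
  rw [this]
  exact ((Complex.measurable_ofReal.comp ((hb.comp ((h2.comp (hμ.pow_const _)).sub
    (h2.comp hρ))).mul h1)).mul hG).indicator (measurableSet_lt measurable_const hμ)

theorem exists_amplitude_le {a : E → ℝ} {m k ρ : ℝ} (hm : 1 < m) (hk : 0 ≤ k) (hρ : 0 < ρ)
    {θ : Metric.sphere (0 : E) 1} (ha : 0 < a θ) :
    ∃ K, 0 ≤ K ∧ ∀ μ ∈ levels m ρ, amplitude a m k θ μ ≤ K := by
  have hm0 : 0 < m := by linarith
  have hc : ContinuousOn (amplitude a m k θ)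
      (Set.Icc ((ρ / Real.exp 1) ^ m) ((Real.exp 1 * ρ) ^ m)) := fun μ hμ => by
    have : 0 < μ := lt_of_lt_of_le (by positivity) hμ.1
    obtain ⟨d, hd, -⟩ := exists_hasDerivAt_amplitude (a := a) (k := k) hm hk ha this
    exact hd.continuousAt.continuousWithinAt
  obtain ⟨K, hK⟩ := isCompact_Icc.exists_bound_of_continuousOn hc
  refine ⟨|K|, abs_nonneg _, fun μ hμ => ?_⟩
  exact (le_abs_self _).trans ((hK μ (levels_subset_Icc hm0 hρ hμ)).trans (le_abs_self _))

theorem indicator_levels_le {m ρ : ℝ} (hm : 0 < m) (hρ : 0 < ρ) {f : ℝ → ℝ} {K : ℝ} (hK : 0 ≤ K)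
    (h : ∀ μ ∈ levels m ρ, f μ ≤ K) (μ : ℝ) : (levels m ρ).indicator f μ ≤
      (Set.Icc ((ρ / Real.exp 1) ^ m) ((Real.exp 1 * ρ) ^ m)).indicator (fun _ => K) μ := by
  by_cases hμ : μ ∈ levels m ρ
  · rw [Set.indicator_of_mem hμ, Set.indicator_of_mem (levels_subset_Icc hm hρ hμ)]
    exact h μ hμ
  · rw [Set.indicator_of_notMem hμ]
    exact Set.indicator_nonneg (fun _ _ => hK) μ

theorem integrable_and_memLp_profile {b : ℝ → ℝ} (hbm : Measurable b) (hb1 : ∀ z, |b z| ≤ 1)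
    (hb0 : ∀ z, 1 < |z| → b z = 0) {a : E → ℝ} {m k ρ : ℝ} (hm : 1 < m) (hk : 0 ≤ k)
    (hρ : 0 < ρ) (ham : Measurable a) {θ : Metric.sphere (0 : E) 1} (ha : 0 < a θ) {G : E → ℂ}
    (hG : Measurable G) {K : ℝ} (hGK : ∀ ξ, ‖G ξ‖ ≤ K) :
    Integrable (profile b a m k ρ θ G) ∧ MemLp (profile b a m k ρ θ G) 2 := by
  obtain ⟨A, hA0, hA⟩ := exists_amplitude_le (k := k) hm hk hρ ha
  have hK0 : 0 ≤ K := (norm_nonneg _).trans (hGK 0)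
  have hmeas : Measurable (profile b a m k ρ θ G) :=
    Measurable.profile (α := ℝ) hbm ham measurable_const measurable_const measurable_id
      (hG.comp (Measurable.polarMap ham measurable_const measurable_id))
  refine integrable_and_memLp_two_of_norm_le_indicator hmeas (K := A * K) fun μ =>
    (norm_profile_le hb1 hb0 μ).trans (indicator_levels_le (by linarith) hρ (by positivity)
      (fun μ hμ => ?_) μ)
  exact mul_le_mul (hA μ hμ) (hGK _) (norm_nonneg _) hA0

theorem lintegral_amplitude_sq_mul_le [Nontrivial E] {a : E → ℝ} {m k a₀ : ℝ} (hm : 1 < m)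
    (hk : 0 ≤ k) (ha₀ : 0 < a₀) (ham : Measurable a)
    (ha_hom : ∀ t : ℝ, 0 < t → ∀ ξ, a (t • ξ) = t * a ξ)
    (ha_pos : ∀ ξ, ξ ≠ 0 → 0 < a ξ) (ha : ∀ θ : Metric.sphere (0 : E) 1, a₀ ≤ a θ) {ρ : ℝ}
    (hρ : 0 < ρ) {F : E → ℝ≥0∞} (hF : Measurable F) :
    ∫⁻ θ : Metric.sphere (0 : E) 1, (∫⁻ μ in levels m ρ,
      ENNReal.ofReal (amplitude a m k θ μ ^ 2) * F (polarMap a m θ μ))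
        ∂(volume : Measure E).toSphere ≤
      ENNReal.ofReal (((1 + k / a₀ ^ 2) * Real.exp 1 ^ 2) ^ ((m - 1) / 2) * (1 + ρ) ^ (m - 1)) *
        ∫⁻ η in shell a ρ, F η := by
  have hm0 : 0 < m := by linarith
  rw [← lintegral_indicator (measurableSet_shell ham ρ),
    lintegral_eq_lintegral_polarMap hm0 ha_pos (hF.indicator (measurableSet_shell ham ρ)),
    ← lintegral_const_mul' _ _ ENNReal.ofReal_ne_top]
  refine lintegral_mono fun θ => ?_
  have haθ : 0 < a θ := ha_pos _ (ne_zero_of_mem_unit_sphere θ)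
  rw [← lintegral_const_mul' _ _ ENNReal.ofReal_ne_top,
    ← lintegral_indicator (measurableSet_levels m ρ), ← lintegral_indicator measurableSet_Ioi]
  refine lintegral_mono fun μ => ?_
  by_cases hμ : μ ∈ levels m ρ
  swap
  · rw [Set.indicator_of_notMem hμ]; exact zero_le
  have hμ0 : 0 < μ := hμ.1
  have hr : 0 < μ ^ (1 / m) := by positivity
  have hmem : polarMap a m θ μ ∈ shell a ρ := by
    simp only [shell, Set.mem_ofPred_eq, apply_polarMap ha_hom ha_pos θ hμ0]
    exact ⟨hr, hμ.2⟩
  rw [Set.indicator_of_mem hμ, Set.indicator_of_mem (Set.mem_Ioi.2 hμ0),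
    Set.indicator_of_mem hmem, ← mul_assoc, ← ENNReal.ofReal_mul (by positivity)]
  gcongr
  have hJ := polarJac_nonneg hm0 haθ hμ0
  rw [amplitude, Real.sq_sqrt (by positivity), mul_comm]
  gcongr
  have h1 : μ ^ (1 / m) ≤ Real.exp 1 * ρ := le_exp_mul_of_logAdd_sub_le hρ (abs_le.1 hμ.2).2
  have h2 : ‖polarMap a m θ μ‖ ^ 2 ≤ (Real.exp 1 * ρ) ^ 2 / a₀ ^ 2 := by
    rw [norm_polarMap haθ hμ0, div_pow]
    gcongr
    exact ha θ
  have he : 1 ≤ Real.exp 1 := Real.one_le_exp (by norm_num)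
  have h3 : 1 + k * ‖polarMap a m θ μ‖ ^ 2 ≤
      (1 + k / a₀ ^ 2) * Real.exp 1 ^ 2 * (1 + ρ) ^ 2 := by
    calc _ ≤ 1 + k * ((Real.exp 1 * ρ) ^ 2 / a₀ ^ 2) := by gcongr
      _ = 1 * (1 ^ 2 * 1 ^ 2) + k / a₀ ^ 2 * (Real.exp 1 ^ 2 * ρ ^ 2) := by ring
      _ ≤ 1 * (Real.exp 1 ^ 2 * (1 + ρ) ^ 2) + k / a₀ ^ 2 * (Real.exp 1 ^ 2 * (1 + ρ) ^ 2) := by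
          gcongr <;> linarith
      _ = _ := by ring
  calc _ ≤ ((1 + k / a₀ ^ 2) * Real.exp 1 ^ 2 * (1 + ρ) ^ 2) ^ ((m - 1) / 2) := by
        refine Real.rpow_le_rpow (by positivity) h3 (by linarith)
    _ = _ := by
        rw [Real.mul_rpow (by positivity) (by positivity), ← Real.rpow_natCast (1 + ρ),
          ← Real.rpow_mul (by positivity)]
        congr 2; push_cast; ring

theorem lintegral_fourier_profile_sq_le {b : ℝ → ℝ} (hbm : Measurable b)
    (hb1 : ∀ z, |b z| ≤ 1) (hb0 : ∀ z, 1 < |z| → b z = 0) {a : E → ℝ} {m k ρ : ℝ} (hm : 1 < m)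
    (hk : 0 ≤ k) (hρ : 0 < ρ) (ham : Measurable a) {θ : Metric.sphere (0 : E) 1} (ha : 0 < a θ)
    {G : E → ℂ} (hG : Measurable G) {K : ℝ} (hGK : ∀ ξ, ‖G ξ‖ ≤ K) :
    ∫⁻ y, ‖𝓕 (profile b a m k ρ θ G) y‖ₑ ^ 2 ≤ ∫⁻ μ in levels m ρ,
      ENNReal.ofReal (amplitude a m k θ μ ^ 2) * ‖G (polarMap a m θ μ)‖ₑ ^ 2 := by
  obtain ⟨h1, h2⟩ := integrable_and_memLp_profile (k := k) hbm hb1 hb0 hm hk hρ ham ha hG hGK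
  rw [lintegral_enorm_fourier_sq h1 h2, ← lintegral_indicator (measurableSet_levels m ρ)]
  refine lintegral_mono fun μ => ?_
  have h := norm_profile_le (a := a) (m := m) (k := k) (ρ := ρ) (θ := θ) (G := G) hb1 hb0 μ
  by_cases hμ : μ ∈ levels m ρ
  · rw [Set.indicator_of_mem hμ] at h ⊢
    have h0 : 0 ≤ amplitude a m k θ μ := Real.sqrt_nonneg _
    rw [ENNReal.ofReal_pow h0, ← mul_pow]
    gcongr
    rw [← ofReal_norm, ← ofReal_norm, ← ENNReal.ofReal_mul h0]
    exact ENNReal.ofReal_le_ofReal h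
  · rw [Set.indicator_of_notMem hμ, profile_eq_zero hb0 hμ]
    simp

theorem lintegral_sq_mul_fourier_profile_sq_le {b : ℝ → ℝ} (hb : ContDiff ℝ 1 b)
    (hb1 : ∀ z, |b z| ≤ 1) (hb0 : ∀ z, 1 < |z| → b z = 0) {B : ℝ} (hB : ∀ z, |deriv b z| ≤ B)
    {a : E → ℝ} {m k a₀ ρ : ℝ} (hm : 1 < m) (hk : 0 ≤ k) (ha₀ : 0 < a₀) (hρ : 0 < ρ)
    (ham : Measurable a) {θ : Metric.sphere (0 : E) 1} (ha : a₀ ≤ a θ) {G : E → ℂ}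
    (hG : Differentiable ℝ G) {K : ℝ} (hGK : ∀ ξ, ‖G ξ‖ ≤ K) (hGK' : ∀ ξ, ‖fderiv ℝ G ξ‖ ≤ K) :
    ∫⁻ y, ENNReal.ofReal ((ρ ^ m / (1 + ρ) * y) ^ 2) * ‖𝓕 (profile b a m k ρ θ G) y‖ₑ ^ 2 ≤
      ENNReal.ofReal ((Real.exp (m + 1) * (B + ((Module.finrank ℝ E : ℝ) / m + 2) + 1 / a₀)) ^ 2
        * 2) *
      ∫⁻ μ in levels m ρ, ENNReal.ofReal (amplitude a m k θ μ ^ 2) *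
        (‖G (polarMap a m θ μ)‖ₑ ^ 2 +
          ENNReal.ofReal ((ρ / (1 + ρ)) ^ 2) * ‖fderiv ℝ G (polarMap a m θ μ)‖ₑ ^ 2) := by
  have hm0 : 0 < m := by linarith
  have haθ : 0 < a θ := ha₀.trans_le ha
  set v := profile b a m k ρ θ G with hv
  set C := Real.exp (m + 1) * (B + ((Module.finrank ℝ E : ℝ) / m + 2) + 1 / a₀) with hC
  have hB0 : 0 ≤ B := (abs_nonneg _).trans (hB 0)
  have hC0 : 0 ≤ C := by positivity
  have hK0 : 0 ≤ K := (norm_nonneg _).trans (hGK 0)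
  have hX : 0 < (1 + ρ) / ρ ^ m := by positivity
  obtain ⟨h1, h2⟩ := integrable_and_memLp_profile (k := k) hb.continuous.measurable hb1 hb0 hm hk
    hρ ham haθ hG.continuous.measurable hGK
  have hder := exists_hasDerivAt_profile hb hb1 hb0 hB (a := a) hm hk ha₀ ha hρ hG
  have hdiff : Differentiable ℝ v := fun μ => (hder μ).choose_spec.1.differentiableAt
  have hbound : ∀ μ, ‖deriv v μ‖ ≤ (levels m ρ).indicator (fun μ =>
      C * ((1 + ρ) / ρ ^ m) * (amplitude a m k θ μ *
        (‖G (polarMap a m θ μ)‖ + ρ / (1 + ρ) * ‖fderiv ℝ G (polarMap a m θ μ)‖))) μ := fun μ => by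
    obtain ⟨d, hd, hdle⟩ := hder μ
    rw [hd.deriv]; exact hdle
  obtain ⟨A, hA0, hA⟩ := exists_amplitude_le (k := k) hm hk hρ haθ
  obtain ⟨h3, h4⟩ := integrable_and_memLp_two_of_norm_le_indicator (measurable_deriv v)
    (K := C * ((1 + ρ) / ρ ^ m) * (A * (K + ρ / (1 + ρ) * K))) (fun μ => (hbound μ).trans
      (indicator_levels_le hm0 hρ (by positivity) (fun μ hμ => by
        gcongr
        · exact hA μ hμ
        · exact hGK _
        · exact hGK' _) μ))
  have hF := Real.fourier_deriv h1 hdiff h3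
  calc ∫⁻ y, ENNReal.ofReal ((ρ ^ m / (1 + ρ) * y) ^ 2) * ‖𝓕 v y‖ₑ ^ 2
      ≤ ∫⁻ y, ENNReal.ofReal ((ρ ^ m / (1 + ρ)) ^ 2) * ‖𝓕 (deriv v) y‖ₑ ^ 2 := by
        refine lintegral_mono fun y => ?_
        rw [hF]
        simp only [smul_eq_mul, enorm_mul, mul_pow]
        rw [ENNReal.ofReal_mul (by positivity), mul_assoc]
        gcongr
        rw [← ofReal_norm (2 : ℂ), ← ofReal_norm (π : ℂ), ← ofReal_norm I, ← ofReal_norm (y : ℂ),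
          ← ENNReal.ofReal_pow (norm_nonneg _), ← ENNReal.ofReal_pow (norm_nonneg _),
          ← ENNReal.ofReal_pow (norm_nonneg _), ← ENNReal.ofReal_pow (norm_nonneg _),
          ← ENNReal.ofReal_mul (by positivity), ← ENNReal.ofReal_mul (by positivity),
          ← ENNReal.ofReal_mul (by positivity)]
        refine ENNReal.ofReal_le_ofReal ?_
        simp only [Complex.norm_real, Complex.norm_I, Complex.norm_ofNat, Real.norm_eq_abs, sq_abs]
        nlinarith [sq_nonneg y, Real.pi_gt_three, mul_nonneg (sq_nonneg y) (sq_nonneg (π - 1)),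
          mul_nonneg (sq_nonneg y) (sub_nonneg.2 Real.pi_gt_three.le)]
    _ = ENNReal.ofReal ((ρ ^ m / (1 + ρ)) ^ 2) * ∫⁻ μ, ‖deriv v μ‖ₑ ^ 2 := by
        rw [lintegral_const_mul' _ _ ENNReal.ofReal_ne_top, lintegral_enorm_fourier_sq h3 h4]
    _ ≤ _ := by
        rw [← lintegral_const_mul' _ _ ENNReal.ofReal_ne_top,
          ← lintegral_const_mul' _ _ ENNReal.ofReal_ne_top,
          ← lintegral_indicator (measurableSet_levels m ρ)]
        refine lintegral_mono fun μ => ?_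
        have hbμ := hbound μ
        by_cases hμ : μ ∈ levels m ρ
        swap
        · rw [Set.indicator_of_notMem hμ] at hbμ ⊢
          have : deriv v μ = 0 := norm_le_zero_iff.1 hbμ
          simp [this]
        rw [Set.indicator_of_mem hμ] at hbμ ⊢
        rw [← ofReal_norm, ← ofReal_norm, ← ofReal_norm, ← ENNReal.ofReal_pow (norm_nonneg _),
          ← ENNReal.ofReal_pow (norm_nonneg _), ← ENNReal.ofReal_pow (norm_nonneg _),
          ← ENNReal.ofReal_mul (by positivity), ← ENNReal.ofReal_mul (by positivity),
          ← ENNReal.ofReal_add (by positivity) (by positivity),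
          ← ENNReal.ofReal_mul (by positivity), ← ENNReal.ofReal_mul (by positivity)]
        refine ENNReal.ofReal_le_ofReal ?_
        calc _ ≤ (ρ ^ m / (1 + ρ)) ^ 2 * (C * ((1 + ρ) / ρ ^ m) * (amplitude a m k θ μ *
              (‖G (polarMap a m θ μ)‖ + ρ / (1 + ρ) * ‖fderiv ℝ G (polarMap a m θ μ)‖))) ^ 2 := by
              gcongr
          _ = C ^ 2 * (amplitude a m k θ μ ^ 2 *
              (‖G (polarMap a m θ μ)‖ + ρ / (1 + ρ) * ‖fderiv ℝ G (polarMap a m θ μ)‖) ^ 2) := by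
              field_simp
          _ ≤ C ^ 2 * (amplitude a m k θ μ ^ 2 * (2 * (‖G (polarMap a m θ μ)‖ ^ 2 +
              (ρ / (1 + ρ) * ‖fderiv ℝ G (polarMap a m θ μ)‖) ^ 2))) := by
              gcongr
              exact add_sq_le
          _ = _ := by ring

end ShellPlancherel

section Energy

variable {E : Type*} [NormedAddCommGroup E] [InnerProductSpace ℝ E] [FiniteDimensional ℝ E]
  [MeasurableSpace E] [BorelSpace E]

theorem ContinuousLinearMap.norm_sq_le_sum {ι : Type*} [Fintype ι] (e : OrthonormalBasis ι ℝ E)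
    (L : E →L[ℝ] ℂ) : ‖L‖ ^ 2 ≤ ∑ i, ‖L (e i)‖ ^ 2 := by
  have h0 : 0 ≤ ∑ i, ‖L (e i)‖ ^ 2 := Finset.sum_nonneg fun _ _ => by positivity
  refine (Real.le_sqrt (norm_nonneg _) h0).1 (L.opNorm_le_bound (Real.sqrt_nonneg _) fun x => ?_)
  have hx : L x = ∑ i, ⟪e i, x⟫ • L (e i) := by
    conv_lhs => rw [← e.sum_repr' x]
    simp
  calc ‖L x‖ ≤ ∑ i, ‖L (e i)‖ * ‖⟪e i, x⟫‖ := by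
        rw [hx]
        refine (norm_sum_le _ _).trans (Finset.sum_le_sum fun i _ => ?_)
        rw [norm_smul, mul_comm]
    _ ≤ √(∑ i, ‖L (e i)‖ ^ 2) * √(∑ i, ‖⟪e i, x⟫‖ ^ 2) := Real.sum_mul_le_sqrt_mul_sqrt _ _ _
    _ = _ := by rw [e.sum_sq_norm_inner_right, Real.sqrt_sq (norm_nonneg _)]

theorem continuous_fourier {φ : E → ℂ} (hφ : Integrable φ) : Continuous (𝓕 φ) :=
  VectorFourier.fourierIntegral_continuous Real.continuous_fourierChar
    (by exact continuous_inner) hφ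

theorem norm_fourier_le (φ : E → ℂ) (ξ : E) : ‖𝓕 φ ξ‖ ≤ ∫ x, ‖φ x‖ :=
  VectorFourier.norm_fourierIntegral_le_integral_norm _ _ _ _ _

theorem integrable_norm_mul_of_eq_zero {φ : E → ℂ} (hφ : Integrable φ) {R : ℝ}
    (hR : ∀ x, R ≤ ‖x‖ → φ x = 0) : Integrable fun x => ‖x‖ * ‖φ x‖ := by
  refine (hφ.norm.const_mul R).mono' (by fun_prop) (.of_forall fun x => ?_)
  rw [Real.norm_of_nonneg (by positivity)]
  by_cases h : R ≤ ‖x‖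
  · simp [hR x h]
  · gcongr
    linarith

theorem norm_fderiv_fourier_le {φ : E → ℂ} (hφ : Integrable φ)
    (hφ' : Integrable fun x => ‖x‖ * ‖φ x‖) (ξ : E) :
    ‖fderiv ℝ (𝓕 φ) ξ‖ ≤ 2 * π * ∫ x, ‖x‖ * ‖φ x‖ := by
  rw [Real.fderiv_fourier hφ hφ', ← integral_const_mul]
  refine (VectorFourier.norm_fourierIntegral_le_integral_norm _ _ _ _ _).trans ?_
  refine integral_mono_of_nonneg (.of_forall fun _ => norm_nonneg _) (hφ'.const_mul _)
    (.of_forall fun x => ?_)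
  refine (VectorFourier.norm_fourierSMulRight_le _ _ _).trans ?_
  calc _ ≤ 2 * π * 1 * ‖x‖ * ‖φ x‖ := by gcongr; exact norm_innerSL_le _
    _ = _ := by ring

theorem lintegral_enorm_fderiv_fourier_sq_le {φ : E → ℂ} (hφ : Integrable φ) (hφ2 : MemLp φ 2)
    {R : ℝ} (hR : ∀ x, R ≤ ‖x‖ → φ x = 0) :
    ∫⁻ ξ, ‖fderiv ℝ (𝓕 φ) ξ‖ₑ ^ 2 ≤
      ENNReal.ofReal ((2 * π) ^ 2) * ∫⁻ x, ENNReal.ofReal (‖x‖ ^ 2) * ‖φ x‖ₑ ^ 2 := by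
  have hφ' := integrable_norm_mul_of_eq_zero hφ hR
  set e := stdOrthonormalBasis ℝ E
  set S := VectorFourier.fourierSMulRight (innerSL ℝ (E := E)) φ with hS
  have hSn : ∀ x, ‖S x‖ ≤ 2 * π * (‖x‖ * ‖φ x‖) := fun x => by
    refine (VectorFourier.norm_fourierSMulRight_le _ _ _).trans ?_
    calc _ ≤ 2 * π * 1 * ‖x‖ * ‖φ x‖ := by gcongr; exact norm_innerSL_le _
      _ = _ := by ring
  have hSi : Integrable S := (hφ'.const_mul (2 * π)).mono'
    hφ.1.fourierSMulRight (.of_forall hSn)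
  have hSe : ∀ i, Integrable fun x => S x (e i) := fun i => hSi.apply_continuousLinearMap _
  have hSe' : ∀ i x, ‖S x (e i)‖ = 2 * π * (|⟪e i, x⟫| * ‖φ x‖) := fun i x => by
    rw [hS, VectorFourier.fourierSMulRight_apply, norm_smul, norm_smul, norm_neg]
    simp only [Complex.norm_mul, Complex.norm_ofNat, Complex.norm_real, Complex.norm_I,
      Real.norm_eq_abs, abs_of_pos Real.pi_pos, mul_one]
    rw [real_inner_comm, innerSL_apply_apply]
  have hSe2 : ∀ i, MemLp (fun x => S x (e i)) 2 := fun i => by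
    refine (hφ2.norm.const_mul (2 * π * R)).mono' (hSe i).1 (.of_forall fun x => ?_)
    rw [hSe']
    by_cases h : R ≤ ‖x‖
    · simp [hR x h]
    · have : |⟪e i, x⟫| ≤ R := (abs_real_inner_le_norm _ _).trans (by
        rw [e.norm_eq_one, one_mul]; linarith)
      calc _ ≤ 2 * π * (R * ‖φ x‖) := by gcongr
        _ = _ := by ring
  calc ∫⁻ ξ, ‖fderiv ℝ (𝓕 φ) ξ‖ₑ ^ 2 ≤ ∫⁻ ξ, ∑ i, ‖𝓕 (fun x => S x (e i)) ξ‖ₑ ^ 2 := by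
        refine lintegral_mono fun ξ => ?_
        have := ContinuousLinearMap.norm_sq_le_sum e (fderiv ℝ (𝓕 φ) ξ)
        rw [Real.fderiv_fourier hφ hφ'] at this ⊢
        have h' : ∀ i, 𝓕 S ξ (e i) = 𝓕 (fun x => S x (e i)) ξ := fun i =>
          Real.fourier_continuousLinearMap_apply hSi
        simp only [← hS, h'] at this ⊢
        rw [← ofReal_norm, ← ENNReal.ofReal_pow (norm_nonneg _)]
        refine (ENNReal.ofReal_le_ofReal this).trans_eq ?_
        rw [ENNReal.ofReal_sum_of_nonneg fun _ _ => by positivity]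
        refine Finset.sum_congr rfl fun i _ => ?_
        rw [← ofReal_norm, ← ENNReal.ofReal_pow (norm_nonneg _)]
    _ = ∑ i, ∫⁻ x, ‖S x (e i)‖ₑ ^ 2 := by
        rw [lintegral_finsetSum _ fun i _ => ?_]
        · exact Finset.sum_congr rfl fun i _ => lintegral_enorm_fourier_sq (hSe i) (hSe2 i)
        · exact (continuous_fourier (hSe i)).measurable.enorm.pow_const 2
    _ = ∫⁻ x, ∑ i, ‖S x (e i)‖ₑ ^ 2 := by
        rw [lintegral_finsetSum' _ fun i _ => (hSe i).1.enorm.pow_const 2]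
    _ = _ := by
        rw [← lintegral_const_mul' _ _ ENNReal.ofReal_ne_top]
        refine lintegral_congr fun x => ?_
        simp only [← ofReal_norm, ← ENNReal.ofReal_pow (norm_nonneg _), hSe']
        have h' : ∀ i, ENNReal.ofReal (2 * π * (|⟪e i, x⟫| * ‖φ x‖)) ^ 2 =
            ENNReal.ofReal ((2 * π * (|⟪e i, x⟫| * ‖φ x‖)) ^ 2) := fun i =>
          (ENNReal.ofReal_pow (by positivity) 2).symm
        simp only [h']
        rw [← ENNReal.ofReal_sum_of_nonneg fun _ _ => by positivity,
          ← ENNReal.ofReal_mul (by positivity), ← ENNReal.ofReal_mul (by positivity)]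
        congr 1
        rw [← e.sum_sq_norm_inner_right x, Finset.sum_mul, Finset.mul_sum]
        refine Finset.sum_congr rfl fun i _ => ?_
        rw [Real.norm_eq_abs]
        ring

/-- The density of the squared Sobolev norm of `𝓕 φ` with derivatives scaled by `l`. -/
def energy (l : ℝ) (φ : E → ℂ) (η : E) : ℝ≥0∞ :=
  ‖𝓕 φ η‖ₑ ^ 2 + ENNReal.ofReal (l ^ 2) * ‖fderiv ℝ (𝓕 φ) η‖ₑ ^ 2

theorem measurable_energy {φ : E → ℂ} (hφ : Integrable φ) (l : ℝ) : Measurable (energy l φ) :=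
  ((continuous_fourier hφ).measurable.enorm.pow_const 2).add
    (((measurable_fderiv ℝ (𝓕 φ)).enorm.pow_const 2).const_mul _)

theorem lintegral_energy_le {φ : E → ℂ} (hφ : Integrable φ) (hφ2 : MemLp φ 2)
    {R : ℝ} (hR : ∀ x, R ≤ ‖x‖ → φ x = 0) (l : ℝ) :
    ∫⁻ η, energy l φ η ≤
      ENNReal.ofReal ((2 * π) ^ 2) * ∫⁻ x, ENNReal.ofReal (1 + (l * ‖x‖) ^ 2) * ‖φ x‖ₑ ^ 2 := by
  unfold energy
  rw [lintegral_add_left ((continuous_fourier hφ).measurable.enorm.pow_const 2),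
    lintegral_const_mul' _ _ ENNReal.ofReal_ne_top, lintegral_enorm_fourier_sq hφ hφ2]
  calc _ ≤ ENNReal.ofReal ((2 * π) ^ 2) * (∫⁻ x, ‖φ x‖ₑ ^ 2) + ENNReal.ofReal (l ^ 2) *
        (ENNReal.ofReal ((2 * π) ^ 2) * ∫⁻ x, ENNReal.ofReal (‖x‖ ^ 2) * ‖φ x‖ₑ ^ 2) := by
        refine add_le_add (le_mul_of_one_le_left zero_le ?_) ?_
        · rw [ENNReal.one_le_ofReal]
          nlinarith [Real.pi_gt_three]
        · gcongr
          exact lintegral_enorm_fderiv_fourier_sq_le hφ hφ2 hR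
    _ = _ := by
        rw [mul_left_comm, ← mul_add, ← lintegral_const_mul' _ _ ENNReal.ofReal_ne_top,
          ← lintegral_add_left' (hφ.1.enorm.pow_const 2)]
        congr 1
        refine lintegral_congr fun x => ?_
        rw [ENNReal.ofReal_add zero_le_one (by positivity), add_mul, mul_pow,
          ENNReal.ofReal_mul (by positivity), ENNReal.ofReal_one, one_mul, mul_assoc]

theorem energy_le {φ : E → ℂ} (hφ : Integrable φ) {R : ℝ} (hR : ∀ x, R ≤ ‖x‖ → φ x = 0)
    {l : ℝ} (hl : 0 ≤ l) (hlR : l * R ≤ 1) (η : E) :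
    energy l φ η ≤ ENNReal.ofReal (1 + (2 * π) ^ 2) * (∫⁻ x, ‖φ x‖ₑ) ^ 2 := by
  have hφ' := integrable_norm_mul_of_eq_zero hφ hR
  have h1 : l * ‖fderiv ℝ (𝓕 φ) η‖ ≤ 2 * π * ∫ x, ‖φ x‖ := by
    calc _ ≤ l * (2 * π * ∫ x, ‖x‖ * ‖φ x‖) := by gcongr; exact norm_fderiv_fourier_le hφ hφ' η
      _ = 2 * π * ∫ x, l * (‖x‖ * ‖φ x‖) := by rw [integral_const_mul]; ring
      _ ≤ _ := by
        gcongr ?_ * ?_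
        refine integral_mono (hφ'.const_mul l) hφ.norm fun x => ?_
        by_cases h : R ≤ ‖x‖
        · simp [hR x h]
        · have : l * ‖x‖ ≤ 1 := (mul_le_mul_of_nonneg_left (not_le.1 h).le hl).trans hlR
          nlinarith [norm_nonneg (φ x)]
  have h0 : (∫⁻ x, ‖φ x‖ₑ) = ENNReal.ofReal (∫ x, ‖φ x‖) := by
    rw [ofReal_integral_norm_eq_lintegral_enorm hφ]
  have hI : 0 ≤ ∫ x, ‖φ x‖ := integral_nonneg fun _ => norm_nonneg _
  rw [energy, h0, ← ofReal_norm, ← ofReal_norm, ← ENNReal.ofReal_pow (norm_nonneg _),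
    ← ENNReal.ofReal_pow (norm_nonneg _), ← ENNReal.ofReal_pow hI,
    ← ENNReal.ofReal_mul (by positivity), ← ENNReal.ofReal_mul (by positivity),
    ← ENNReal.ofReal_add (by positivity) (by positivity), ← mul_pow]
  refine ENNReal.ofReal_le_ofReal ?_
  calc _ ≤ (∫ x, ‖φ x‖) ^ 2 + (2 * π * ∫ x, ‖φ x‖) ^ 2 := by
        gcongr
        exact norm_fourier_le φ η
    _ = _ := by ring

theorem fourier_add_eq {φ ψ : E → ℂ} (hφ : Integrable φ) (hψ : Integrable ψ) :
    𝓕 (φ + ψ) = 𝓕 φ + 𝓕 ψ :=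
  (VectorFourier.fourierIntegral_add Real.continuous_fourierChar
    (by exact continuous_inner) hφ hψ)

theorem enorm_add_sq_le {F : Type*} [NormedAddCommGroup F] (x y : F) :
    ‖x + y‖ₑ ^ 2 ≤ 2 * (‖x‖ₑ ^ 2 + ‖y‖ₑ ^ 2) := by
  simp only [← ofReal_norm, ← ENNReal.ofReal_pow (norm_nonneg _)]
  rw [← ENNReal.ofReal_add (by positivity) (by positivity),
    show (2 : ℝ≥0∞) = ENNReal.ofReal 2 by simp, ← ENNReal.ofReal_mul (by positivity)]
  refine ENNReal.ofReal_le_ofReal ?_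
  calc ‖x + y‖ ^ 2 ≤ (‖x‖ + ‖y‖) ^ 2 := by gcongr; exact norm_add_le _ _
    _ ≤ _ := add_sq_le

theorem energy_add_le {φ ψ : E → ℂ} (hφ : Integrable φ) (hψ : Integrable ψ)
    (hφ' : Integrable fun x => ‖x‖ * ‖φ x‖) (hψ' : Integrable fun x => ‖x‖ * ‖ψ x‖)
    (l : ℝ) (η : E) : energy l (φ + ψ) η ≤ 2 * (energy l φ η + energy l ψ η) := by
  have h1 := (Real.hasFDerivAt_fourier hφ hφ' η).differentiableAt
  have h2 := (Real.hasFDerivAt_fourier hψ hψ' η).differentiableAt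
  unfold energy
  rw [fourier_add_eq hφ hψ, fderiv_add h1 h2, Pi.add_apply]
  calc _ ≤ 2 * (‖𝓕 φ η‖ₑ ^ 2 + ‖𝓕 ψ η‖ₑ ^ 2) + ENNReal.ofReal (l ^ 2) *
        (2 * (‖fderiv ℝ (𝓕 φ) η‖ₑ ^ 2 + ‖fderiv ℝ (𝓕 ψ) η‖ₑ ^ 2)) := by
        gcongr <;> exact enorm_add_sq_le _ _
    _ = _ := by ring

end Energy

section Tail

variable {E : Type*} [NormedAddCommGroup E] [InnerProductSpace ℝ E] [FiniteDimensional ℝ E]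
  [MeasurableSpace E] [BorelSpace E]

theorem profile_add (b : ℝ → ℝ) (a : E → ℝ) (m k ρ : ℝ) (θ : Metric.sphere (0 : E) 1)
    (G H : E → ℂ) : profile b a m k ρ θ (G + H) =
      profile b a m k ρ θ G + profile b a m k ρ θ H := by
  ext μ
  by_cases h : 0 < μ <;> simp [profile, h, mul_add]

theorem exists_lintegral_fourier_profile_tail_le [Nontrivial E] {b : ℝ → ℝ} (hb : ContDiff ℝ 1 b)
    (hb1 : ∀ z, |b z| ≤ 1) (hb0 : ∀ z, 1 < |z| → b z = 0) {B : ℝ} (hB : ∀ z, |deriv b z| ≤ B)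
    {a : E → ℝ} {m k a₀ : ℝ} (hm : 1 < m) (hk : 0 ≤ k) (ha₀ : 0 < a₀) (ham : Measurable a)
    (ha_hom : ∀ t : ℝ, 0 < t → ∀ ξ, a (t • ξ) = t * a ξ)
    (ha_pos : ∀ ξ, ξ ≠ 0 → 0 < a ξ) (ha : ∀ θ : Metric.sphere (0 : E) 1, a₀ ≤ a θ) :
    ∃ C : ℝ≥0∞, C ≠ ⊤ ∧ ∀ (ρ : ℝ), 0 < ρ → ∀ κ : ℝ, 1 ≤ κ → ∀ g₁ g₂ : E → ℂ, Integrable g₁ →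
      Integrable g₂ → ∀ R : ℝ, (∀ x, R ≤ ‖x‖ → g₂ x = 0) →
      ∫⁻ θ : Metric.sphere (0 : E) 1, (∫⁻ y in {y : ℝ | κ ≤ 2 + ρ ^ m / (1 + ρ) * |y|},
        ‖𝓕 (profile b a m k ρ θ (𝓕 (g₁ + g₂))) y‖ₑ ^ 2) ∂(volume : Measure E).toSphere ≤
      C * (ENNReal.ofReal ((1 + ρ) ^ (m - 1)) * ∫⁻ η in shell a ρ,
        (‖𝓕 g₁ η‖ₑ ^ 2 + ENNReal.ofReal ((κ ^ 2)⁻¹) * energy (ρ / (1 + ρ)) g₂ η)) := by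
  set C₁ := (Real.exp (m + 1) * (B + ((Module.finrank ℝ E : ℝ) / m + 2) + 1 / a₀)) ^ 2 * 2 with hC₁
  set C₂ := ((1 + k / a₀ ^ 2) * Real.exp 1 ^ 2) ^ ((m - 1) / 2) with hC₂
  have hC₁0 : 0 ≤ C₁ := by positivity
  refine ⟨ENNReal.ofReal (16 * (1 + C₁)) * ENNReal.ofReal C₂,
    ENNReal.mul_ne_top ENNReal.ofReal_ne_top ENNReal.ofReal_ne_top, ?_⟩
  intro ρ hρ κ hκ g₁ g₂ hg₁ hg₂ R hR
  have hκ0 : 0 < κ := by linarith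
  have hG₁ := (continuous_fourier hg₁).measurable
  have hG₂ := (continuous_fourier hg₂).measurable
  have hg₂' := integrable_norm_mul_of_eq_zero hg₂ hR
  set F : E → ℝ≥0∞ := fun η =>
    ‖𝓕 g₁ η‖ₑ ^ 2 + ENNReal.ofReal ((κ ^ 2)⁻¹) * energy (ρ / (1 + ρ)) g₂ η with hF
  have hFm : Measurable F :=
    (hG₁.enorm.pow_const 2).add ((measurable_energy hg₂ _).const_mul _)
  have key : ∀ θ : Metric.sphere (0 : E) 1,
      ∫⁻ y in {y : ℝ | κ ≤ 2 + ρ ^ m / (1 + ρ) * |y|},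
        ‖𝓕 (profile b a m k ρ θ (𝓕 (g₁ + g₂))) y‖ₑ ^ 2 ≤ ENNReal.ofReal (16 * (1 + C₁)) *
          ∫⁻ μ in levels m ρ, ENNReal.ofReal (amplitude a m k θ μ ^ 2) * F (polarMap a m θ μ) := by
    intro θ
    have haθ : 0 < a θ := ha₀.trans_le (ha θ)
    have hpm : Measurable (polarMap a m θ) := Measurable.polarMap ham measurable_const measurable_id
    have ham' : Measurable (amplitude a m k θ) :=
      Measurable.amplitude ham measurable_const measurable_id
    have hi₁ := (integrable_and_memLp_profile (k := k) hb.continuous.measurable hb1 hb0 hm hk hρ ham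
      haθ hG₁ (norm_fourier_le g₁)).1
    have hi₂ := (integrable_and_memLp_profile (k := k) hb.continuous.measurable hb1 hb0 hm hk hρ ham
      haθ hG₂ (norm_fourier_le g₂)).1
    have hm₁ : Measurable fun y => ‖𝓕 (profile b a m k ρ θ (𝓕 g₁)) y‖ₑ ^ 2 :=
      (continuous_fourier hi₁).measurable.enorm.pow_const 2
    have hm₂ : Measurable fun y => ‖𝓕 (profile b a m k ρ θ (𝓕 g₂)) y‖ₑ ^ 2 :=
      (continuous_fourier hi₂).measurable.enorm.pow_const 2
    set X := ∫⁻ μ in levels m ρ,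
      ENNReal.ofReal (amplitude a m k θ μ ^ 2) * ‖𝓕 g₁ (polarMap a m θ μ)‖ₑ ^ 2 with hX
    set Y := ∫⁻ μ in levels m ρ, ENNReal.ofReal (amplitude a m k θ μ ^ 2) *
      energy (ρ / (1 + ρ)) g₂ (polarMap a m θ μ) with hY
    have e₁ : ∫⁻ y, ‖𝓕 (profile b a m k ρ θ (𝓕 g₁)) y‖ₑ ^ 2 ≤ X :=
      lintegral_fourier_profile_sq_le hb.continuous.measurable hb1 hb0 hm hk hρ ham haθ hG₁
        (norm_fourier_le g₁)
    have e₂ : ∫⁻ y, ‖𝓕 (profile b a m k ρ θ (𝓕 g₂)) y‖ₑ ^ 2 ≤ Y := by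
      refine (lintegral_fourier_profile_sq_le hb.continuous.measurable hb1 hb0 hm hk hρ ham haθ hG₂
        (norm_fourier_le g₂)).trans (lintegral_mono fun μ => ?_)
      gcongr
      exact le_self_add
    have e₃ : ∫⁻ y, ENNReal.ofReal ((ρ ^ m / (1 + ρ) * y) ^ 2) *
        ‖𝓕 (profile b a m k ρ θ (𝓕 g₂)) y‖ₑ ^ 2 ≤ ENNReal.ofReal C₁ * Y :=
      lintegral_sq_mul_fourier_profile_sq_le hb hb1 hb0 hB hm hk ha₀ hρ ham (ha θ)
        (fun ξ => (Real.hasFDerivAt_fourier hg₂ hg₂' ξ).differentiableAt)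
        (K := max (∫ x, ‖g₂ x‖) (2 * π * ∫ x, ‖x‖ * ‖g₂ x‖))
        (fun ξ => (norm_fourier_le g₂ ξ).trans (le_max_left _ _))
        (fun ξ => (norm_fderiv_fourier_le hg₂ hg₂' ξ).trans (le_max_right _ _))
    have hset : MeasurableSet {y : ℝ | κ ≤ 2 + ρ ^ m / (1 + ρ) * |y|} :=
      measurableSet_le measurable_const (by fun_prop)
    have e₄ : ∫⁻ y in {y : ℝ | κ ≤ 2 + ρ ^ m / (1 + ρ) * |y|},
        ‖𝓕 (profile b a m k ρ θ (𝓕 g₂)) y‖ₑ ^ 2 ≤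
        ENNReal.ofReal (8 * (κ ^ 2)⁻¹) * (Y + ENNReal.ofReal C₁ * Y) := by
      calc _ ≤ ∫⁻ y in {y : ℝ | κ ≤ 2 + ρ ^ m / (1 + ρ) * |y|}, ENNReal.ofReal (8 * (κ ^ 2)⁻¹) *
            (‖𝓕 (profile b a m k ρ θ (𝓕 g₂)) y‖ₑ ^ 2 +
              ENNReal.ofReal ((ρ ^ m / (1 + ρ) * y) ^ 2) *
                ‖𝓕 (profile b a m k ρ θ (𝓕 g₂)) y‖ₑ ^ 2) := by
            refine setLIntegral_mono' hset fun y hy => ?_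
            rw [← one_add_mul, ← mul_assoc]
            refine le_mul_of_one_le_left zero_le ?_
            rw [← ENNReal.ofReal_one, ← ENNReal.ofReal_add zero_le_one (by positivity),
              ← ENNReal.ofReal_mul (by positivity)]
            refine ENNReal.ofReal_le_ofReal ?_
            have hy' : κ ≤ 2 + ρ ^ m / (1 + ρ) * |y| := hy
            have hsq : (ρ ^ m / (1 + ρ) * |y|) ^ 2 = (ρ ^ m / (1 + ρ) * y) ^ 2 := by
              rw [mul_pow, sq_abs, mul_pow]
            have hz0 : 0 ≤ ρ ^ m / (1 + ρ) * |y| := by positivity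
            rw [← hsq]
            generalize ρ ^ m / (1 + ρ) * |y| = z at hy' hz0
            rw [mul_right_comm, ← div_eq_mul_inv, le_div_iff₀ (by positivity)]
            nlinarith [sq_nonneg (z - 1)]
        _ ≤ ∫⁻ y, ENNReal.ofReal (8 * (κ ^ 2)⁻¹) *
            (‖𝓕 (profile b a m k ρ θ (𝓕 g₂)) y‖ₑ ^ 2 +
              ENNReal.ofReal ((ρ ^ m / (1 + ρ) * y) ^ 2) *
                ‖𝓕 (profile b a m k ρ θ (𝓕 g₂)) y‖ₑ ^ 2) := setLIntegral_le_lintegral _ _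
        _ ≤ _ := by
            rw [lintegral_const_mul' _ _ ENNReal.ofReal_ne_top, lintegral_add_left hm₂]
            gcongr
    have e₅ : ∫⁻ μ in levels m ρ, ENNReal.ofReal (amplitude a m k θ μ ^ 2) *
        F (polarMap a m θ μ) = X + ENNReal.ofReal ((κ ^ 2)⁻¹) * Y := by
      rw [hX, hY, ← lintegral_const_mul' _ _ ENNReal.ofReal_ne_top, ← lintegral_add_left]
      · refine lintegral_congr fun μ => ?_
        rw [hF]
        ring
      · exact (ham'.pow_const 2).ennreal_ofReal.mul ((hG₁.comp hpm).enorm.pow_const 2)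
    rw [e₅]
    calc _ ≤ ∫⁻ y in {y : ℝ | κ ≤ 2 + ρ ^ m / (1 + ρ) * |y|},
          2 * (‖𝓕 (profile b a m k ρ θ (𝓕 g₁)) y‖ₑ ^ 2 +
            ‖𝓕 (profile b a m k ρ θ (𝓕 g₂)) y‖ₑ ^ 2) := by
          refine lintegral_mono fun y => ?_
          rw [fourier_add_eq hg₁ hg₂, profile_add, fourier_add_eq hi₁ hi₂]
          exact enorm_add_sq_le _ _
      _ ≤ 2 * (X + ENNReal.ofReal (8 * (κ ^ 2)⁻¹) * (Y + ENNReal.ofReal C₁ * Y)) := by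
          rw [lintegral_const_mul' _ _ (by simp), lintegral_add_left hm₁]
          gcongr
          exact (setLIntegral_le_lintegral _ _).trans e₁
      _ = 2 * X + ENNReal.ofReal (16 * (1 + C₁)) * (ENNReal.ofReal ((κ ^ 2)⁻¹) * Y) := by
          rw [ENNReal.ofReal_mul (p := 8) (by norm_num), ENNReal.ofReal_mul (p := 16) (by norm_num),
            ENNReal.ofReal_add zero_le_one hC₁0, ENNReal.ofReal_one]
          simp only [ENNReal.ofReal_ofNat]
          ring
      _ ≤ ENNReal.ofReal (16 * (1 + C₁)) * X +
          ENNReal.ofReal (16 * (1 + C₁)) * (ENNReal.ofReal ((κ ^ 2)⁻¹) * Y) := by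
          gcongr
          rw [show (2 : ℝ≥0∞) = ENNReal.ofReal 2 by simp]
          exact ENNReal.ofReal_le_ofReal (by linarith)
      _ = _ := by rw [← mul_add (ENNReal.ofReal (16 * (1 + C₁)))]
  calc _ ≤ ∫⁻ θ : Metric.sphere (0 : E) 1, ENNReal.ofReal (16 * (1 + C₁)) * (∫⁻ μ in levels m ρ,
        ENNReal.ofReal (amplitude a m k θ μ ^ 2) * F (polarMap a m θ μ))
          ∂(volume : Measure E).toSphere := lintegral_mono key
    _ ≤ ENNReal.ofReal (16 * (1 + C₁)) * (ENNReal.ofReal (C₂ * (1 + ρ) ^ (m - 1)) *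
        ∫⁻ η in shell a ρ, F η) := by
        rw [lintegral_const_mul' _ _ ENNReal.ofReal_ne_top]
        gcongr
        exact lintegral_amplitude_sq_mul_le hm hk ha₀ ham ha_hom ha_pos ha hρ hFm
    _ = _ := by
        rw [ENNReal.ofReal_mul (p := C₂) (by positivity)]
        ring

end Tail

theorem lintegral_Ioo_rpow {s R : ℝ} (hs : -1 < s) (hR : 0 ≤ R) :
    ∫⁻ r in Set.Ioo 0 R, ENNReal.ofReal (r ^ s) = ENNReal.ofReal (R ^ (s + 1) / (s + 1)) := by
  have hi : IntegrableOn (fun r : ℝ => r ^ s) (Set.Ioc 0 R) :=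
    (intervalIntegrable_iff_integrableOn_Ioc_of_le hR).1
      (intervalIntegral.intervalIntegrable_rpow' hs)
  rw [setLIntegral_congr Ioo_ae_eq_Ioc, ← ofReal_integral_eq_lintegral_ofReal hi
    ((ae_restrict_iff' measurableSet_Ioc).2 (.of_forall fun r hr => Real.rpow_nonneg hr.1.le _)),
    ← intervalIntegral.integral_of_le hR, integral_rpow (Or.inl hs),
    Real.zero_rpow (by linarith), sub_zero]

theorem lintegral_Ioi_rpow {s t : ℝ} (hs : s < -1) (ht : 0 < t) :
    ∫⁻ r in Set.Ioi t, ENNReal.ofReal (r ^ s) = ENNReal.ofReal (t ^ (s + 1) / (-(s + 1))) := by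
  rw [← ofReal_integral_eq_lintegral_ofReal (integrableOn_Ioi_rpow_of_lt hs ht)
    ((ae_restrict_iff' measurableSet_Ioi).2
      (.of_forall fun r hr => Real.rpow_nonneg (ht.trans hr).le _)),
    integral_Ioi_rpow_of_lt hs ht, div_neg, neg_div]

section Weights

variable {E : Type*} [NormedAddCommGroup E] [InnerProductSpace ℝ E] [FiniteDimensional ℝ E]
  [MeasurableSpace E] [BorelSpace E]

theorem exists_lintegral_ball_rpow_norm_le [Nontrivial E] {β : ℝ}
    (hβ : β < Module.finrank ℝ E) : ∃ C : ℝ≥0∞, C ≠ ⊤ ∧ ∀ R : ℝ, 0 < R →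
      ∫⁻ x in Metric.ball (0 : E) R, ENNReal.ofReal (‖x‖ ^ (-β)) ≤
        C * ENNReal.ofReal (R ^ (Module.finrank ℝ E - β)) := by
  set n := Module.finrank ℝ E with hn
  have hn1 : 1 ≤ n := Module.finrank_pos
  refine ⟨(volume : Measure E).toSphere Set.univ * ENNReal.ofReal (1 / (n - β)),
    ENNReal.mul_ne_top (measure_ne_top _ _) ENNReal.ofReal_ne_top, fun R hR => ?_⟩
  rw [← lintegral_indicator measurableSet_ball, lintegral_eq_lintegral_sphere_Ioi
    (Measurable.indicator (by fun_prop) measurableSet_ball)]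
  have h : ∀ θ : Metric.sphere (0 : E) 1, ∫⁻ r in Set.Ioi (0 : ℝ), ENNReal.ofReal (r ^ (n - 1)) *
      (Metric.ball (0 : E) R).indicator (fun x => ENNReal.ofReal (‖x‖ ^ (-β))) (r • (θ : E)) =
      ENNReal.ofReal (1 / (n - β)) * ENNReal.ofReal (R ^ (n - β)) := fun θ => by
    have h1 := lintegral_Ioo_rpow (s := n - 1 - β) (by linarith) hR.le
    rw [← ENNReal.ofReal_mul (by have := sub_pos.2 hβ; positivity),
      show 1 / (n - β) * R ^ (n - β) = R ^ (n - 1 - β + 1) / (n - 1 - β + 1) by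
        rw [show n - 1 - β + 1 = n - β by ring]; ring, ← h1,
      ← lintegral_indicator measurableSet_Ioi, ← lintegral_indicator measurableSet_Ioo]
    refine lintegral_congr fun r => ?_
    by_cases hr : 0 < r
    swap
    · rw [Set.indicator_of_notMem (by simpa using hr), Set.indicator_of_notMem (fun h => hr h.1)]
    have hrn : ‖r • (θ : E)‖ = r := by
      rw [norm_smul, norm_eq_of_mem_sphere θ, mul_one, Real.norm_of_nonneg hr.le]
    rw [Set.indicator_of_mem (Set.mem_Ioi.2 hr)]
    by_cases hrR : r < R
    · rw [Set.indicator_of_mem (by rw [mem_ball_zero_iff, hrn]; exact hrR),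
        Set.indicator_of_mem (Set.mem_Ioo.2 ⟨hr, hrR⟩), hrn,
        ← ENNReal.ofReal_mul (by positivity), ← Real.rpow_natCast, ← Real.rpow_add hr]
      congr 2
      push_cast [hn1]; ring
    · rw [Set.indicator_of_notMem (by rw [mem_ball_zero_iff, hrn]; exact hrR),
        Set.indicator_of_notMem (fun h : r ∈ Set.Ioo 0 R => hrR h.2), mul_zero]
  rw [lintegral_congr h, lintegral_const]
  exact le_of_eq (by ring)

theorem exists_sq_lintegral_ball_le [Nontrivial E] {β : ℝ}
    (hβ : β < Module.finrank ℝ E) : ∃ C : ℝ≥0∞, C ≠ ⊤ ∧ ∀ R : ℝ, 0 < R →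
      ∀ φ : E → ℂ, Measurable φ → (∫⁻ x in Metric.ball (0 : E) R, ‖φ x‖ₑ) ^ 2 ≤
        C * (ENNReal.ofReal (R ^ (Module.finrank ℝ E - β)) *
          ∫⁻ x in Metric.ball (0 : E) R, ENNReal.ofReal (‖x‖ ^ β) * ‖φ x‖ₑ ^ 2) := by
  obtain ⟨C, hC, h⟩ := exists_lintegral_ball_rpow_norm_le (E := E) hβ
  refine ⟨C, hC, fun R hR φ hφ => ?_⟩
  have h1 : ∫⁻ x in Metric.ball (0 : E) R, ‖φ x‖ₑ = ∫⁻ x in Metric.ball (0 : E) R,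
      ENNReal.ofReal (‖x‖ ^ (-β / 2)) * (ENNReal.ofReal (‖x‖ ^ (β / 2)) * ‖φ x‖ₑ) := by
    refine lintegral_congr_ae (ae_restrict_of_ae ?_)
    have h0 : ∀ᵐ x : E, x ≠ 0 := by simp [ae_iff]
    filter_upwards [h0] with x hx
    have : 0 < ‖x‖ := norm_pos_iff.2 hx
    rw [← mul_assoc, ← ENNReal.ofReal_mul (by positivity), ← Real.rpow_add this]
    simp [neg_div]
  rw [h1]
  refine (sq_lintegral_mul_le (by fun_prop) (by fun_prop)).trans ?_
  rw [← mul_assoc]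
  have e : ∀ (x : E) (s : ℝ), ENNReal.ofReal (‖x‖ ^ (s / 2)) ^ 2 = ENNReal.ofReal (‖x‖ ^ s) :=
    fun x s => by
      rw [← ENNReal.ofReal_pow (by positivity), ← Real.rpow_natCast, ← Real.rpow_mul (by positivity)]
      congr 2; push_cast; ring
  simp only [mul_pow, e]
  gcongr
  exact h R hR

theorem shell_subset_closedBall {a : E → ℝ} {a₀ : ℝ} (ha₀ : 0 < a₀)
    (ha_hom : ∀ t : ℝ, 0 < t → ∀ ξ, a (t • ξ) = t * a ξ)
    (ha : ∀ θ : Metric.sphere (0 : E) 1, a₀ ≤ a θ) {ρ : ℝ} (hρ : 0 < ρ) :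
    shell a ρ ⊆ Metric.closedBall 0 (Real.exp 1 / a₀ * ρ) := by
  rintro η ⟨h0, h1⟩
  rw [mem_closedBall_zero_iff]
  have h2 := le_exp_mul_of_logAdd_sub_le hρ (abs_le.1 h1).2
  by_cases hη : η = 0
  · rw [hη, norm_zero]; positivity
  have hn : 0 < ‖η‖ := norm_pos_iff.2 hη
  have h3 : a₀ * ‖η‖ ≤ a η := by
    have h4 := ha ⟨‖η‖⁻¹ • η, by simp [norm_smul, hn.ne']⟩
    have h5 : a (‖η‖⁻¹ • η) = ‖η‖⁻¹ * a η := ha_hom _ (by positivity) _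
    simp only [h5] at h4
    rw [inv_mul_eq_div, le_div_iff₀ hn] at h4
    exact h4
  rw [div_mul_eq_mul_div, le_div_iff₀ ha₀]
  linarith

theorem exists_volume_shell_le [Nontrivial E] {a : E → ℝ} {a₀ : ℝ} (ha₀ : 0 < a₀)
    (ha_hom : ∀ t : ℝ, 0 < t → ∀ ξ, a (t • ξ) = t * a ξ)
    (ha : ∀ θ : Metric.sphere (0 : E) 1, a₀ ≤ a θ) : ∃ C : ℝ≥0∞, C ≠ ⊤ ∧ ∀ ρ : ℝ, 0 < ρ →
      volume (shell a ρ) ≤ C * ENNReal.ofReal (ρ ^ (Module.finrank ℝ E : ℝ)) := by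
  refine ⟨ENNReal.ofReal ((Real.exp 1 / a₀) ^ (Module.finrank ℝ E)) *
    volume (Metric.closedBall (0 : E) 1),
    ENNReal.mul_ne_top ENNReal.ofReal_ne_top measure_closedBall_lt_top.ne, fun ρ hρ => ?_⟩
  refine (measure_mono (shell_subset_closedBall ha₀ ha_hom ha hρ)).trans ?_
  rw [Measure.addHaar_closedBall' _ _ (by positivity), mul_pow, ENNReal.ofReal_mul (by positivity),
    Real.rpow_natCast]
  exact le_of_eq (by ring)

theorem lintegral_Ioi_one_shell_le {a : E → ℝ} (ham : Measurable a) {F : E → ℝ≥0∞}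
    (hF : Measurable F) :
    ∫⁻ ρ in Set.Ioi (1 : ℝ), ∫⁻ η in shell a ρ, F η ≤ 2 * ∫⁻ η, F η := by
  have hset : MeasurableSet {p : ℝ × E | p.2 ∈ shell a p.1} := by
    have h1 : Measurable fun p : ℝ × E => |logAdd (a p.2) - logAdd p.1| :=
      ((measurable_logAdd.comp (ham.comp measurable_snd)).sub
        (measurable_logAdd.comp measurable_fst)).norm
    exact (measurableSet_lt measurable_const (ham.comp measurable_snd)).inter
      (measurableSet_le h1 measurable_const)
  have h1 : ∀ ρ, ∫⁻ η in shell a ρ, F η =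
      ∫⁻ η, {p : ℝ × E | p.2 ∈ shell a p.1}.indicator (fun p => F p.2) (ρ, η) := fun ρ => by
    rw [← lintegral_indicator (measurableSet_shell ham ρ)]
    rfl
  simp only [h1]
  have hm : Measurable (Function.uncurry fun (ρ : ℝ) (η : E) =>
      {p : ℝ × E | p.2 ∈ shell a p.1}.indicator (fun p => F p.2) (ρ, η)) :=
    (hF.comp measurable_snd).indicator hset
  rw [lintegral_lintegral_swap hm.aemeasurable,
    ← lintegral_const_mul' _ _ (by simp)]
  refine lintegral_mono fun η => ?_
  calc _ ≤ ∫⁻ ρ in Set.Ioi (1 : ℝ), (Set.Icc (a η - 1) (a η + 1)).indicator (fun _ => F η) ρ := by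
        refine setLIntegral_mono' measurableSet_Ioi fun ρ hρ => ?_
        by_cases h : η ∈ shell a ρ
        · have hρ0 : 0 < ρ := zero_lt_one.trans hρ
          have h2 := sub_le_of_logAdd_sub_le hρ0 (abs_le.1 h.2).2
          have h3 := sub_le_of_logAdd_sub_le (r := ρ) h.1 (by linarith [(abs_le.1 h.2).1])
          rw [Set.indicator_of_mem (s := {p : ℝ × E | p.2 ∈ shell a p.1}) h,
            Set.indicator_of_mem (Set.mem_Icc.2 ⟨by linarith, by linarith⟩)]
        · rw [Set.indicator_of_notMem (s := {p : ℝ × E | p.2 ∈ shell a p.1}) h]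
          exact zero_le
    _ ≤ ∫⁻ ρ, (Set.Icc (a η - 1) (a η + 1)).indicator (fun _ => F η) ρ :=
        setLIntegral_le_lintegral _ _
    _ = _ := by
        rw [lintegral_indicator measurableSet_Icc, setLIntegral_const, Real.volume_Icc,
          show a η + 1 - (a η - 1) = 2 by ring, mul_comm]
        simp

end Weights

/-- The weight arising from low frequencies. -/
def hardyWeight (q β z : ℝ) : ℝ := if 1 ≤ z then z ^ q else z ^ β

theorem measurable_hardyWeight (q β : ℝ) : Measurable (hardyWeight q β) :=
  Measurable.ite (measurableSet_le measurable_const measurable_id) (by fun_prop) (by fun_prop)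

theorem lintegral_hardyWeight_le {q β m r : ℝ} (hq : q < m) (hβ : m < β) (hm : 0 < m)
    (hr : 0 ≤ r) :
    ∫⁻ ρ in Set.Ioi (0 : ℝ), ENNReal.ofReal (ρ ^ (-m - 1)) * ENNReal.ofReal (hardyWeight q β (ρ * r))
      ≤ ENNReal.ofReal (1 / (β - m) + 1 / (m - q)) * ENNReal.ofReal (r ^ m) := by
  rcases hr.eq_or_lt with rfl | hr
  · have : hardyWeight q β 0 = 0 := by
      rw [hardyWeight, if_neg (by norm_num), Real.zero_rpow (by linarith)]
    simp [this]
  have hβm := sub_pos.2 hβ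
  have hmq := sub_pos.2 hq
  have e : Set.Ioi (0 : ℝ) = Set.Ioo 0 (1 / r) ∪ Set.Ici (1 / r) :=
    (Set.Ioo_union_Ici_eq_Ioi (by positivity)).symm
  rw [e]
  refine (lintegral_union_le _ _ _).trans ?_
  rw [ENNReal.ofReal_add (by positivity) (by positivity), add_mul]
  gcongr
  · have h : ∀ ρ ∈ Set.Ioo 0 (1 / r), ENNReal.ofReal (ρ ^ (-m - 1)) *
        ENNReal.ofReal (hardyWeight q β (ρ * r)) =
        ENNReal.ofReal (r ^ β) * ENNReal.ofReal (ρ ^ (β - m - 1)) := fun ρ hρ => by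
      have h0 : 0 < ρ := hρ.1
      rw [hardyWeight, if_neg (by rw [not_le]; exact (lt_div_iff₀ hr).1 hρ.2),
        ← ENNReal.ofReal_mul (by positivity), ← ENNReal.ofReal_mul (by positivity),
        Real.mul_rpow h0.le hr.le, show β - m - 1 = -m - 1 + β by ring, Real.rpow_add h0]
      congr 1; ring
    rw [setLIntegral_congr_fun measurableSet_Ioo h, lintegral_const_mul' _ _ ENNReal.ofReal_ne_top,
      lintegral_Ioo_rpow (by linarith) (by positivity), ← ENNReal.ofReal_mul (by positivity),
      ← ENNReal.ofReal_mul (by positivity)]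
    refine ENNReal.ofReal_le_ofReal (le_of_eq ?_)
    rw [show β - m - 1 + 1 = β - m by ring, Real.div_rpow zero_le_one hr.le, Real.one_rpow,
      Real.rpow_sub hr]
    field_simp
  · have h : ∀ ρ ∈ Set.Ici (1 / r), ENNReal.ofReal (ρ ^ (-m - 1)) *
        ENNReal.ofReal (hardyWeight q β (ρ * r)) =
        ENNReal.ofReal (r ^ q) * ENNReal.ofReal (ρ ^ (q - m - 1)) := fun ρ hρ => by
      have h0 : 0 < ρ := lt_of_lt_of_le (by positivity) hρ
      rw [hardyWeight, if_pos ((div_le_iff₀ hr).1 hρ),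
        ← ENNReal.ofReal_mul (by positivity), ← ENNReal.ofReal_mul (by positivity),
        Real.mul_rpow h0.le hr.le, show q - m - 1 = -m - 1 + q by ring, Real.rpow_add h0]
      congr 1; ring
    rw [setLIntegral_congr_fun measurableSet_Ici h, lintegral_const_mul' _ _ ENNReal.ofReal_ne_top,
      setLIntegral_congr Ioi_ae_eq_Ici.symm,
      lintegral_Ioi_rpow (by linarith) (by positivity), ← ENNReal.ofReal_mul (by positivity),
      ← ENNReal.ofReal_mul (by positivity)]
    refine ENNReal.ofReal_le_ofReal (le_of_eq ?_)
    rw [show q - m - 1 + 1 = q - m by ring, Real.div_rpow zero_le_one hr.le, Real.one_rpow,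
      Real.rpow_sub hr, neg_sub]
    field_simp

section Low

variable {E : Type*} [NormedAddCommGroup E] [InnerProductSpace ℝ E] [FiniteDimensional ℝ E]
  [MeasurableSpace E] [BorelSpace E]

theorem enorm_indicator_sq {s : Set E} (g : E → ℂ) (x : E) :
    ‖s.indicator g x‖ₑ ^ 2 = s.indicator (fun x => ‖g x‖ₑ ^ 2) x := by
  by_cases h : x ∈ s <;> simp [h]

theorem inv_sq_le_rpow_neg {q κ : ℝ} (hq : q ≤ 2) (hκ : 1 ≤ κ) : (κ ^ 2)⁻¹ ≤ κ ^ (-q) := by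
  rw [← Real.rpow_natCast, ← Real.rpow_neg (by linarith)]
  exact Real.rpow_le_rpow_of_exponent_le hκ (by push_cast; linarith)

theorem exists_lintegral_shell_low_le [Nontrivial E] {a : E → ℝ} {a₀ q β : ℝ} (ha₀ : 0 < a₀)
    (ha_hom : ∀ t : ℝ, 0 < t → ∀ ξ, a (t • ξ) = t * a ξ)
    (ha : ∀ θ : Metric.sphere (0 : E) 1, a₀ ≤ a θ) (hq0 : 0 ≤ q) (hq : q ≤ 2)
    (hβ : β < Module.finrank ℝ E) :
    ∃ C : ℝ≥0∞, C ≠ ⊤ ∧ ∀ ρ : ℝ, 0 < ρ → ∀ κ : ℝ, 1 ≤ κ → ∀ g : E → ℂ, Measurable g →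
      Integrable g → MemLp g 2 →
      ∫⁻ η in shell a ρ, (‖𝓕 ({x | κ ≤ ρ * ‖x‖}.indicator g) η‖ₑ ^ 2 +
        ENNReal.ofReal ((κ ^ 2)⁻¹) * energy (ρ / (1 + ρ)) ({x | ρ * ‖x‖ < κ}.indicator g) η) ≤
      C * (ENNReal.ofReal (κ ^ (-q)) *
        ∫⁻ x, ENNReal.ofReal (hardyWeight q β (ρ * ‖x‖)) * ‖g x‖ₑ ^ 2) := by
  obtain ⟨Cv, hCv, hv⟩ := exists_volume_shell_le ha₀ ha_hom ha
  obtain ⟨Ch, hCh, hh⟩ := exists_sq_lintegral_ball_le (E := E) hβ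
  set c₀ := ENNReal.ofReal (1 + (2 * π) ^ 2) with hc₀
  set c₁ := ENNReal.ofReal ((2 * π) ^ 2) with hc₁
  refine ⟨1 + 2 * (c₀ * Cv * Ch + c₁ * 2), ?_, ?_⟩
  · simp only [ne_eq, ENNReal.add_eq_top, ENNReal.mul_eq_top, not_or]
    simp [hCv, hCh, hc₀, hc₁]
  intro ρ hρ κ hκ g hgm hgi hg2
  have hκ0 : 0 < κ := by linarith
  have hκq := inv_sq_le_rpow_neg hq hκ
  set n := Module.finrank ℝ E
  set l := ρ / (1 + ρ) with hl
  have hl0 : 0 ≤ l := by positivity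
  have hlρ : l ≤ ρ := div_le_self hρ.le (by linarith)
  set T := ENNReal.ofReal (κ ^ (-q)) *
    ∫⁻ x, ENNReal.ofReal (hardyWeight q β (ρ * ‖x‖)) * ‖g x‖ₑ ^ 2 with hT
  have hzm : Measurable fun x : E => ρ * ‖x‖ := by fun_prop
  have hs₁ : MeasurableSet {x : E | κ ≤ ρ * ‖x‖} := measurableSet_le measurable_const hzm
  have hs₂ : MeasurableSet {x : E | 1 ≤ ρ * ‖x‖ ∧ ρ * ‖x‖ < κ} :=
    (measurableSet_le measurable_const hzm).inter (measurableSet_lt hzm measurable_const)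
  set g₁ := {x : E | κ ≤ ρ * ‖x‖}.indicator g with hg₁
  set ga := (Metric.ball (0 : E) (1 / ρ)).indicator g with hga
  set gb := {x : E | 1 ≤ ρ * ‖x‖ ∧ ρ * ‖x‖ < κ}.indicator g with hgb
  have hball : ∀ x : E, x ∈ Metric.ball (0 : E) (1 / ρ) ↔ ρ * ‖x‖ < 1 := fun x => by
    rw [mem_ball_zero_iff, lt_div_iff₀ hρ, mul_comm]
  have hsplit : {x : E | ρ * ‖x‖ < κ}.indicator g = ga + gb := by
    ext x
    rw [hga, hgb, Pi.add_apply]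
    by_cases h1 : ρ * ‖x‖ < 1
    · rw [Set.indicator_of_mem ((hball x).2 h1), Set.indicator_of_mem
        (show x ∈ {x : E | ρ * ‖x‖ < κ} from h1.trans_le hκ),
        Set.indicator_of_notMem 
          (fun h : x ∈ {x : E | 1 ≤ ρ * ‖x‖ ∧ ρ * ‖x‖ < κ} => absurd h.1 (not_le.2 h1)), add_zero]
    · rw [Set.indicator_of_notMem (fun h => h1 ((hball x).1 h)), zero_add]
      by_cases h2 : ρ * ‖x‖ < κ
      · rw [Set.indicator_of_mem (show x ∈ {x : E | ρ * ‖x‖ < κ} from h2), Set.indicator_of_mem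
          (show x ∈ {x : E | 1 ≤ ρ * ‖x‖ ∧ ρ * ‖x‖ < κ} from ⟨not_lt.1 h1, h2⟩)]
      · rw [Set.indicator_of_notMem (show x ∉ {x : E | ρ * ‖x‖ < κ} from h2),
          Set.indicator_of_notMem (fun h : x ∈ {x : E | 1 ≤ ρ * ‖x‖ ∧ ρ * ‖x‖ < κ} => h2 h.2)]
  have hga0 : ∀ x, 1 / ρ ≤ ‖x‖ → ga x = 0 := fun x hx =>
    Set.indicator_of_notMem (by rw [mem_ball_zero_iff]; linarith) g
  have hgb0 : ∀ x, κ / ρ ≤ ‖x‖ → gb x = 0 := fun x hx =>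
    Set.indicator_of_notMem (fun h => by
      rw [div_le_iff₀ hρ, mul_comm] at hx
      exact absurd h.2 (not_lt.2 hx)) g
  have hgai : Integrable ga := hgi.indicator measurableSet_ball
  have hgbi : Integrable gb := hgi.indicator hs₂
  have hg₁i : Integrable g₁ := hgi.indicator hs₁
  have hHm : Measurable fun x : E => ENNReal.ofReal (hardyWeight q β (ρ * ‖x‖)) :=
    ((measurable_hardyWeight q β).comp (by fun_prop)).ennreal_ofReal
  have e₁ : ∫⁻ x, ‖g₁ x‖ₑ ^ 2 ≤ T := by
    rw [hT, ← lintegral_const_mul' _ _ ENNReal.ofReal_ne_top]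
    refine lintegral_mono fun x => ?_
    rw [hg₁, enorm_indicator_sq]
    by_cases hx : x ∈ {x : E | κ ≤ ρ * ‖x‖}
    swap
    · rw [Set.indicator_of_notMem hx]
      exact zero_le
    have hx' : κ ≤ ρ * ‖x‖ := hx
    rw [Set.indicator_of_mem hx]
    rw [← mul_assoc, ← ENNReal.ofReal_mul (by positivity)]
    refine le_mul_of_one_le_left zero_le ?_
    rw [ENNReal.one_le_ofReal, hardyWeight, if_pos (by linarith), Real.rpow_neg hκ0.le,
      inv_mul_eq_div, one_le_div (by positivity)]
    gcongr
  have e₂ : ENNReal.ofReal ((κ ^ 2)⁻¹) * ∫⁻ x in Metric.ball (0 : E) (1 / ρ),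
      ENNReal.ofReal ((ρ * ‖x‖) ^ β) * ‖g x‖ₑ ^ 2 ≤ T := by
    refine mul_le_mul' (ENNReal.ofReal_le_ofReal hκq) ?_
    refine (setLIntegral_mono' measurableSet_ball fun x hx => ?_).trans
      (setLIntegral_le_lintegral _ _)
    rw [hardyWeight, if_neg (not_le.2 ((hball x).1 hx))]
  have e₃ : ENNReal.ofReal ((κ ^ 2)⁻¹) * ∫⁻ x, ENNReal.ofReal (1 + (l * ‖x‖) ^ 2) * ‖gb x‖ₑ ^ 2 ≤
      2 * T := by
    rw [hT, ← lintegral_const_mul' _ _ ENNReal.ofReal_ne_top,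
      ← lintegral_const_mul' _ _ ENNReal.ofReal_ne_top, ← lintegral_const_mul' _ _ (by simp)]
    refine lintegral_mono fun x => ?_
    rw [hgb, enorm_indicator_sq]
    by_cases hx : x ∈ {x : E | 1 ≤ ρ * ‖x‖ ∧ ρ * ‖x‖ < κ}
    swap
    · rw [Set.indicator_of_notMem hx]; simp
    rw [Set.indicator_of_mem hx, ← mul_assoc, ← mul_assoc, ← mul_assoc,
      show (2 : ℝ≥0∞) = ENNReal.ofReal 2 by simp, ← ENNReal.ofReal_mul (by positivity),
      ← ENNReal.ofReal_mul (by positivity), ← ENNReal.ofReal_mul (by positivity)]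
    obtain ⟨hx1, hx2⟩ := hx
    rw [show hardyWeight q β (ρ * ‖x‖) = (ρ * ‖x‖) ^ q from if_pos hx1]
    refine mul_le_mul' (ENNReal.ofReal_le_ofReal ?_) le_rfl
    have hz : l * ‖x‖ ≤ ρ * ‖x‖ := by gcongr
    have hz0 : 0 ≤ l * ‖x‖ := by positivity
    generalize ρ * ‖x‖ = z at *
    have hz' : 0 < z := by linarith
    calc (κ ^ 2)⁻¹ * (1 + (l * ‖x‖) ^ 2) ≤ (κ ^ 2)⁻¹ * (z ^ 2 + z ^ 2) := by
          gcongr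
          nlinarith
      _ = 2 * (z / κ) ^ (2 : ℝ) := by
          rw [show (2 : ℝ) = ((2 : ℕ) : ℝ) by norm_num, Real.rpow_natCast]
          field_simp; norm_num
      _ ≤ 2 * (z / κ) ^ q := by
          gcongr ?_ * ?_
          exact Real.rpow_le_rpow_of_exponent_ge (by positivity)
            ((div_le_one hκ0).2 hx2.le) hq
      _ = _ := by
          rw [Real.div_rpow hz'.le hκ0.le, Real.rpow_neg hκ0.le]
          field_simp
  have e₄ : ENNReal.ofReal ((κ ^ 2)⁻¹) * ∫⁻ η in shell a ρ, energy l ga η ≤ c₀ * Cv * Ch * T := by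
    calc _ ≤ ENNReal.ofReal ((κ ^ 2)⁻¹) * ∫⁻ η in shell a ρ, c₀ * (∫⁻ x, ‖ga x‖ₑ) ^ 2 := by
          gcongr with η
          refine energy_le hgai hga0 hl0 ?_ η
          rw [mul_one_div]
          exact div_le_one_of_le₀ hlρ hρ.le
      _ ≤ ENNReal.ofReal ((κ ^ 2)⁻¹) * (c₀ * (Ch * (ENNReal.ofReal ((1 / ρ) ^ (n - β)) *
          ∫⁻ x in Metric.ball (0 : E) (1 / ρ), ENNReal.ofReal (‖x‖ ^ β) * ‖g x‖ₑ ^ 2)) *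
            (Cv * ENNReal.ofReal (ρ ^ (n : ℝ)))) := by
          rw [setLIntegral_const]
          gcongr
          · have : ∫⁻ x, ‖ga x‖ₑ = ∫⁻ x in Metric.ball (0 : E) (1 / ρ), ‖g x‖ₑ := by
              rw [← lintegral_indicator measurableSet_ball]
              refine lintegral_congr fun x => ?_
              rw [hga, enorm_indicator_eq_indicator_enorm]
            rw [this]
            exact hh _ (by positivity) g hgm
          · exact hv ρ hρ
      _ = c₀ * Cv * Ch * (ENNReal.ofReal ((κ ^ 2)⁻¹) * (ENNReal.ofReal (ρ ^ β) *
          ∫⁻ x in Metric.ball (0 : E) (1 / ρ), ENNReal.ofReal (‖x‖ ^ β) * ‖g x‖ₑ ^ 2)) := by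
          have : ENNReal.ofReal (ρ ^ β) =
              ENNReal.ofReal ((1 / ρ) ^ (n - β)) * ENNReal.ofReal (ρ ^ (n : ℝ)) := by
            rw [← ENNReal.ofReal_mul (by positivity), Real.div_rpow zero_le_one hρ.le,
              Real.one_rpow, Real.rpow_sub hρ]
            congr 1
            field_simp
          rw [this]
          ring
      _ ≤ _ := by
          gcongr
          refine le_trans (le_of_eq ?_) e₂
          rw [← lintegral_const_mul' _ _ ENNReal.ofReal_ne_top]
          congr 1
          refine lintegral_congr fun x => ?_
          rw [← mul_assoc, ← ENNReal.ofReal_mul (by positivity),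
            Real.mul_rpow hρ.le (norm_nonneg _)]
  have e₅ : ENNReal.ofReal ((κ ^ 2)⁻¹) * ∫⁻ η in shell a ρ, energy l gb η ≤ c₁ * 2 * T := by
    calc _ ≤ ENNReal.ofReal ((κ ^ 2)⁻¹) * (c₁ *
          ∫⁻ x, ENNReal.ofReal (1 + (l * ‖x‖) ^ 2) * ‖gb x‖ₑ ^ 2) := by
          gcongr
          exact (setLIntegral_le_lintegral _ _).trans
            (lintegral_energy_le hgbi (hg2.indicator hs₂) hgb0 l)
      _ = c₁ * (ENNReal.ofReal ((κ ^ 2)⁻¹) *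
          ∫⁻ x, ENNReal.ofReal (1 + (l * ‖x‖) ^ 2) * ‖gb x‖ₑ ^ 2) := by ring
      _ ≤ c₁ * (2 * T) := by gcongr
      _ = _ := by ring
  rw [hsplit]
  calc _ ≤ ∫⁻ η in shell a ρ, (‖𝓕 g₁ η‖ₑ ^ 2 + ENNReal.ofReal ((κ ^ 2)⁻¹) *
        (2 * (energy l ga η + energy l gb η))) := by
        gcongr with η
        exact energy_add_le hgai hgbi (integrable_norm_mul_of_eq_zero hgai hga0)
          (integrable_norm_mul_of_eq_zero hgbi hgb0) l η
    _ = (∫⁻ η in shell a ρ, ‖𝓕 g₁ η‖ₑ ^ 2) +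
        2 * (ENNReal.ofReal ((κ ^ 2)⁻¹) * (∫⁻ η in shell a ρ, energy l ga η) +
          ENNReal.ofReal ((κ ^ 2)⁻¹) * ∫⁻ η in shell a ρ, energy l gb η) := by
        rw [lintegral_add_left ((continuous_fourier hg₁i).measurable.enorm.pow_const 2),
          lintegral_const_mul' _ _ ENNReal.ofReal_ne_top, lintegral_const_mul' _ _ (by simp),
          lintegral_add_left (measurable_energy hgai l)]
        ring
    _ ≤ T + 2 * (c₀ * Cv * Ch * T + c₁ * 2 * T) := by
        gcongr
        refine (setLIntegral_le_lintegral _ _).trans ?_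
        rw [lintegral_enorm_fourier_sq hg₁i (hg2.indicator hs₁)]
        exact e₁
    _ = _ := by ring

theorem exists_lintegral_shell_high_le {a : E → ℝ} {q m : ℝ} (ham : Measurable a) (hq0 : 0 ≤ q)
    (hq : q ≤ 2) (hqm : q ≤ m) :
    ∃ C : ℝ≥0∞, C ≠ ⊤ ∧ ∀ κ : ℝ, 1 ≤ κ → ∀ g : E → ℂ, Integrable g → MemLp g 2 →
      ∫⁻ ρ in Set.Ioi (1 : ℝ), ∫⁻ η in shell a ρ, (‖𝓕 ({x | κ ≤ ‖x‖}.indicator g) η‖ₑ ^ 2 +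
        ENNReal.ofReal ((κ ^ 2)⁻¹) * energy (ρ / (1 + ρ)) ({x | ‖x‖ < κ}.indicator g) η) ≤
      C * (ENNReal.ofReal (κ ^ (-q)) *
        ∫⁻ x, ENNReal.ofReal ((1 + ‖x‖ ^ 2) ^ (m / 2)) * ‖g x‖ₑ ^ 2) := by
  set c₁ := ENNReal.ofReal ((2 * π) ^ 2) with hc₁
  refine ⟨2 * (1 + c₁ * 2), ?_, fun κ hκ g hgi hg2 => ?_⟩
  · simp only [ne_eq, ENNReal.add_eq_top, ENNReal.mul_eq_top, not_or]
    simp [hc₁]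
  have hκ0 : 0 < κ := by linarith
  set T := ENNReal.ofReal (κ ^ (-q)) *
    ∫⁻ x, ENNReal.ofReal ((1 + ‖x‖ ^ 2) ^ (m / 2)) * ‖g x‖ₑ ^ 2 with hT
  have hs₁ : MeasurableSet {x : E | κ ≤ ‖x‖} := measurableSet_le measurable_const (by fun_prop)
  have hs₂ : MeasurableSet {x : E | ‖x‖ < κ} := measurableSet_lt (by fun_prop) measurable_const
  set g₁ := {x : E | κ ≤ ‖x‖}.indicator g with hg₁
  set g₂ := {x : E | ‖x‖ < κ}.indicator g with hg₂
  have hg₁i : Integrable g₁ := hgi.indicator hs₁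
  have hg₂i : Integrable g₂ := hgi.indicator hs₂
  have hg₂0 : ∀ x, κ ≤ ‖x‖ → g₂ x = 0 := fun x hx =>
    Set.indicator_of_notMem (fun h : x ∈ {x : E | ‖x‖ < κ} => absurd hx (not_le.2 h)) g
  have hw : ∀ x : E, (1 + ‖x‖ ^ 2) ^ (q / 2) ≤ (1 + ‖x‖ ^ 2) ^ (m / 2) := fun x =>
    Real.rpow_le_rpow_of_exponent_le (by nlinarith [norm_nonneg x]) (by linarith)
  have e₁ : ∫⁻ x, ‖g₁ x‖ₑ ^ 2 ≤ T := by
    rw [hT, ← lintegral_const_mul' _ _ ENNReal.ofReal_ne_top]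
    refine lintegral_mono fun x => ?_
    rw [hg₁, enorm_indicator_sq]
    by_cases hx : x ∈ {x : E | κ ≤ ‖x‖}
    swap
    · rw [Set.indicator_of_notMem hx]
      exact zero_le
    have hx' : κ ≤ ‖x‖ := hx
    rw [Set.indicator_of_mem hx]
    rw [← mul_assoc, ← ENNReal.ofReal_mul (by positivity)]
    refine le_mul_of_one_le_left zero_le ?_
    rw [ENNReal.one_le_ofReal, Real.rpow_neg hκ0.le,
      inv_mul_eq_div, one_le_div (by positivity)]
    refine le_trans ?_ (hw x)
    rw [show q / 2 = (2 : ℝ)⁻¹ * q by ring, Real.rpow_mul (by positivity)]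
    refine Real.rpow_le_rpow hκ0.le ?_ hq0
    rw [show (2 : ℝ)⁻¹ = 1 / 2 by norm_num, ← Real.sqrt_eq_rpow]
    exact Real.le_sqrt_of_sq_le (by nlinarith)
  have e₂ : ENNReal.ofReal ((κ ^ 2)⁻¹) * ∫⁻ x, ENNReal.ofReal (1 + (1 * ‖x‖) ^ 2) * ‖g₂ x‖ₑ ^ 2 ≤
      2 * T := by
    rw [hT, ← lintegral_const_mul' _ _ ENNReal.ofReal_ne_top,
      ← lintegral_const_mul' _ _ ENNReal.ofReal_ne_top, ← lintegral_const_mul' _ _ (by simp)]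
    refine lintegral_mono fun x => ?_
    rw [hg₂, enorm_indicator_sq]
    by_cases hx : x ∈ {x : E | ‖x‖ < κ}
    swap
    · rw [Set.indicator_of_notMem hx]; simp
    rw [Set.indicator_of_mem hx, ← mul_assoc, ← mul_assoc, ← mul_assoc,
      show (2 : ℝ≥0∞) = ENNReal.ofReal 2 by simp, ← ENNReal.ofReal_mul (by positivity),
      ← ENNReal.ofReal_mul (by positivity), ← ENNReal.ofReal_mul (by positivity)]
    refine mul_le_mul' (ENNReal.ofReal_le_ofReal ?_) le_rfl
    have hx' : ‖x‖ < κ := hx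
    refine le_trans ?_ (mul_le_mul_of_nonneg_left (hw x) (by positivity))
    have hle : 1 + ‖x‖ ^ 2 ≤ 2 * κ ^ 2 := by nlinarith [norm_nonneg x]
    have hpos : 0 < 1 + ‖x‖ ^ 2 := by positivity
    rw [one_mul]
    generalize 1 + ‖x‖ ^ 2 = w at *
    calc (κ ^ 2)⁻¹ * w = 2 * (w / (2 * κ ^ 2)) ^ (1 : ℝ) := by rw [Real.rpow_one]; field_simp
      _ ≤ 2 * (w / (2 * κ ^ 2)) ^ (q / 2) := by
          gcongr ?_ * ?_
          exact Real.rpow_le_rpow_of_exponent_ge (by positivity)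
            ((div_le_one (by positivity)).2 hle) (by linarith)
      _ ≤ 2 * (w / κ ^ 2) ^ (q / 2) := by
          gcongr
          nlinarith [sq_nonneg κ]
      _ = _ := by
          rw [Real.div_rpow hpos.le (by positivity), ← Real.rpow_natCast κ,
            ← Real.rpow_mul hκ0.le, Real.rpow_neg hκ0.le,
            show ((2 : ℕ) : ℝ) * (q / 2) = q by push_cast; ring]
          field_simp
  calc _ ≤ ∫⁻ ρ in Set.Ioi (1 : ℝ), ∫⁻ η in shell a ρ, (‖𝓕 g₁ η‖ₑ ^ 2 +
        ENNReal.ofReal ((κ ^ 2)⁻¹) * energy 1 g₂ η) := by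
        refine setLIntegral_mono' measurableSet_Ioi fun ρ hρ => ?_
        have hρ0 : 0 < ρ := zero_lt_one.trans hρ
        unfold energy
        gcongr
        exact (div_le_one (by positivity)).2 (by linarith)
    _ ≤ 2 * ∫⁻ η, (‖𝓕 g₁ η‖ₑ ^ 2 + ENNReal.ofReal ((κ ^ 2)⁻¹) * energy 1 g₂ η) :=
        lintegral_Ioi_one_shell_le ham
          (((continuous_fourier hg₁i).measurable.enorm.pow_const 2).add
            ((measurable_energy hg₂i 1).const_mul _))
    _ ≤ 2 * (T + c₁ * (2 * T)) := by
        rw [lintegral_add_left ((continuous_fourier hg₁i).measurable.enorm.pow_const 2),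
          lintegral_const_mul' _ _ ENNReal.ofReal_ne_top,
          lintegral_enorm_fourier_sq hg₁i (hg2.indicator hs₁)]
        refine mul_le_mul' le_rfl (add_le_add e₁ ?_)
        calc _ ≤ ENNReal.ofReal ((κ ^ 2)⁻¹) * (c₁ *
              ∫⁻ x, ENNReal.ofReal (1 + (1 * ‖x‖) ^ 2) * ‖g₂ x‖ₑ ^ 2) := by
              gcongr
              exact lintegral_energy_le hg₂i (hg2.indicator hs₂) hg₂0 1
          _ = c₁ * (ENNReal.ofReal ((κ ^ 2)⁻¹) *
              ∫⁻ x, ENNReal.ofReal (1 + (1 * ‖x‖) ^ 2) * ‖g₂ x‖ₑ ^ 2) := by ring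
          _ ≤ _ := by gcongr
    _ = _ := by ring

end Low

section Tail

variable {E : Type*} [NormedAddCommGroup E] [InnerProductSpace ℝ E] [FiniteDimensional ℝ E]
  [MeasurableSpace E] [BorelSpace E]

theorem indicator_le_add_indicator_lt {r : E → ℝ} {κ : ℝ} (g : E → ℂ) :
    {x | κ ≤ r x}.indicator g + {x | r x < κ}.indicator g = g := by
  have : {x | r x < κ} = {x | κ ≤ r x}ᶜ := by
    ext x; exact (not_le (a := κ)).symm
  rw [this, Set.indicator_self_add_compl]

theorem rpow_le_one_add_sq_rpow {r m : ℝ} (hr : 0 ≤ r) (hm : 0 ≤ m) :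
    r ^ m ≤ (1 + r ^ 2) ^ (m / 2) := by
  calc r ^ m = (r ^ 2) ^ (m / 2) := by
        rw [← Real.rpow_natCast r, ← Real.rpow_mul hr]; congr 1; push_cast; ring
    _ ≤ _ := Real.rpow_le_rpow (by positivity) (by linarith) (by linarith)

theorem lintegral_lintegral_hardyWeight_le {q β m : ℝ} (hq : q < m) (hβ : m < β) (hm : 0 < m)
    {g : E → ℂ} (hg : Measurable g) :
    ∫⁻ ρ in Set.Ioi (0 : ℝ), ENNReal.ofReal (ρ ^ (-m - 1)) *
        ∫⁻ x, ENNReal.ofReal (hardyWeight q β (ρ * ‖x‖)) * ‖g x‖ₑ ^ 2 ≤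
      ENNReal.ofReal (1 / (β - m) + 1 / (m - q)) *
        ∫⁻ x, ENNReal.ofReal ((1 + ‖x‖ ^ 2) ^ (m / 2)) * ‖g x‖ₑ ^ 2 := by
  have hH : Measurable fun z : ℝ × E => ENNReal.ofReal (hardyWeight q β (z.1 * ‖z.2‖)) :=
    ((measurable_hardyWeight q β).comp (by fun_prop)).ennreal_ofReal
  have hJ : Measurable (Function.uncurry fun (ρ : ℝ) (x : E) => ENNReal.ofReal (ρ ^ (-m - 1)) *
      (ENNReal.ofReal (hardyWeight q β (ρ * ‖x‖)) * ‖g x‖ₑ ^ 2)) := by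
    refine Measurable.mul (by fun_prop) (hH.mul ?_)
    exact (hg.comp measurable_snd).enorm.pow_const 2
  calc _ = ∫⁻ ρ in Set.Ioi (0 : ℝ), ∫⁻ x, ENNReal.ofReal (ρ ^ (-m - 1)) *
        (ENNReal.ofReal (hardyWeight q β (ρ * ‖x‖)) * ‖g x‖ₑ ^ 2) := by
        congr 1 with ρ
        rw [lintegral_const_mul' _ _ ENNReal.ofReal_ne_top]
    _ = ∫⁻ x, ∫⁻ ρ in Set.Ioi (0 : ℝ), ENNReal.ofReal (ρ ^ (-m - 1)) *
        (ENNReal.ofReal (hardyWeight q β (ρ * ‖x‖)) * ‖g x‖ₑ ^ 2) :=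
        lintegral_lintegral_swap hJ.aemeasurable
    _ = ∫⁻ x, (∫⁻ ρ in Set.Ioi (0 : ℝ), ENNReal.ofReal (ρ ^ (-m - 1)) *
        ENNReal.ofReal (hardyWeight q β (ρ * ‖x‖))) * ‖g x‖ₑ ^ 2 := by
        congr 1 with x
        rw [← lintegral_mul_const' _ _ (by simp)]
        simp only [mul_assoc]
    _ ≤ ∫⁻ x, ENNReal.ofReal (1 / (β - m) + 1 / (m - q)) *
        (ENNReal.ofReal ((1 + ‖x‖ ^ 2) ^ (m / 2)) * ‖g x‖ₑ ^ 2) := by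
        refine lintegral_mono fun x => ?_
        rw [← mul_assoc]
        refine mul_le_mul' ((lintegral_hardyWeight_le hq hβ hm (norm_nonneg x)).trans ?_) le_rfl
        exact mul_le_mul' le_rfl
          (ENNReal.ofReal_le_ofReal (rpow_le_one_add_sq_rpow (norm_nonneg x) hm.le))
    _ = _ := lintegral_const_mul' _ _ ENNReal.ofReal_ne_top

theorem shell_prefactor_le_of_le_one {m ρ : ℝ} (hm : 1 < m) (hρ : 0 < ρ) (hρ1 : ρ ≤ 1) :
    (1 + ρ) / ρ * ((1 + ρ) / ρ ^ m) * (1 + ρ) ^ (m - 1) ≤ 2 ^ (m + 1) * ρ ^ (-m - 1) := by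
  have : (1 + ρ) / ρ * ((1 + ρ) / ρ ^ m) * (1 + ρ) ^ (m - 1) =
      (1 + ρ) ^ (m + 1) * ρ ^ (-m - 1) := by
    rw [show m + 1 = m - 1 + 1 + 1 by ring, Real.rpow_add_one (by positivity),
      Real.rpow_add_one (by positivity), show -m - 1 = -(m + 1) by ring, Real.rpow_neg hρ.le,
      Real.rpow_add_one hρ.ne']
    field_simp
  rw [this]
  gcongr
  linarith

theorem shell_prefactor_le_of_one_le {m ρ : ℝ} (hm : 1 < m) (hρ : 1 ≤ ρ) :
    (1 + ρ) / ρ * ((1 + ρ) / ρ ^ m) * (1 + ρ) ^ (m - 1) ≤ 2 ^ (m + 1) := by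
  have hρ0 : 0 < ρ := by linarith
  have : (1 + ρ) / ρ * ((1 + ρ) / ρ ^ m) * (1 + ρ) ^ (m - 1) = ((1 + ρ) / ρ) ^ (m + 1) := by
    rw [Real.div_rpow (by positivity) hρ0.le, show m + 1 = m - 1 + 1 + 1 by ring,
      Real.rpow_add_one (by positivity), Real.rpow_add_one (by positivity),
      show m - 1 + 1 + 1 = m + 1 by ring, Real.rpow_add_one hρ0.ne']
    field_simp
  rw [this]
  gcongr
  rw [div_le_iff₀ hρ0]
  linarith

theorem exists_lintegral_shells_tail_le [Nontrivial E] {b : ℝ → ℝ} (hb : ContDiff ℝ 1 b)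
    (hb1 : ∀ z, |b z| ≤ 1) (hb0 : ∀ z, 1 < |z| → b z = 0) {B : ℝ} (hB : ∀ z, |deriv b z| ≤ B)
    {a : E → ℝ} {m k a₀ q : ℝ} (hm : 1 < m) (hmn : m < Module.finrank ℝ E) (hk : 0 ≤ k)
    (ha₀ : 0 < a₀) (ham : Measurable a)
    (ha_hom : ∀ t : ℝ, 0 < t → ∀ ξ, a (t • ξ) = t * a ξ)
    (ha_pos : ∀ ξ, ξ ≠ 0 → 0 < a ξ) (ha : ∀ θ : Metric.sphere (0 : E) 1, a₀ ≤ a θ)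
    (hq0 : 0 ≤ q) (hq : q ≤ 2) (hqm : q < m) :
    ∃ C : ℝ≥0∞, C ≠ ⊤ ∧ ∀ κ : ℝ, 1 ≤ κ → ∀ g : E → ℂ, Measurable g → Integrable g → MemLp g 2 →
      ∫⁻ ρ in Set.Ioi (0 : ℝ), ENNReal.ofReal ((1 + ρ) / ρ * ((1 + ρ) / ρ ^ m)) *
        ∫⁻ θ : Metric.sphere (0 : E) 1, (∫⁻ y in {y : ℝ | κ ≤ 2 + ρ ^ m / (1 + ρ) * |y|},
          ‖𝓕 (profile b a m k ρ θ (𝓕 g)) y‖ₑ ^ 2) ∂(volume : Measure E).toSphere ≤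
      C * (ENNReal.ofReal (κ ^ (-q)) *
        ∫⁻ x, ENNReal.ofReal ((1 + ‖x‖ ^ 2) ^ (m / 2)) * ‖g x‖ₑ ^ 2) := by
  obtain ⟨β, hmβ, hβ⟩ := exists_between hmn
  obtain ⟨Ct, hCt, ht⟩ :=
    exists_lintegral_fourier_profile_tail_le hb hb1 hb0 hB hm hk ha₀ ham ha_hom ha_pos ha
  obtain ⟨Cl, hCl, hl⟩ := exists_lintegral_shell_low_le ha₀ ha_hom ha hq0 hq hβ
  obtain ⟨Ch, hCh, hh⟩ := exists_lintegral_shell_high_le (E := E) (a := a) ham hq0 hq hqm.le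
  set c := ENNReal.ofReal (2 ^ (m + 1)) with hc
  set d := ENNReal.ofReal (1 / (β - m) + 1 / (m - q)) with hd
  have hc' : c ≠ ⊤ := ENNReal.ofReal_ne_top
  have hd' : d ≠ ⊤ := ENNReal.ofReal_ne_top
  refine ⟨Ct * Cl * c * d + Ct * c * Ch, by finiteness, ?_⟩
  intro κ hκ g hgm hgi hg2
  set T := fun ρ : ℝ => ∫⁻ θ : Metric.sphere (0 : E) 1,
    (∫⁻ y in {y : ℝ | κ ≤ 2 + ρ ^ m / (1 + ρ) * |y|},
      ‖𝓕 (profile b a m k ρ θ (𝓕 g)) y‖ₑ ^ 2) ∂(volume : Measure E).toSphere with hT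
  set W := ∫⁻ x, ENNReal.ofReal ((1 + ‖x‖ ^ 2) ^ (m / 2)) * ‖g x‖ₑ ^ 2 with hW
  have hm0 : 0 < m := by linarith
  have tail : ∀ ρ : ℝ, 0 < ρ → ∀ {r : E → ℝ}, Measurable r → ∀ R, (∀ x, R ≤ ‖x‖ → κ ≤ r x) →
      T ρ ≤ Ct * (ENNReal.ofReal ((1 + ρ) ^ (m - 1)) * ∫⁻ η in shell a ρ,
        (‖𝓕 ({x | κ ≤ r x}.indicator g) η‖ₑ ^ 2 + ENNReal.ofReal ((κ ^ 2)⁻¹) *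
          energy (ρ / (1 + ρ)) ({x | r x < κ}.indicator g) η)) := by
    intro ρ hρ r hr R hR
    have := ht ρ hρ κ hκ ({x | κ ≤ r x}.indicator g) ({x | r x < κ}.indicator g)
      (hgi.indicator (measurableSet_le measurable_const hr))
      (hgi.indicator (measurableSet_lt hr measurable_const)) R (fun x hx =>
        Set.indicator_of_notMem (fun h : x ∈ {x | r x < κ} => absurd (hR x hx) (not_le.2 h)) g)
    rwa [indicator_le_add_indicator_lt] at this
  have low : ∫⁻ ρ in Set.Ioc (0 : ℝ) 1, ENNReal.ofReal ((1 + ρ) / ρ * ((1 + ρ) / ρ ^ m)) * T ρ ≤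
      Ct * Cl * c * d * (ENNReal.ofReal (κ ^ (-q)) * W) := by
    calc _ ≤ ∫⁻ ρ in Set.Ioc (0 : ℝ) 1, (Ct * Cl * c * ENNReal.ofReal (κ ^ (-q))) *
          (ENNReal.ofReal (ρ ^ (-m - 1)) *
            ∫⁻ x, ENNReal.ofReal (hardyWeight q β (ρ * ‖x‖)) * ‖g x‖ₑ ^ 2) := by
          refine setLIntegral_mono' measurableSet_Ioc fun ρ hρ => ?_
          have h1 := tail ρ hρ.1 (r := fun x => ρ * ‖x‖) (by fun_prop) (κ / ρ) fun x hx => by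
            rw [div_le_iff₀ hρ.1] at hx; linarith
          have h2 := hl ρ hρ.1 κ hκ g hgm hgi hg2
          have h3 := ENNReal.ofReal_le_ofReal (shell_prefactor_le_of_le_one hm hρ.1 hρ.2)
          have hρ0 := hρ.1
          rw [ENNReal.ofReal_mul (by positivity), ENNReal.ofReal_mul (p := 2 ^ (m + 1))
            (by positivity)] at h3
          set X := ∫⁻ x, ENNReal.ofReal (hardyWeight q β (ρ * ‖x‖)) * ‖g x‖ₑ ^ 2
          calc _ ≤ ENNReal.ofReal ((1 + ρ) / ρ * ((1 + ρ) / ρ ^ m)) *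
                (Ct * (ENNReal.ofReal ((1 + ρ) ^ (m - 1)) *
                  (Cl * (ENNReal.ofReal (κ ^ (-q)) * X)))) :=
                mul_le_mul' le_rfl (h1.trans (mul_le_mul' le_rfl (mul_le_mul' le_rfl h2)))
            _ = (ENNReal.ofReal ((1 + ρ) / ρ * ((1 + ρ) / ρ ^ m)) *
                ENNReal.ofReal ((1 + ρ) ^ (m - 1))) *
                (Ct * (Cl * (ENNReal.ofReal (κ ^ (-q)) * X))) := by ring
            _ ≤ _ := mul_le_mul' h3 le_rfl
            _ = _ := by ring
      _ ≤ ∫⁻ ρ in Set.Ioi (0 : ℝ), (Ct * Cl * c * ENNReal.ofReal (κ ^ (-q))) *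
          (ENNReal.ofReal (ρ ^ (-m - 1)) *
            ∫⁻ x, ENNReal.ofReal (hardyWeight q β (ρ * ‖x‖)) * ‖g x‖ₑ ^ 2) :=
          lintegral_mono_set fun ρ hρ => hρ.1
      _ ≤ (Ct * Cl * c * ENNReal.ofReal (κ ^ (-q))) * (d * W) := by
          rw [lintegral_const_mul' _ _ (by finiteness)]
          exact mul_le_mul' le_rfl (lintegral_lintegral_hardyWeight_le hqm hmβ hm0 hgm)
      _ = _ := by ring
  have high : ∫⁻ ρ in Set.Ioi (1 : ℝ), ENNReal.ofReal ((1 + ρ) / ρ * ((1 + ρ) / ρ ^ m)) * T ρ ≤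
      Ct * c * Ch * (ENNReal.ofReal (κ ^ (-q)) * W) := by
    calc _ ≤ ∫⁻ ρ in Set.Ioi (1 : ℝ), (Ct * c) *
          ∫⁻ η in shell a ρ, (‖𝓕 ({x | κ ≤ ‖x‖}.indicator g) η‖ₑ ^ 2 +
            ENNReal.ofReal ((κ ^ 2)⁻¹) *
              energy (ρ / (1 + ρ)) ({x | ‖x‖ < κ}.indicator g) η) := by
          refine setLIntegral_mono' measurableSet_Ioi fun ρ hρ => ?_
          have hρ1 : 1 < ρ := hρ
          have hρ0 : 0 < ρ := by linarith
          have h1 := tail ρ hρ0 (r := fun x => ‖x‖) (by fun_prop) κ fun x hx => hx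
          have h3 := ENNReal.ofReal_le_ofReal (shell_prefactor_le_of_one_le hm hρ1.le)
          rw [ENNReal.ofReal_mul (by positivity)] at h3
          set X := ∫⁻ η in shell a ρ, (‖𝓕 ({x | κ ≤ ‖x‖}.indicator g) η‖ₑ ^ 2 +
            ENNReal.ofReal ((κ ^ 2)⁻¹) *
              energy (ρ / (1 + ρ)) ({x | ‖x‖ < κ}.indicator g) η)
          calc _ ≤ ENNReal.ofReal ((1 + ρ) / ρ * ((1 + ρ) / ρ ^ m)) *
                (Ct * (ENNReal.ofReal ((1 + ρ) ^ (m - 1)) * X)) := mul_le_mul' le_rfl h1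
            _ = (ENNReal.ofReal ((1 + ρ) / ρ * ((1 + ρ) / ρ ^ m)) *
                ENNReal.ofReal ((1 + ρ) ^ (m - 1))) * (Ct * X) := by ring
            _ ≤ _ := mul_le_mul' h3 le_rfl
            _ = _ := by ring
      _ ≤ (Ct * c) * (Ch * (ENNReal.ofReal (κ ^ (-q)) * W)) := by
          rw [lintegral_const_mul' _ _ (by finiteness)]
          exact mul_le_mul' le_rfl (hh κ hκ g hgi hg2)
      _ = _ := by ring
  rw [← Set.Ioc_union_Ioi_eq_Ioi zero_le_one, add_mul]
  exact (lintegral_union_le _ _ _).trans (add_le_add low high)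

end Tail

section LayerCake

variable {E : Type*} [NormedAddCommGroup E] [InnerProductSpace ℝ E] [FiniteDimensional ℝ E]
  [MeasurableSpace E] [BorelSpace E]

theorem measurable_fourier_profile {α : Type*} [MeasurableSpace α] {b : ℝ → ℝ} (hb : Measurable b)
    {a : E → ℝ} {m k : ℝ} (ha : Measurable a) {ρ : α → ℝ} {θ : α → Metric.sphere (0 : E) 1}
    {G : α → E → ℂ} {y : α → ℝ} (hρ : Measurable ρ) (hθ : Measurable θ) (hy : Measurable y)
    (hG : Measurable (Function.uncurry G)) :
    Measurable fun z => 𝓕 (profile b a m k (ρ z) (θ z) (G z)) (y z) := by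
  have hp : Measurable fun z : α × ℝ => profile b a m k (ρ z.1) (θ z.1) (G z.1) z.2 :=
    Measurable.profile hb ha (hρ.comp measurable_fst) (hθ.comp measurable_fst) measurable_snd
      (hG.comp (measurable_fst.prodMk
        (Measurable.polarMap ha (hθ.comp measurable_fst) measurable_snd)))
  have hq : Measurable fun z : α × ℝ =>
      (𝐞 (-(z.2 * y z.1)) : ℂ) * profile b a m k (ρ z.1) (θ z.1) (G z.1) z.2 := by
    refine Measurable.mul ?_ hp
    have hc : Continuous fun t : ℝ => (𝐞 t : ℂ) := by fun_prop
    exact hc.measurable.comp (measurable_snd.mul (hy.comp measurable_fst)).neg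
  have := (hq.stronglyMeasurable.integral_prod_right' (ν := volume)).measurable
  convert this using 2 with z
  rw [Real.fourier_real_eq]
  rfl

theorem ofReal_one_add_rpow_le_lintegral {q z : ℝ} (hq : 1 ≤ q) (hz : 0 ≤ z) :
    ENNReal.ofReal ((1 + z) ^ q) ≤ ENNReal.ofReal (2 ^ q) *
      ∫⁻ κ in Set.Ioi (1 : ℝ), ENNReal.ofReal (κ ^ (q - 1)) *
        {κ : ℝ | κ ≤ 2 + z}.indicator 1 κ := by
  have hr : 0 < (2 + z) / 2 := by positivity
  have h : ∫⁻ κ in Set.Ioc ((2 + z) / 2) (2 + z), ENNReal.ofReal (((2 + z) / 2) ^ (q - 1)) ≤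
      ∫⁻ κ in Set.Ioi (1 : ℝ), ENNReal.ofReal (κ ^ (q - 1)) *
        {κ : ℝ | κ ≤ 2 + z}.indicator 1 κ := by
    calc _ ≤ ∫⁻ κ in Set.Ioc ((2 + z) / 2) (2 + z), ENNReal.ofReal (κ ^ (q - 1)) *
        {κ : ℝ | κ ≤ 2 + z}.indicator 1 κ := by
          refine setLIntegral_mono' measurableSet_Ioc fun κ hκ => ?_
          rw [Set.indicator_of_mem (show κ ∈ {κ : ℝ | κ ≤ 2 + z} from hκ.2), Pi.one_apply, mul_one]
          exact ENNReal.ofReal_le_ofReal (Real.rpow_le_rpow hr.le hκ.1.le (by linarith))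
      _ ≤ _ := lintegral_mono_set fun κ hκ => by
          have := hκ.1
          rw [Set.mem_Ioi]
          linarith
  refine le_trans ?_ (mul_le_mul' le_rfl h)
  rw [setLIntegral_const, Real.volume_Ioc, show 2 + z - (2 + z) / 2 = (2 + z) / 2 by ring,
    ← ENNReal.ofReal_mul (by positivity), ← ENNReal.ofReal_mul (by positivity)]
  refine ENNReal.ofReal_le_ofReal ?_
  rw [← Real.rpow_add_one hr.ne', sub_add_cancel, ← Real.mul_rpow (by norm_num) hr.le]
  refine Real.rpow_le_rpow (by positivity) (by linarith) (by linarith)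

theorem lintegral_mul_one_add_rpow_le {α : Type*} [MeasurableSpace α] {ν : Measure α} [SFinite ν]
    {q' q : ℝ} (hq' : 1 ≤ q') (hq : q' < q) {Φ : α → ℝ≥0∞} (hΦ : Measurable Φ) {Z : α → ℝ}
    (hZ : Measurable Z) (hZ0 : ∀ z, 0 ≤ Z z) {A : ℝ≥0∞}
    (h : ∀ κ : ℝ, 1 ≤ κ → ∫⁻ z in {z | κ ≤ 2 + Z z}, Φ z ∂ν ≤ ENNReal.ofReal (κ ^ (-q)) * A) :
    ∫⁻ z, Φ z * ENNReal.ofReal ((1 + Z z) ^ q') ∂ν ≤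
      ENNReal.ofReal (2 ^ q' / (q - q')) * A := by
  have hset : MeasurableSet {p : α × ℝ | p.2 ≤ 2 + Z p.1} :=
    measurableSet_le measurable_snd ((hZ.comp measurable_fst).const_add 2)
  have hJ : Measurable (Function.uncurry fun (z : α) (κ : ℝ) => Φ z *
      (ENNReal.ofReal (κ ^ (q' - 1)) * {κ : ℝ | κ ≤ 2 + Z z}.indicator 1 κ)) := by
    refine (hΦ.comp measurable_fst).mul (Measurable.mul (by fun_prop) ?_)
    exact (measurable_one.indicator hset : Measurable
      ({p : α × ℝ | p.2 ≤ 2 + Z p.1}.indicator (1 : α × ℝ → ℝ≥0∞)))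
  calc _ ≤ ∫⁻ z, ENNReal.ofReal (2 ^ q') * (∫⁻ κ in Set.Ioi (1 : ℝ), Φ z *
        (ENNReal.ofReal (κ ^ (q' - 1)) * {κ : ℝ | κ ≤ 2 + Z z}.indicator 1 κ)) ∂ν := by
        refine lintegral_mono fun z => ?_
        rw [lintegral_const_mul, mul_left_comm]
        · exact mul_le_mul' le_rfl (ofReal_one_add_rpow_le_lintegral hq' (hZ0 z))
        · exact Measurable.mul (by fun_prop) (measurable_one.indicator measurableSet_Iic)
    _ = ENNReal.ofReal (2 ^ q') * ∫⁻ κ in Set.Ioi (1 : ℝ), ∫⁻ z, Φ z *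
        (ENNReal.ofReal (κ ^ (q' - 1)) * {κ : ℝ | κ ≤ 2 + Z z}.indicator 1 κ) ∂ν := by
        rw [lintegral_const_mul' _ _ ENNReal.ofReal_ne_top,
          lintegral_lintegral_swap hJ.aemeasurable]
    _ ≤ ENNReal.ofReal (2 ^ q') * ∫⁻ κ in Set.Ioi (1 : ℝ), ENNReal.ofReal (κ ^ (q' - q - 1)) * A := by
        refine mul_le_mul' le_rfl (setLIntegral_mono' measurableSet_Ioi fun κ hκ => ?_)
        have hκ1 : 1 < κ := hκ
        have hκ0 : 0 < κ := by linarith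
        calc _ = ENNReal.ofReal (κ ^ (q' - 1)) * ∫⁻ z in {z | κ ≤ 2 + Z z}, Φ z ∂ν := by
              rw [← lintegral_indicator (measurableSet_le measurable_const (hZ.const_add 2)),
                ← lintegral_const_mul' _ _ ENNReal.ofReal_ne_top]
              refine lintegral_congr fun z => ?_
              by_cases hz : κ ≤ 2 + Z z <;> simp [Set.indicator, hz, mul_comm]
          _ ≤ ENNReal.ofReal (κ ^ (q' - 1)) * (ENNReal.ofReal (κ ^ (-q)) * A) :=
              mul_le_mul' le_rfl (h κ hκ1.le)
          _ = _ := by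
              rw [← mul_assoc, ← ENNReal.ofReal_mul (by positivity), ← Real.rpow_add hκ0]
              congr 3
              ring
    _ = _ := by
        rw [lintegral_mul_const _ (by fun_prop), lintegral_Ioi_rpow (by linarith) one_pos,
          ← mul_assoc, ← ENNReal.ofReal_mul (by positivity)]
        congr 2
        rw [Real.one_rpow, sub_add_cancel, neg_sub, mul_one_div]

theorem exists_lintegral_one_add_rpow_fourier_profile_le [Nontrivial E] {b : ℝ → ℝ}
    (hb : ContDiff ℝ 1 b)
    (hb1 : ∀ z, |b z| ≤ 1) (hb0 : ∀ z, 1 < |z| → b z = 0) {B : ℝ} (hB : ∀ z, |deriv b z| ≤ B)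
    {a : E → ℝ} {m k a₀ q q' : ℝ} (hm : 1 < m) (hmn : m < Module.finrank ℝ E) (hk : 0 ≤ k)
    (ha₀ : 0 < a₀) (ham : Measurable a)
    (ha_hom : ∀ t : ℝ, 0 < t → ∀ ξ, a (t • ξ) = t * a ξ)
    (ha_pos : ∀ ξ, ξ ≠ 0 → 0 < a ξ) (ha : ∀ θ : Metric.sphere (0 : E) 1, a₀ ≤ a θ)
    (hq' : 1 ≤ q') (hqq : q' < q) (hq : q ≤ 2) (hqm : q < m) :
    ∃ C : ℝ≥0∞, C ≠ ⊤ ∧ ∀ g : E → ℂ, Measurable g → Integrable g → MemLp g 2 →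
      ∫⁻ w, ENNReal.ofReal ((1 + w.1) / w.1) * (ENNReal.ofReal (w.1 ^ m / (1 + w.1))⁻¹ *
        ∫⁻ y, ENNReal.ofReal ((1 + w.1 ^ m / (1 + w.1) * |y|) ^ q') *
          ‖𝓕 (profile b a m k w.1 w.2 (𝓕 g)) y‖ₑ ^ 2)
            ∂((volume.restrict (Set.Ioi (0 : ℝ))).prod (volume : Measure E).toSphere) ≤
      C * ∫⁻ x, ENNReal.ofReal ((1 + ‖x‖ ^ 2) ^ (m / 2)) * ‖g x‖ₑ ^ 2 := by
  obtain ⟨C, hC, h⟩ :=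
    exists_lintegral_shells_tail_le hb hb1 hb0 hB hm hmn hk ha₀ ham ha_hom ha_pos ha
      (by linarith) hq hqm
  refine ⟨ENNReal.ofReal (2 ^ q' / (q - q')) * C, by finiteness, fun g hgm hgi hg2 => ?_⟩
  set lam := (volume.restrict (Set.Ioi (0 : ℝ))).prod (volume : Measure E).toSphere with hlam
  set F : (ℝ × Metric.sphere (0 : E) 1) × ℝ → ℝ≥0∞ := fun z => ‖𝓕 (profile b a m k z.1.1 z.1.2 (𝓕 g)) z.2‖ₑ ^ 2 with hF
  have hFm : Measurable F := (measurable_fourier_profile (α := (ℝ × Metric.sphere (0 : E) 1) × ℝ) (G := fun _ => 𝓕 g)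
    hb.continuous.measurable ham measurable_fst.fst measurable_fst.snd measurable_snd
    ((continuous_fourier hgi).measurable.comp measurable_snd)).enorm.pow_const 2
  set A : ℝ × Metric.sphere (0 : E) 1 → ℝ≥0∞ := fun w =>
    ENNReal.ofReal ((1 + w.1) / w.1) * ENNReal.ofReal (w.1 ^ m / (1 + w.1))⁻¹ with hA
  have hAm : Measurable A := by fun_prop
  set Z : (ℝ × Metric.sphere (0 : E) 1) × ℝ → ℝ := fun z => |z.1.1 ^ m / (1 + z.1.1)| * |z.2| with hZ
  have hZm : Measurable Z := by
    have : Measurable fun z : (ℝ × Metric.sphere (0 : E) 1) × ℝ => z.1.1 ^ m / (1 + z.1.1) := by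
      fun_prop
    exact this.norm.mul measurable_snd.norm
  have hae : ∀ᵐ w ∂lam, (0 : ℝ) < w.1 := by
    have : ∀ᵐ ρ ∂(volume.restrict (Set.Ioi (0 : ℝ))), (0 : ℝ) < ρ :=
      ae_restrict_mem measurableSet_Ioi
    exact Measure.quasiMeasurePreserving_fst.ae this
  have hΦm : Measurable fun z : (ℝ × Metric.sphere (0 : E) 1) × ℝ => A z.1 * F z := (hAm.comp measurable_fst).mul hFm
  have key := lintegral_mul_one_add_rpow_le (ν := lam.prod volume) hq' hqq hΦm hZm
    (fun z => by positivity) (A := C * ∫⁻ x, ENNReal.ofReal ((1 + ‖x‖ ^ 2) ^ (m / 2)) * ‖g x‖ₑ ^ 2)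
    (fun κ hκ => by
      have hset : MeasurableSet {z | κ ≤ 2 + Z z} :=
        measurableSet_le measurable_const (hZm.const_add 2)
      rw [mul_left_comm]
      refine le_trans (le_of_eq ?_) (h κ hκ g hgm hgi hg2)
      rw [← lintegral_indicator hset, lintegral_prod _ (hΦm.indicator hset).aemeasurable,
        hlam, lintegral_prod]
      · refine setLIntegral_congr_fun measurableSet_Ioi fun ρ hρ => ?_
        have hρ0 : 0 < ρ := hρ
        rw [← lintegral_const_mul' _ _ ENNReal.ofReal_ne_top]
        refine lintegral_congr fun θ => ?_
        have hs : MeasurableSet {y : ℝ | κ ≤ 2 + ρ ^ m / (1 + ρ) * |y|} :=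
          measurableSet_le measurable_const (by fun_prop)
        rw [← lintegral_indicator hs, ← lintegral_const_mul' _ _ ENNReal.ofReal_ne_top]
        refine lintegral_congr fun y => ?_
        have hM : 0 < ρ ^ m / (1 + ρ) := by positivity
        by_cases hy : κ ≤ 2 + ρ ^ m / (1 + ρ) * |y|
        · simp only [Set.indicator, Set.mem_ofPred_eq, hZ, abs_of_pos hM, hy, if_true, hA, hF]
          rw [ENNReal.ofReal_mul (by positivity), inv_div]
        · simp only [Set.indicator, Set.mem_ofPred_eq, hZ, abs_of_pos hM, hy, if_false, mul_zero]
      · exact (Measurable.lintegral_prod_right' (hΦm.indicator hset)).aemeasurable)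
  rw [mul_assoc]
  refine le_trans (le_of_eq ?_) key
  have hΨm : Measurable fun z => A z.1 * F z * ENNReal.ofReal ((1 + Z z) ^ q') :=
    hΦm.mul (by fun_prop)
  rw [lintegral_prod _ hΨm.aemeasurable]
  refine lintegral_congr_ae ?_
  filter_upwards [hae] with w hw
  have hM : 0 < w.1 ^ m / (1 + w.1) := by positivity
  simp only [hZ, abs_of_pos hM, hA, hF]
  rw [← mul_assoc, ← lintegral_const_mul' _ _ (by finiteness)]
  refine lintegral_congr fun y => ?_
  ring

end LayerCake

section Bilinear

variable {E : Type*} [NormedAddCommGroup E] [InnerProductSpace ℝ E] [FiniteDimensional ℝ E]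
  [MeasurableSpace E] [BorelSpace E]

theorem measurable_uncurry_fourier {α : Type*} [MeasurableSpace α] {f : α → E → ℂ}
    (hf : Measurable (Function.uncurry f)) :
    Measurable (Function.uncurry fun s ξ => 𝓕 (f s) ξ) := by
  have hq : Measurable fun z : (α × E) × E => (𝐞 (-⟪z.2, z.1.2⟫) : ℂ) * f z.1.1 z.2 := by
    refine Measurable.mul ?_ (hf.comp (measurable_fst.fst.prodMk measurable_snd))
    have hc : Continuous fun z : E × E => (𝐞 (-⟪z.1, z.2⟫) : ℂ) := by fun_prop
    exact hc.measurable.comp (measurable_snd.prodMk measurable_fst.snd)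
  have := (hq.stronglyMeasurable.integral_prod_right' (ν := volume)).measurable
  convert this using 2 with z
  rw [Function.uncurry, Real.fourier_eq]
  rfl

/-- The size of the Fourier transform of the profile of `𝓕 (f s)`. -/
def profileNorm (b : ℝ → ℝ) (a : E → ℝ) (m k : ℝ) (f : ℝ → E → ℂ)
    (w : ℝ × Metric.sphere (0 : E) 1) (s y : ℝ) : ℝ≥0∞ :=
  ‖𝓕 (profile b a m k w.1 w.2 (𝓕 (f s))) y‖ₑ

theorem measurable_profileNorm {α : Type*} [MeasurableSpace α] {b : ℝ → ℝ}
    (hb : Measurable b) {a : E → ℝ} {m k : ℝ} (ha : Measurable a) {f : ℝ → E → ℂ}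
    (hf : Measurable (Function.uncurry f)) {w : α → ℝ × Metric.sphere (0 : E) 1} {s y : α → ℝ}
    (hw : Measurable w) (hs : Measurable s) (hy : Measurable y) :
    Measurable fun z => profileNorm b a m k f (w z) (s z) (y z) := by
  have hG : Measurable (Function.uncurry fun z => 𝓕 (f (s z))) := by
    have h : ((Function.uncurry fun s ξ => 𝓕 (f s) ξ) ∘ fun p : α × E => (s p.1, p.2)) =
        Function.uncurry fun z => 𝓕 (f (s z)) := by
      funext p
      simp only [Function.uncurry, Function.comp]
    rw [← h]
    exact (measurable_uncurry_fourier hf).comp (by fun_prop)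
  exact (measurable_fourier_profile hb ha hw.fst hw.snd hy hG).enorm

theorem measurable_profileNorm_prod {b : ℝ → ℝ} (hb : Measurable b) {a : E → ℝ} {m k : ℝ}
    (ha : Measurable a) {f : ℝ → E → ℂ} (hf : Measurable (Function.uncurry f)) :
    Measurable fun z : ((ℝ × Metric.sphere (0 : E) 1) × ℝ) × ℝ =>
      profileNorm b a m k f z.1.1 z.1.2 z.2 := by
  have h1 : Measurable fun z : ((ℝ × Metric.sphere (0 : E) 1) × ℝ) × ℝ => z.1.1 := by fun_prop
  have h2 : Measurable fun z : ((ℝ × Metric.sphere (0 : E) 1) × ℝ) × ℝ => z.1.2 := by fun_prop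
  have h3 : Measurable fun z : ((ℝ × Metric.sphere (0 : E) 1) × ℝ) × ℝ => z.2 := by fun_prop
  exact measurable_profileNorm hb ha hf h1 h2 h3

/-- The weighted squared norm `∫∫ ⟨x⟩ ^ m |f|²`. -/
def weightedSq (m : ℝ) (f : ℝ → E → ℂ) : ℝ≥0∞ :=
  ∫⁻ s, ∫⁻ x, ENNReal.ofReal ((1 + ‖x‖ ^ 2) ^ (m / 2)) * ‖f s x‖ₑ ^ 2

theorem amplitude_sq_mul_eq {a : E → ℝ} {m k : ℝ} (hm : 0 < m) (hk : 0 ≤ k)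
    (ha_hom : ∀ t : ℝ, 0 < t → ∀ ξ, a (t • ξ) = t * a ξ)
    (ha_pos : ∀ ξ, ξ ≠ 0 → 0 < a ξ) (b : ℝ → ℝ) (ρ : ℝ) (θ : Metric.sphere (0 : E) 1)
    (G H : E → ℂ) (τ : ℝ) {μ : ℝ} (hμ : 0 < μ) :
    (polarJac a m θ μ * b (logAdd (μ ^ (1 / m)) - logAdd ρ) ^ 2) •
      ((𝐞 (τ * a (polarMap a m θ μ) ^ m) : ℂ) *
        ((((1 + k * ‖polarMap a m θ μ‖ ^ 2) ^ ((m - 1) / 2) : ℝ) : ℂ) *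
          (G (polarMap a m θ μ) * conj (H (polarMap a m θ μ))))) =
      (𝐞 (τ * μ) : ℂ) * (profile b a m k ρ θ G μ * conj (profile b a m k ρ θ H μ)) := by
  have hθ : (θ : E) ≠ 0 := ne_zero_of_mem_unit_sphere θ
  have hJ := polarJac_nonneg hm (ha_pos θ hθ) hμ
  have hsq : amplitude a m k θ μ ^ 2 =
      polarJac a m θ μ * (1 + k * ‖polarMap a m θ μ‖ ^ 2) ^ ((m - 1) / 2) :=
    Real.sq_sqrt (by positivity)
  rw [apply_polarMap ha_hom ha_pos θ hμ, rpow_one_div_rpow hm hμ, profile, profile,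
    Set.indicator_of_mem (Set.mem_Ioi.2 hμ), Set.indicator_of_mem (Set.mem_Ioi.2 hμ)]
  set A := amplitude a m k θ μ
  set β := b (logAdd (μ ^ (1 / m)) - logAdd ρ)
  set W := (1 + k * ‖polarMap a m θ μ‖ ^ 2) ^ ((m - 1) / 2)
  rw [map_mul (starRingEnd ℂ), Complex.conj_ofReal, Complex.real_smul]
  have hc : ((A : ℝ) : ℂ) ^ 2 = (polarJac a m θ μ : ℂ) * (W : ℂ) := by exact_mod_cast hsq
  push_cast
  linear_combination (-(β : ℂ) ^ 2 * (𝐞 (τ * μ) : ℂ) * G (polarMap a m θ μ) *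
    conj (H (polarMap a m θ μ))) * hc

theorem enorm_setIntegral_shell_le {a : E → ℝ} {m k : ℝ} (hm : 1 < m) (hk : 0 ≤ k)
    (ham : Measurable a) (ha_hom : ∀ t : ℝ, 0 < t → ∀ ξ, a (t • ξ) = t * a ξ)
    (ha_pos : ∀ ξ, ξ ≠ 0 → 0 < a ξ) {b : ℝ → ℝ} (hb : Measurable b) (hb1 : ∀ z, |b z| ≤ 1)
    (hb0 : ∀ z, 1 < |z| → b z = 0) {ρ : ℝ} (hρ : 0 < ρ) (θ : Metric.sphere (0 : E) 1)
    {f h : E → ℂ} (hf : Integrable f) (hh : Integrable h) (τ : ℝ) :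
    ‖∫ μ in Set.Ioi (0 : ℝ), (polarJac a m θ μ * b (logAdd (μ ^ (1 / m)) - logAdd ρ) ^ 2) •
      ((𝐞 (τ * a (polarMap a m θ μ) ^ m) : ℂ) *
        ((((1 + k * ‖polarMap a m θ μ‖ ^ 2) ^ ((m - 1) / 2) : ℝ) : ℂ) *
          (𝓕 f (polarMap a m θ μ) * conj (𝓕 h (polarMap a m θ μ)))))‖ₑ ≤
      ∫⁻ y, ‖𝓕 (profile b a m k ρ θ (𝓕 f)) (y - τ)‖ₑ * ‖𝓕 (profile b a m k ρ θ (𝓕 h)) y‖ₑ := by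
  have hθ : 0 < a θ := ha_pos θ (ne_zero_of_mem_unit_sphere θ)
  obtain ⟨hv, hv2⟩ := integrable_and_memLp_profile hb hb1 hb0 hm hk hρ ham hθ
    (continuous_fourier hf).measurable (norm_fourier_le f)
  obtain ⟨hu, hu2⟩ := integrable_and_memLp_profile hb hb1 hb0 hm hk hρ ham hθ
    (continuous_fourier hh).measurable (norm_fourier_le h)
  rw [setIntegral_congr_fun measurableSet_Ioi fun μ hμ => amplitude_sq_mul_eq (by linarith) hk
      ha_hom ha_pos b ρ θ (𝓕 f) (𝓕 h) τ hμ, setIntegral_eq_integral_of_forall_compl_eq_zero]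
  · exact enorm_integral_fourierChar_mul_conj_le hv hv2 hu hu2 τ
  · intro μ hμ
    rw [profile, Set.indicator_of_notMem hμ]
    simp

theorem lintegral_mul_sq_lintegral_sqrt_le {β : Type*} [MeasurableSpace β] {lam : Measure (ℝ × β)}
    [SFinite lam] (hae : ∀ᵐ w ∂lam, (0 : ℝ) < w.1) {m q : ℝ} {C₁ C₂ : ℝ≥0∞} (hC₁ : C₁ ≠ ⊤)
    (hC₂ : C₂ ≠ ⊤)
    (h₁ : ∀ {M : ℝ}, 0 < M → ∀ {P : ℝ → ℝ≥0∞}, Measurable P →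
      (∫⁻ y, P y ^ (1 / 2 : ℝ)) ^ 2 ≤
        C₁ * (ENNReal.ofReal M⁻¹ * ∫⁻ y, ENNReal.ofReal ((1 + M * |y|) ^ q) * P y))
    {V : ℝ × β → ℝ → ℝ → ℝ≥0∞}
    (hVm : Measurable fun z : ((ℝ × β) × ℝ) × ℝ => V z.1.1 z.1.2 z.2) {N : ℝ → ℝ≥0∞}
    (h₂ : ∀ s, ∫⁻ w, ENNReal.ofReal ((1 + w.1) / w.1) *
      (ENNReal.ofReal (w.1 ^ m / (1 + w.1))⁻¹ *
        ∫⁻ y, ENNReal.ofReal ((1 + w.1 ^ m / (1 + w.1) * |y|) ^ q) * V w s y) ∂lam ≤ C₂ * N s) :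
    ∫⁻ w, ENNReal.ofReal ((1 + w.1) / w.1) * (∫⁻ y, (∫⁻ s, V w s y) ^ (1 / 2 : ℝ)) ^ 2 ∂lam ≤
      C₁ * C₂ * ∫⁻ s, N s := by
  have hJ : Measurable (Function.uncurry fun (w : ℝ × β) (s : ℝ) =>
      ENNReal.ofReal ((1 + w.1) / w.1) * (ENNReal.ofReal (w.1 ^ m / (1 + w.1))⁻¹ *
        ∫⁻ y, ENNReal.ofReal ((1 + w.1 ^ m / (1 + w.1) * |y|) ^ q) * V w s y)) := by
    refine Measurable.mul (by fun_prop) (Measurable.mul (by fun_prop) ?_)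
    refine Measurable.lintegral_prod_right' (f := fun z : ((ℝ × β) × ℝ) × ℝ =>
      ENNReal.ofReal ((1 + z.1.1.1 ^ m / (1 + z.1.1.1) * |z.2|) ^ q) * V z.1.1 z.1.2 z.2) ?_
    exact Measurable.mul (by fun_prop) hVm
  calc _ ≤ ∫⁻ w, C₁ * ∫⁻ s, ENNReal.ofReal ((1 + w.1) / w.1) *
        (ENNReal.ofReal (w.1 ^ m / (1 + w.1))⁻¹ *
          (∫⁻ y, ENNReal.ofReal ((1 + w.1 ^ m / (1 + w.1) * |y|) ^ q) * V w s y)) ∂volume ∂lam := by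
        refine lintegral_mono_ae ?_
        filter_upwards [hae] with w hw
        have hM : 0 < w.1 ^ m / (1 + w.1) := by positivity
        have hVw : Measurable fun z : ℝ × ℝ => V w z.1 z.2 := by
          have hc : Measurable fun z : ℝ × ℝ => ((w, z.1), z.2) := by fun_prop
          exact hVm.comp hc
        have hP : Measurable fun y => ∫⁻ s, V w s y := hVw.lintegral_prod_left'
        have hy : Measurable (Function.uncurry fun (s y : ℝ) =>
            ENNReal.ofReal ((1 + w.1 ^ m / (1 + w.1) * |y|) ^ q) * V w s y) :=
          Measurable.mul (by fun_prop) hVw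
        rw [lintegral_const_mul' _ _ ENNReal.ofReal_ne_top,
          lintegral_const_mul' _ _ ENNReal.ofReal_ne_top,
          lintegral_lintegral_swap hy.aemeasurable]
        refine (mul_le_mul' le_rfl (h₁ hM hP)).trans (le_of_eq ?_)
        rw [mul_left_comm]
        have : ∀ y, ∫⁻ s, ENNReal.ofReal ((1 + w.1 ^ m / (1 + w.1) * |y|) ^ q) * V w s y =
            ENNReal.ofReal ((1 + w.1 ^ m / (1 + w.1) * |y|) ^ q) * ∫⁻ s, V w s y := fun y =>
          lintegral_const_mul' _ _ ENNReal.ofReal_ne_top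
        simp only [this]
    _ = C₁ * ∫⁻ s, (∫⁻ w, ENNReal.ofReal ((1 + w.1) / w.1) *
        (ENNReal.ofReal (w.1 ^ m / (1 + w.1))⁻¹ *
          ∫⁻ y, ENNReal.ofReal ((1 + w.1 ^ m / (1 + w.1) * |y|) ^ q) * V w s y) ∂lam) := by
        rw [lintegral_const_mul' _ _ hC₁, lintegral_lintegral_swap hJ.aemeasurable]
    _ ≤ C₁ * ∫⁻ s, C₂ * N s := mul_le_mul' le_rfl (lintegral_mono h₂)
    _ = _ := by rw [lintegral_const_mul' _ _ hC₂, mul_assoc]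

theorem exists_lintegral_sq_lintegral_fourier_profile_le [Nontrivial E] {b : ℝ → ℝ}
    (hb : ContDiff ℝ 1 b)
    (hb1 : ∀ z, |b z| ≤ 1) (hb0 : ∀ z, 1 < |z| → b z = 0) {B : ℝ} (hB : ∀ z, |deriv b z| ≤ B)
    {a : E → ℝ} {m k a₀ : ℝ} (hm : 1 < m) (hmn : m < Module.finrank ℝ E) (hk : 0 ≤ k)
    (ha₀ : 0 < a₀) (ham : Measurable a)
    (ha_hom : ∀ t : ℝ, 0 < t → ∀ ξ, a (t • ξ) = t * a ξ)
    (ha_pos : ∀ ξ, ξ ≠ 0 → 0 < a ξ) (ha : ∀ θ : Metric.sphere (0 : E) 1, a₀ ≤ a θ) :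
    ∃ C : ℝ≥0∞, C ≠ ⊤ ∧ ∀ f : ℝ → E → ℂ, Measurable (Function.uncurry f) →
      (∀ s, Integrable (f s)) → (∀ s, MemLp (f s) 2) →
      ∫⁻ w, ENNReal.ofReal ((1 + w.1) / w.1) * (∫⁻ y,
        (∫⁻ s, profileNorm b a m k f w s y ^ 2) ^ (1 / 2 : ℝ)) ^ 2
          ∂((volume.restrict (Set.Ioi (0 : ℝ))).prod (volume : Measure E).toSphere) ≤
      C * weightedSq m f := by
  obtain ⟨q, hq1, hqm2⟩ := exists_between (lt_min hm one_lt_two)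
  obtain ⟨hqm, hq2⟩ := lt_min_iff.1 hqm2
  obtain ⟨q', hq', hqq⟩ := exists_between hq1
  obtain ⟨C₁, hC₁, h₁⟩ := exists_sq_lintegral_sqrt_le hq'
  obtain ⟨C₂, hC₂, h₂⟩ := exists_lintegral_one_add_rpow_fourier_profile_le hb hb1 hb0 hB hm hmn hk
    ha₀ ham ha_hom ha_pos ha hq'.le hqq hq2.le hqm
  refine ⟨C₁ * C₂, by finiteness, fun f hf hfi hf2 => ?_⟩
  have hae : ∀ᵐ w ∂((volume.restrict (Set.Ioi (0 : ℝ))).prod (volume : Measure E).toSphere),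
      (0 : ℝ) < w.1 := by
    have : ∀ᵐ ρ ∂(volume.restrict (Set.Ioi (0 : ℝ))), (0 : ℝ) < ρ :=
      ae_restrict_mem measurableSet_Ioi
    exact Measure.quasiMeasurePreserving_fst.ae this
  have hVm := (measurable_profileNorm_prod (m := m) (k := k) hb.continuous.measurable ham
    hf).pow_const 2
  have h₃ : ∀ s, ∫⁻ w, ENNReal.ofReal ((1 + w.1) / w.1) *
      (ENNReal.ofReal (w.1 ^ m / (1 + w.1))⁻¹ *
        ∫⁻ y, ENNReal.ofReal ((1 + w.1 ^ m / (1 + w.1) * |y|) ^ q') *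
          profileNorm b a m k f w s y ^ 2)
          ∂((volume.restrict (Set.Ioi (0 : ℝ))).prod (volume : Measure E).toSphere) ≤
      C₂ * ∫⁻ x, ENNReal.ofReal ((1 + ‖x‖ ^ 2) ^ (m / 2)) * ‖f s x‖ₑ ^ 2 := by
    intro s
    have hfm : Measurable (f s) := by
      have hc : Measurable fun x : E => (s, x) := by fun_prop
      exact hf.comp hc
    simp only [profileNorm]
    exact h₂ (f s) hfm (hfi s) (hf2 s)
  exact lintegral_mul_sq_lintegral_sqrt_le (V := fun w s y => profileNorm b a m k f w s y ^ 2)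
    hae hC₁ hC₂ h₁ hVm h₃

end Bilinear

theorem sq_lintegral_shear_le {β : Type*} [MeasurableSpace β] {lam : Measure β} [SFinite lam]
    {c : β → ℝ≥0∞} (hc : Measurable c) {V U : β → ℝ → ℝ → ℝ≥0∞}
    (hV : Measurable fun z : (β × ℝ) × ℝ => V z.1.1 z.1.2 z.2)
    (hU : Measurable fun z : (β × ℝ) × ℝ => U z.1.1 z.1.2 z.2) :
    (∫⁻ t : ℝ, ∫⁻ s : ℝ, ∫⁻ w, c w * (∫⁻ y, V w s (y - (t - s)) * U w t y) ∂lam) ^ 2 ≤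
      (∫⁻ w, c w * (∫⁻ y, (∫⁻ s, V w s y ^ 2) ^ (1 / 2 : ℝ)) ^ 2 ∂lam) *
        ∫⁻ w, c w * (∫⁻ y, (∫⁻ s, U w s y ^ 2) ^ (1 / 2 : ℝ)) ^ 2 ∂lam := by
  have hK : Measurable fun z : (β × ℝ) × ℝ =>
      ∫⁻ y, V z.1.1 z.2 (y - (z.1.2 - z.2)) * U z.1.1 z.1.2 y := by
    refine Measurable.lintegral_prod_right' (f := fun x : ((β × ℝ) × ℝ) × ℝ =>
      V x.1.1.1 x.1.2 (x.2 - (x.1.1.2 - x.1.2)) * U x.1.1.1 x.1.1.2 x.2) ?_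
    have h1 : Measurable fun x : ((β × ℝ) × ℝ) × ℝ =>
      ((x.1.1.1, x.1.2), x.2 - (x.1.1.2 - x.1.2)) := by fun_prop
    have h2 : Measurable fun x : ((β × ℝ) × ℝ) × ℝ => ((x.1.1.1, x.1.1.2), x.2) := by fun_prop
    exact (hV.comp h1).mul (hU.comp h2)
  have hcK : Measurable fun z : (β × ℝ) × ℝ =>
      c z.1.1 * ∫⁻ y, V z.1.1 z.2 (y - (z.1.2 - z.2)) * U z.1.1 z.1.2 y :=
    (hc.comp measurable_fst.fst).mul hK
  have hroot : ∀ {W : β → ℝ → ℝ → ℝ≥0∞},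
      (Measurable fun z : (β × ℝ) × ℝ => W z.1.1 z.1.2 z.2) →
      Measurable fun w => ∫⁻ y, (∫⁻ s, W w s y ^ 2) ^ (1 / 2 : ℝ) := by
    intro W hW
    refine Measurable.lintegral_prod_right' (f := fun x : β × ℝ =>
      (∫⁻ s, W x.1 s x.2 ^ 2) ^ (1 / 2 : ℝ)) ?_
    refine Measurable.pow_const (Measurable.lintegral_prod_right' (f := fun x : (β × ℝ) × ℝ =>
      W x.1.1 x.2 x.1.2 ^ 2) ?_) _
    have h1 : Measurable fun x : (β × ℝ) × ℝ => ((x.1.1, x.2), x.1.2) := by fun_prop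
    exact (hW.comp h1).pow_const 2
  have hst : ∀ t, ∫⁻ s : ℝ, ∫⁻ w, c w * (∫⁻ y, V w s (y - (t - s)) * U w t y) ∂lam =
      ∫⁻ w, ∫⁻ s : ℝ, c w * (∫⁻ y, V w s (y - (t - s)) * U w t y) ∂volume ∂lam := by
    intro t
    have : Measurable (Function.uncurry fun (s : ℝ) (w : β) =>
        c w * (∫⁻ y, V w s (y - (t - s)) * U w t y)) := by
      have h1 : Measurable fun x : ℝ × β => ((x.2, t), x.1) := by fun_prop
      exact hcK.comp h1
    exact lintegral_lintegral_swap this.aemeasurable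
  have htw : ∫⁻ t : ℝ, (∫⁻ w, ∫⁻ s : ℝ, c w * (∫⁻ y, V w s (y - (t - s)) * U w t y) ∂volume ∂lam) =
      ∫⁻ w, ∫⁻ t : ℝ, ∫⁻ s : ℝ, c w * (∫⁻ y, V w s (y - (t - s)) * U w t y) ∂volume ∂volume ∂lam := by
    have : Measurable (Function.uncurry fun (t : ℝ) (w : β) =>
        ∫⁻ s : ℝ, c w * (∫⁻ y, V w s (y - (t - s)) * U w t y)) := by
      have h1 : Measurable fun x : ℝ × β => (x.2, x.1) := by fun_prop
      exact (hcK.lintegral_prod_right').comp h1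
    exact lintegral_lintegral_swap this.aemeasurable
  simp only [hst]
  rw [htw]
  have hw : ∀ w, ∫⁻ t : ℝ, ∫⁻ s : ℝ, c w * (∫⁻ y, V w s (y - (t - s)) * U w t y) ≤
      (c w ^ (1 / 2 : ℝ) * ∫⁻ y, (∫⁻ s, V w s y ^ 2) ^ (1 / 2 : ℝ)) *
        (c w ^ (1 / 2 : ℝ) * ∫⁻ y, (∫⁻ s, U w s y ^ 2) ^ (1 / 2 : ℝ)) := by
    intro w
    have hVw : Measurable (Function.uncurry (V w)) := by
      have h1 : Measurable fun x : ℝ × ℝ => ((w, x.1), x.2) := by fun_prop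
      exact hV.comp h1
    have hUw : Measurable (Function.uncurry (U w)) := by
      have h1 : Measurable fun x : ℝ × ℝ => ((w, x.1), x.2) := by fun_prop
      exact hU.comp h1
    have hKw : Measurable fun x : ℝ × ℝ => ∫⁻ y, V w x.2 (y - (x.1 - x.2)) * U w x.1 y := by
      have h1 : Measurable fun x : ℝ × ℝ => ((w, x.1), x.2) := by fun_prop
      exact hK.comp h1
    have h1 : ∀ t, ∫⁻ s : ℝ, c w * (∫⁻ y, V w s (y - (t - s)) * U w t y) =
        c w * ∫⁻ s : ℝ, (∫⁻ y, V w s (y - (t - s)) * U w t y) := fun t => by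
      have h2 : Measurable fun s : ℝ => ∫⁻ y, V w s (y - (t - s)) * U w t y := by
        have h1 : Measurable fun s : ℝ => (t, s) := by fun_prop
        exact hKw.comp h1
      exact lintegral_const_mul _ h2
    simp only [h1]
    rw [lintegral_const_mul _ hKw.lintegral_prod_right', mul_mul_mul_comm]
    refine mul_le_mul' (le_of_eq ?_) (lintegral_shear_le hVw hUw)
    rw [← ENNReal.rpow_add_of_nonneg _ _ (by norm_num) (by norm_num)]
    norm_num
  refine (pow_le_pow_left' (lintegral_mono hw) 2).trans ?_
  refine (sq_lintegral_mul_le ((hc.pow_const _).mul (hroot hV)).aemeasurable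
    ((hc.pow_const _).mul (hroot hU)).aemeasurable).trans (le_of_eq ?_)
  have h3 : ∀ w, (c w ^ (1 / 2 : ℝ)) ^ 2 = c w := fun w => by
    rw [← ENNReal.rpow_natCast, ← ENNReal.rpow_mul]
    norm_num
  simp only [Pi.mul_apply, mul_pow, h3]

section Bilinear

variable {E : Type*} [NormedAddCommGroup E] [InnerProductSpace ℝ E] [FiniteDimensional ℝ E]
  [MeasurableSpace E] [BorelSpace E]

/-- The pairing `⟨e^{iτ a(D)^m} w(D) f, h⟩` on the Fourier side, where
`w ξ = (1 + k ‖ξ‖²) ^ ((m - 1) / 2)`. -/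
def phasePairing (a : E → ℝ) (m k τ : ℝ) (f h : E → ℂ) : ℂ :=
  ∫ ξ, (𝐞 (τ * a ξ ^ m) : ℂ) *
    ((((1 + k * ‖ξ‖ ^ 2) ^ ((m - 1) / 2) : ℝ) : ℂ) * (𝓕 f ξ * conj (𝓕 h ξ)))

theorem mul_enorm_phasePairing_le [Nontrivial E] {a : E → ℝ} {m k : ℝ} (hm : 1 < m) (hk : 0 ≤ k)
    (ha_cont : Continuous a) (ha_hom : ∀ t : ℝ, 0 < t → ∀ ξ, a (t • ξ) = t * a ξ)
    (ha_pos : ∀ ξ, ξ ≠ 0 → 0 < a ξ) {b : ℝ → ℝ} (hb : Continuous b) (hbc : HasCompactSupport b)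
    (hb1 : ∀ z, |b z| ≤ 1) (hb0 : ∀ z, 1 < |z| → b z = 0) {f h : ℝ → E → ℂ}
    (hfm : Measurable (Function.uncurry f)) (hhm : Measurable (Function.uncurry h)) {s t : ℝ}
    (hf : Integrable (f s)) (hh : Integrable (h t))
    (hfh : Integrable fun ξ => (((1 + k * ‖ξ‖ ^ 2) ^ ((m - 1) / 2) : ℝ) : ℂ) *
      (𝓕 (f s) ξ * conj (𝓕 (h t) ξ))) :
    (∫⁻ z, ENNReal.ofReal (b z ^ 2)) * ‖phasePairing a m k (t - s) (f s) (h t)‖ₑ ≤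
      ∫⁻ w, ENNReal.ofReal ((1 + w.1) / w.1) *
        (∫⁻ y, profileNorm b a m k f w s (y - (t - s)) * profileNorm b a m k h w t y)
        ∂((volume.restrict (Set.Ioi (0 : ℝ))).prod (volume : Measure E).toSphere) := by
  have hQ : Integrable fun ξ => (𝐞 ((t - s) * a ξ ^ m) : ℂ) *
      ((((1 + k * ‖ξ‖ ^ 2) ^ ((m - 1) / 2) : ℝ) : ℂ) * (𝓕 (f s) ξ * conj (𝓕 (h t) ξ))) := by
    have hc : Continuous fun ξ => (𝐞 ((t - s) * a ξ ^ m) : ℂ) := by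
      have : Continuous fun ξ => a ξ ^ m := ha_cont.rpow_const fun ξ => Or.inr (by linarith)
      fun_prop
    exact hfh.bdd_mul (c := 1) hc.aestronglyMeasurable (.of_forall fun ξ => (Circle.norm_coe _).le)
  have hfst : Measurable fun z : (ℝ × Metric.sphere (0 : E) 1) × ℝ => z.1 := by fun_prop
  have hy : Measurable fun z : (ℝ × Metric.sphere (0 : E) 1) × ℝ => z.2 := by fun_prop
  have hyt : Measurable fun z : (ℝ × Metric.sphere (0 : E) 1) × ℝ => z.2 - (t - s) := by fun_prop
  have hK : Measurable fun w =>
      ∫⁻ y, profileNorm b a m k f w s (y - (t - s)) * profileNorm b a m k h w t y :=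
    Measurable.lintegral_prod_right' (f := fun z : (ℝ × Metric.sphere (0 : E) 1) × ℝ =>
      profileNorm b a m k f z.1 s (z.2 - (t - s)) * profileNorm b a m k h z.1 t z.2)
      ((measurable_profileNorm hb.measurable ha_cont.measurable hfm hfst measurable_const hyt).mul
        (measurable_profileNorm hb.measurable ha_cont.measurable hhm hfst measurable_const hy))
  have hcK : Measurable fun w : ℝ × Metric.sphere (0 : E) 1 => ENNReal.ofReal ((1 + w.1) / w.1) *
      ∫⁻ y, profileNorm b a m k f w s (y - (t - s)) * profileNorm b a m k h w t y :=
    Measurable.mul (by fun_prop) hK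
  rw [lintegral_prod _ hcK.aemeasurable]
  refine (mul_enorm_integral_le_lintegral_shell (by linarith : 0 < m) ha_cont.measurable ha_hom
    ha_pos hb hbc hb1 hQ).trans ?_
  refine setLIntegral_mono' measurableSet_Ioi fun ρ hρ => ?_
  refine le_trans (mul_le_mul' le_rfl (lintegral_mono fun θ => ?_))
    (lintegral_const_mul' _ _ ENNReal.ofReal_ne_top).ge
  exact enorm_setIntegral_shell_le hm hk ha_cont.measurable ha_hom ha_pos hb.measurable hb1 hb0 hρ θ
    hf hh (t - s)

theorem exists_sq_lintegral_phasePairing_le [Nontrivial E] {a : E → ℝ} {m k : ℝ} (hm : 1 < m)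
    (hmn : m < Module.finrank ℝ E) (hk : 0 ≤ k)
    (ha_cont : Continuous a) (ha_hom : ∀ t : ℝ, 0 < t → ∀ ξ, a (t • ξ) = t * a ξ)
    (ha_pos : ∀ ξ, ξ ≠ 0 → 0 < a ξ) :
    ∃ C : ℝ≥0∞, C ≠ ⊤ ∧ ∀ f h : ℝ → E → ℂ, Measurable (Function.uncurry f) →
      Measurable (Function.uncurry h) → (∀ s, Integrable (f s)) → (∀ s, MemLp (f s) 2) →
      (∀ t, Integrable (h t)) → (∀ t, MemLp (h t) 2) →
      (∀ s t, Integrable fun ξ => (((1 + k * ‖ξ‖ ^ 2) ^ ((m - 1) / 2) : ℝ) : ℂ) *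
        (𝓕 (f s) ξ * conj (𝓕 (h t) ξ))) →
      (∫⁻ t, ∫⁻ s, ‖phasePairing a m k (t - s) (f s) (h t)‖ₑ) ^ 2 ≤
        C * (weightedSq m f * weightedSq m h) := by
  let b : ContDiffBump (0 : ℝ) := ⟨1 / 2, 1, by norm_num, by norm_num⟩
  have hb : ContDiff ℝ 1 b := b.contDiff
  have hb1 : ∀ z, |b z| ≤ 1 := fun z => by
    rw [abs_of_nonneg b.nonneg]
    exact b.le_one
  have hb0 : ∀ z, 1 < |z| → b z = 0 := fun z hz =>
    b.zero_of_le_dist (by simpa [b] using hz.le)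
  have hbc : HasCompactSupport b := b.hasCompactSupport
  obtain ⟨B, hB⟩ := (hbc.deriv).exists_bound_of_continuous (hb.continuous_deriv le_rfl)
  obtain ⟨θ₀, hθ₀, hmin⟩ := (isCompact_sphere (0 : E) 1).exists_isMinOn
    (NormedSpace.sphere_nonempty.2 zero_le_one) ha_cont.continuousOn
  have hθ₀' : θ₀ ≠ 0 := ne_zero_of_mem_unit_sphere ⟨θ₀, hθ₀⟩
  obtain ⟨C, hC, h₁⟩ := exists_lintegral_sq_lintegral_fourier_profile_le hb hb1 hb0 hB hm hmn hk
    (ha_pos θ₀ hθ₀') ha_cont.measurable ha_hom ha_pos fun θ => hmin θ.2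
  set D := ∫⁻ z, ENNReal.ofReal (b z ^ 2) with hD
  have hD0 : D ≠ 0 := by
    rw [hD]
    have hbm : Measurable b := hb.continuous.measurable
    refine ((lintegral_pos_iff_support (by fun_prop)).2 ?_).ne'
    refine (Metric.measure_ball_pos volume (0 : ℝ) one_half_pos).trans_le (measure_mono fun z hz => ?_)
    have : b z = 1 := b.one_of_mem_closedBall (Metric.ball_subset_closedBall hz)
    simp [this]
  have hDtop : D ≠ ⊤ := by
    have hb2 : Integrable (fun z => b z ^ 2) :=
      (hb.continuous.pow 2).integrable_of_hasCompactSupport (by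
        simpa [pow_two] using hbc.mul_left (f := b))
    rw [hD, ← ofReal_integral_eq_lintegral_ofReal hb2 (.of_forall fun z => by positivity)]
    exact ENNReal.ofReal_ne_top
  refine ⟨D⁻¹ ^ 2 * C ^ 2, by finiteness, fun f h hfm hhm hfi hf2 hhi hh2 hfh => ?_⟩
  have hI : ∀ s t, ‖phasePairing a m k (t - s) (f s) (h t)‖ₑ ≤ D⁻¹ *
      ∫⁻ w, ENNReal.ofReal ((1 + w.1) / w.1) *
        (∫⁻ y, profileNorm b a m k f w s (y - (t - s)) * profileNorm b a m k h w t y)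
        ∂((volume.restrict (Set.Ioi (0 : ℝ))).prod (volume : Measure E).toSphere) := fun s t => by
    rw [← ENNReal.div_eq_inv_mul, ENNReal.le_div_iff_mul_le (Or.inl hD0) (Or.inl hDtop), mul_comm]
    exact mul_enorm_phasePairing_le hm hk ha_cont ha_hom ha_pos hb.continuous hbc hb1 hb0 hfm hhm
      (hfi s) (hhi t) (hfh s t)
  have hDinv : D⁻¹ ≠ ⊤ := ENNReal.inv_ne_top.2 hD0
  refine (pow_le_pow_left' (lintegral_mono fun t => lintegral_mono fun s => hI s t) 2).trans ?_
  simp only [lintegral_const_mul' _ _ hDinv]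
  rw [mul_pow, mul_assoc]
  refine mul_le_mul' le_rfl ?_
  have hc : Measurable fun w : ℝ × Metric.sphere (0 : E) 1 => ENNReal.ofReal ((1 + w.1) / w.1) := by
    fun_prop
  refine (sq_lintegral_shear_le hc
    (measurable_profileNorm_prod hb.continuous.measurable ha_cont.measurable hfm)
    (measurable_profileNorm_prod hb.continuous.measurable ha_cont.measurable hhm)).trans ?_
  refine (mul_le_mul' (h₁ f hfm hfi hf2) (h₁ h hhm hhi hh2)).trans (le_of_eq ?_)
  ring

end Bilinear

section Duhamel

variable {E : Type*} [NormedAddCommGroup E] [InnerProductSpace ℝ E] [FiniteDimensional ℝ E]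
  [MeasurableSpace E] [BorelSpace E]

theorem integral_fourierInv_mul_conj {A h : E → ℂ} (hA : Integrable A) (hh : Integrable h) :
    ∫ x, 𝓕⁻ A x * conj (h x) = ∫ ξ, A ξ * conj (𝓕 h ξ) := by
  have key := VectorFourier.integral_sesq_fourierIntegral_eq_neg_flip (L := innerₗ E) (innerSL ℂ)
    Real.continuous_fourierChar continuous_inner hh hA
  rw [flip_innerₗ] at key
  exact key.symm

theorem continuous_uncurry_fourier {f : ℝ → E → ℂ} (hf : Continuous (Function.uncurry f))
    {φ : E → ℝ} (hφ : Integrable φ) (hfφ : ∀ s x, ‖f s x‖ ≤ φ x) :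
    Continuous fun z : ℝ × E => 𝓕 (f z.1) z.2 := by
  simp only [Real.fourier_eq, Circle.smul_def, smul_eq_mul]
  have hc : Continuous fun q : (ℝ × E) × E => (𝐞 (-⟪q.2, q.1.2⟫) : ℂ) * f q.1.1 q.2 := by
    refine Continuous.mul (by fun_prop) ?_
    have h1 : Continuous fun q : (ℝ × E) × E => (q.1.1, q.2) := by fun_prop
    exact hf.comp h1
  refine continuous_of_dominated (bound := φ) (fun z => ?_) (fun z => .of_forall fun x => ?_) hφ
    (.of_forall fun x => ?_)
  · exact (hc.comp (Continuous.prodMk_right z)).aestronglyMeasurable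
  · rw [norm_mul, Circle.norm_coe, one_mul]
    exact hfφ _ _
  · exact hc.comp (Continuous.prodMk_left x)

/-- The Fourier transform of the Duhamel integral of `f` at time `t`. -/
def duhamelSymbol (a : E → ℝ) (m : ℝ) (f : ℝ → E → ℂ) (t : ℝ) (ξ : E) : ℂ :=
  ∫ s in (0 : ℝ)..t, (𝐞 ((t - s) * a ξ ^ m) : ℂ) * 𝓕 (f s) ξ

theorem continuous_phase_mul_fourier {a : E → ℝ} (ha : Continuous a) {m : ℝ} (hm : 0 ≤ m)
    {f : ℝ → E → ℂ} (hG : Continuous fun z : ℝ × E => 𝓕 (f z.1) z.2) :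
    Continuous fun z : (ℝ × E) × ℝ =>
      (𝐞 ((z.1.1 - z.2) * a z.1.2 ^ m) : ℂ) * 𝓕 (f z.2) z.1.2 := by
  have h1 : Continuous fun z : (ℝ × E) × ℝ => (z.2, z.1.2) := by fun_prop
  have h2 : Continuous fun z : (ℝ × E) × ℝ => a z.1.2 ^ m :=
    (ha.comp (by fun_prop)).rpow_const fun _ => Or.inr hm
  have h3 : Continuous fun z : (ℝ × E) × ℝ => (𝐞 ((z.1.1 - z.2) * a z.1.2 ^ m) : ℂ) := by fun_prop
  exact h3.mul (hG.comp h1)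

theorem continuous_duhamelSymbol {a : E → ℝ} (ha : Continuous a) {m : ℝ} (hm : 0 ≤ m)
    {f : ℝ → E → ℂ} (hG : Continuous fun z : ℝ × E => 𝓕 (f z.1) z.2) :
    Continuous (Function.uncurry (duhamelSymbol a m f)) :=
  intervalIntegral.continuous_parametric_intervalIntegral_of_continuous
    (f := fun (z : ℝ × E) (s : ℝ) => (𝐞 ((z.1 - s) * a z.2 ^ m) : ℂ) * 𝓕 (f s) z.2)
    (continuous_phase_mul_fourier ha hm hG) continuous_fst

theorem norm_duhamelSymbol_le {a : E → ℝ} {m : ℝ} {f : ℝ → E → ℂ} {t D : ℝ} {ξ : E}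
    (hD : ∀ s, ‖𝓕 (f s) ξ‖ ≤ D) : ‖duhamelSymbol a m f t ξ‖ ≤ D * |t| := by
  have := intervalIntegral.norm_integral_le_of_norm_le_const (a := 0) (b := t) (C := D)
    (f := fun s => (𝐞 ((t - s) * a ξ ^ m) : ℂ) * 𝓕 (f s) ξ) fun s _ => by
      rw [norm_mul, Circle.norm_coe, one_mul]
      exact hD s
  rwa [sub_zero] at this

/-- Fubini for the Duhamel integral paired with a bounded function. -/
theorem integral_duhamelSymbol_mul {a : E → ℝ} (ha : Continuous a) {m : ℝ} (hm : 0 ≤ m)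
    {f : ℝ → E → ℂ} (hG : Continuous fun z : ℝ × E => 𝓕 (f z.1) z.2) {g : E → ℂ}
    (hg : Continuous g) {ψ : E → ℝ} (hψ : Integrable ψ) (hgψ : ∀ s ξ, ‖𝓕 (f s) ξ * g ξ‖ ≤ ψ ξ)
    (t : ℝ) :
    ∫ ξ, duhamelSymbol a m f t ξ * g ξ =
      ∫ s in (0 : ℝ)..t, ∫ ξ, (𝐞 ((t - s) * a ξ ^ m) : ℂ) * (𝓕 (f s) ξ * g ξ) := by
  rw [intervalIntegral_integral_swap]
  · refine integral_congr_ae (.of_forall fun ξ => ?_)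
    simp only [duhamelSymbol, ← mul_assoc]
    rw [intervalIntegral.integral_mul_const]
  · have hc : Continuous (Function.uncurry fun (s : ℝ) (ξ : E) =>
        (𝐞 ((t - s) * a ξ ^ m) : ℂ) * (𝓕 (f s) ξ * g ξ)) := by
      have h1 : Continuous fun z : ℝ × E => ((t, z.2), z.1) := by fun_prop
      have h2 : Continuous fun z : ℝ × E => g z.2 := by fun_prop
      refine (((continuous_phase_mul_fourier ha hm hG).comp h1).mul h2).congr fun z => ?_
      simp only [Pi.mul_apply, Function.comp, Function.uncurry, mul_assoc]
    have hi : Integrable (fun z : ℝ × E => (1 : ℝ) * ψ z.2)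
        ((volume.restrict (Set.uIoc 0 t)).prod volume) :=
      Integrable.mul_prod (f := fun _ : ℝ => (1 : ℝ)) 
        (integrableOn_const (by simp [Set.uIoc])) hψ
    refine hi.mono' hc.aestronglyMeasurable (.of_forall fun z => ?_)
    rw [Function.uncurry, norm_mul, Circle.norm_coe, one_mul, one_mul]
    exact hgψ _ _

/-- The Duhamel integral of `f` at time `t`, smoothed by `(1 + k |D|²) ^ ((m - 1) / 2)`. -/
def duhamelSolution (a : E → ℝ) (m k : ℝ) (f : ℝ → E → ℂ) (t : ℝ) (x : E) : ℂ :=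
  𝓕⁻ (fun ξ => (((1 + k * ‖ξ‖ ^ 2) ^ ((m - 1) / 2) : ℝ) : ℂ) * duhamelSymbol a m f t ξ) x

theorem continuous_weight {m k : ℝ} (hk : 0 ≤ k) :
    Continuous fun ξ : E => (((1 + k * ‖ξ‖ ^ 2) ^ ((m - 1) / 2) : ℝ) : ℂ) :=
  Complex.continuous_ofReal.comp ((by fun_prop : Continuous fun ξ : E => 1 + k * ‖ξ‖ ^ 2).rpow_const
    fun ξ => Or.inl (by positivity))

theorem continuous_weight_mul_duhamelSymbol {a : E → ℝ} (ha : Continuous a) {m k : ℝ} (hm : 0 ≤ m)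
    (hk : 0 ≤ k) {f : ℝ → E → ℂ} (hG : Continuous fun z : ℝ × E => 𝓕 (f z.1) z.2) :
    Continuous (Function.uncurry fun (t : ℝ) (ξ : E) =>
      (((1 + k * ‖ξ‖ ^ 2) ^ ((m - 1) / 2) : ℝ) : ℂ) * duhamelSymbol a m f t ξ) :=
  ((continuous_weight hk).comp continuous_snd).mul (continuous_duhamelSymbol ha hm hG)

theorem norm_weight_mul_duhamelSymbol_le {a : E → ℝ} {m k : ℝ} (hk : 0 ≤ k) {f : ℝ → E → ℂ}
    {t D : ℝ} {ξ : E}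
    (hD : ∀ s, ‖(((1 + k * ‖ξ‖ ^ 2) ^ ((m - 1) / 2) : ℝ) : ℂ) * 𝓕 (f s) ξ‖ ≤ D) :
    ‖(((1 + k * ‖ξ‖ ^ 2) ^ ((m - 1) / 2) : ℝ) : ℂ) * duhamelSymbol a m f t ξ‖ ≤ D * |t| := by
  have hw : 0 < (1 + k * ‖ξ‖ ^ 2) ^ ((m - 1) / 2) := by positivity
  simp only [norm_mul, Complex.norm_real, Real.norm_eq_abs, abs_of_pos hw] at hD ⊢
  have := norm_duhamelSymbol_le (a := a) (m := m) (t := t) fun s =>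
    (le_div_iff₀' hw).2 (hD s)
  calc _ ≤ _ := mul_le_mul_of_nonneg_left this hw.le
    _ = D * |t| := by field_simp

theorem integrable_weight_mul_duhamelSymbol {a : E → ℝ} (ha : Continuous a) {m k : ℝ} (hm : 0 ≤ m)
    (hk : 0 ≤ k) {f : ℝ → E → ℂ} (hG : Continuous fun z : ℝ × E => 𝓕 (f z.1) z.2) {ψ : E → ℝ}
    (hψ : Integrable ψ)
    (hfψ : ∀ s ξ, ‖(((1 + k * ‖ξ‖ ^ 2) ^ ((m - 1) / 2) : ℝ) : ℂ) * 𝓕 (f s) ξ‖ ≤ ψ ξ) (t : ℝ) :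
    Integrable fun ξ => (((1 + k * ‖ξ‖ ^ 2) ^ ((m - 1) / 2) : ℝ) : ℂ) * duhamelSymbol a m f t ξ := by
  have hc := (continuous_weight_mul_duhamelSymbol ha hm hk hG).comp (Continuous.prodMk_right t)
  exact (hψ.mul_const |t|).mono' hc.aestronglyMeasurable
    (.of_forall fun ξ => norm_weight_mul_duhamelSymbol_le hk fun s => hfψ s ξ)

theorem norm_duhamelSolution_le {a : E → ℝ} {m k : ℝ} (hk : 0 ≤ k) {f : ℝ → E → ℂ} {ψ : E → ℝ}
    (hψ : Integrable ψ)
    (hfψ : ∀ s ξ, ‖(((1 + k * ‖ξ‖ ^ 2) ^ ((m - 1) / 2) : ℝ) : ℂ) * 𝓕 (f s) ξ‖ ≤ ψ ξ) (t : ℝ)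
    (x : E) : ‖duhamelSolution a m k f t x‖ ≤ (∫ ξ, ψ ξ) * |t| := by
  rw [duhamelSolution, Real.fourierInv_eq_fourier_neg, ← integral_mul_const]
  exact (norm_fourier_le _ _).trans (integral_mono_of_nonneg (.of_forall fun _ => norm_nonneg _)
    (hψ.mul_const |t|)
    (.of_forall fun ξ => norm_weight_mul_duhamelSymbol_le hk fun s => hfψ s ξ))

theorem measurable_duhamelSolution {a : E → ℝ} (ha : Continuous a) {m k : ℝ} (hm : 0 ≤ m)
    (hk : 0 ≤ k) {f : ℝ → E → ℂ} (hG : Continuous fun z : ℝ × E => 𝓕 (f z.1) z.2) :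
    Measurable fun z : ℝ × E => duhamelSolution a m k f z.1 z.2 := by
  have h := measurable_uncurry_fourier
    (continuous_weight_mul_duhamelSymbol (k := k) ha hm hk hG).measurable
  have h1 : Measurable fun z : ℝ × E => (z.1, -z.2) := by fun_prop
  have h2 := h.comp h1
  simp only [Function.comp_def, Function.uncurry, ← Real.fourierInv_eq_fourier_neg] at h2
  simpa only [duhamelSolution] using h2

theorem enorm_integral_duhamelSolution_mul_conj_le {a : E → ℝ} (ha : Continuous a) {m k : ℝ}
    (hm : 0 ≤ m) (hk : 0 ≤ k) {f : ℝ → E → ℂ}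
    (hG : Continuous fun z : ℝ × E => 𝓕 (f z.1) z.2) {ψ : E → ℝ} (hψ : Integrable ψ)
    (hfψ : ∀ s ξ, ‖(((1 + k * ‖ξ‖ ^ 2) ^ ((m - 1) / 2) : ℝ) : ℂ) * 𝓕 (f s) ξ‖ ≤ ψ ξ)
    {h : E → ℂ} (hh : Integrable h) (t : ℝ) :
    ‖∫ x, duhamelSolution a m k f t x * conj (h x)‖ₑ ≤
      ∫⁻ s, ‖phasePairing a m k (t - s) (f s) h‖ₑ := by
  have hA := integrable_weight_mul_duhamelSymbol ha hm hk hG hψ hfψ t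
  have hg : Continuous fun ξ => (((1 + k * ‖ξ‖ ^ 2) ^ ((m - 1) / 2) : ℝ) : ℂ) * conj (𝓕 h ξ) :=
    (continuous_weight hk).mul (Complex.continuous_conj.comp (continuous_fourier hh))
  have hgψ : ∀ s ξ, ‖𝓕 (f s) ξ *
      ((((1 + k * ‖ξ‖ ^ 2) ^ ((m - 1) / 2) : ℝ) : ℂ) * conj (𝓕 h ξ))‖ ≤ ψ ξ * ∫ x, ‖h x‖ :=
    fun s ξ => by
      rw [← mul_assoc, mul_comm (𝓕 (f s) ξ), norm_mul, RCLike.norm_conj]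
      exact mul_le_mul (hfψ s ξ) (norm_fourier_le h ξ) (norm_nonneg _)
        ((norm_nonneg _).trans (hfψ s ξ))
  have h1 : ∫ x, duhamelSolution a m k f t x * conj (h x) =
      ∫ s in (0 : ℝ)..t, phasePairing a m k (t - s) (f s) h := by
    simp only [duhamelSolution]
    rw [integral_fourierInv_mul_conj hA hh]
    have h2 := integral_duhamelSymbol_mul ha hm hG hg (hψ.mul_const _) hgψ t
    calc _ = ∫ ξ, duhamelSymbol a m f t ξ *
          ((((1 + k * ‖ξ‖ ^ 2) ^ ((m - 1) / 2) : ℝ) : ℂ) * conj (𝓕 h ξ)) := by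
          refine integral_congr_ae (.of_forall fun ξ => ?_)
          ring
      _ = _ := by
          rw [h2]
          simp only [phasePairing, mul_left_comm (𝓕 (f _) _)]
  have h3 : ‖∫ s in (0 : ℝ)..t, phasePairing a m k (t - s) (f s) h‖ₑ =
      ‖∫ s in Set.uIoc 0 t, phasePairing a m k (t - s) (f s) h‖ₑ := by
    rw [← ofReal_norm, intervalIntegral.norm_intervalIntegral_eq, ofReal_norm]
  rw [h1, h3]
  exact (enorm_integral_le_lintegral_enorm _).trans (setLIntegral_le_lintegral _ _)

end Duhamel

section Duality

variable {E : Type*} [NormedAddCommGroup E] [InnerProductSpace ℝ E] [FiniteDimensional ℝ E]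
  [MeasurableSpace E] [BorelSpace E]

/-- The dual weight `⟨x⟩ ^ (-m)` times a function `U`, cut off to a ball of radius `R`. -/
def cutoffDual (m R : ℝ) (U : ℝ → E → ℂ) (t : ℝ) (x : E) : ℂ :=
  (Metric.closedBall (0 : ℝ × E) R).indicator
    (fun z => (((1 + ‖z.2‖ ^ 2) ^ (-(m / 2)) : ℝ) : ℂ) * U z.1 z.2) (t, x)

theorem measurable_cutoffDual {m R : ℝ} {U : ℝ → E → ℂ} (hU : Measurable fun z : ℝ × E => U z.1 z.2) :
    Measurable (Function.uncurry (cutoffDual m R U)) := by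
  have h : Measurable fun z : ℝ × E => (((1 + ‖z.2‖ ^ 2) ^ (-(m / 2)) : ℝ) : ℂ) * U z.1 z.2 := by
    fun_prop
  exact h.indicator Metric.isClosed_closedBall.measurableSet

theorem norm_cutoffDual_le {m R : ℝ} (hm : 0 ≤ m) {U : ℝ → E → ℂ} {D : ℝ}
    (hU : ∀ t x, ‖U t x‖ ≤ D * |t|) (hD : 0 ≤ D) (t : ℝ) (x : E) :
    ‖cutoffDual m R U t x‖ ≤ (Metric.closedBall (0 : E) R).indicator (fun _ => D * |t|) x := by
  rw [cutoffDual]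
  by_cases hz : (t, x) ∈ Metric.closedBall (0 : ℝ × E) R
  · have hx : x ∈ Metric.closedBall (0 : E) R := by
      rw [mem_closedBall_zero_iff] at hz ⊢
      exact (norm_snd_le (t, x)).trans hz
    rw [Set.indicator_of_mem hz, Set.indicator_of_mem hx, norm_mul, Complex.norm_real,
      Real.norm_eq_abs, abs_of_nonneg (by positivity)]
    refine (mul_le_of_le_one_left (norm_nonneg _) ?_).trans (hU t x)
    exact Real.rpow_le_one_of_one_le_of_nonpos (by nlinarith [sq_nonneg ‖x‖]) (by linarith)
  · rw [Set.indicator_of_notMem hz, norm_zero]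
    exact Set.indicator_nonneg (fun _ _ => by positivity) x

theorem memLp_cutoffDual {m R : ℝ} (hm : 0 ≤ m) {U : ℝ → E → ℂ}
    (hUm : Measurable fun z : ℝ × E => U z.1 z.2) {D : ℝ} (hU : ∀ t x, ‖U t x‖ ≤ D * |t|)
    (hD : 0 ≤ D) (t : ℝ) (p : ℝ≥0∞) : MemLp (cutoffDual m R U t) p := by
  have h : MemLp ((Metric.closedBall (0 : E) R).indicator fun _ => D * |t|) p volume :=
    memLp_indicator_const p Metric.isClosed_closedBall.measurableSet _
      (Or.inr measure_closedBall_lt_top.ne)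
  have h1 : Measurable fun x : E => (t, x) := by fun_prop
  exact h.mono' ((measurable_cutoffDual hUm).comp h1).aestronglyMeasurable
    (.of_forall fun x => norm_cutoffDual_le hm hU hD t x)

theorem weight_mul_enorm_cutoffDual_sq {m R : ℝ} {U : ℝ → E → ℂ} (t : ℝ) (x : E) :
    ENNReal.ofReal ((1 + ‖x‖ ^ 2) ^ (m / 2)) * ‖cutoffDual m R U t x‖ₑ ^ 2 =
      (Metric.closedBall (0 : ℝ × E) R).indicator
        (fun z => ENNReal.ofReal ((1 + ‖z.2‖ ^ 2) ^ (-(m / 2))) * ‖U z.1 z.2‖ₑ ^ 2) (t, x) := by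
  rw [cutoffDual]
  by_cases hz : (t, x) ∈ Metric.closedBall (0 : ℝ × E) R
  · have hp : 0 < 1 + ‖x‖ ^ 2 := by positivity
    rw [Set.indicator_of_mem hz, Set.indicator_of_mem hz, enorm_mul, mul_pow, ← mul_assoc]
    congr 1
    rw [← ofReal_norm, Complex.norm_real, Real.norm_eq_abs, abs_of_nonneg (by positivity),
      ← ENNReal.ofReal_pow (by positivity), ← ENNReal.ofReal_mul (by positivity),
      sq ((1 + ‖x‖ ^ 2) ^ (-(m / 2))),
      ← mul_assoc, ← Real.rpow_add hp]
    simp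
  · simp [Set.indicator_of_notMem hz]

theorem lintegral_indicator_eq_enorm_integral {m R : ℝ} (hm : 0 ≤ m) {U : ℝ → E → ℂ}
    (hUm : Measurable fun z : ℝ × E => U z.1 z.2) {D : ℝ} (hU : ∀ t x, ‖U t x‖ ≤ D * |t|)
    (hD : 0 ≤ D) (t : ℝ) :
    ∫⁻ x, (Metric.closedBall (0 : ℝ × E) R).indicator
        (fun z => ENNReal.ofReal ((1 + ‖z.2‖ ^ 2) ^ (-(m / 2))) * ‖U z.1 z.2‖ₑ ^ 2) (t, x) =
      ‖∫ x, U t x * conj (cutoffDual m R U t x)‖ₑ := by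
  have h1 : Measurable fun x : E => (t, x) := by fun_prop
  have hUt : Measurable (U t) := hUm.comp h1
  have hreal : ∀ x, U t x * conj (cutoffDual m R U t x) =
      ((‖U t x * conj (cutoffDual m R U t x)‖ : ℝ) : ℂ) := by
    intro x
    rw [cutoffDual]
    by_cases hz : (t, x) ∈ Metric.closedBall (0 : ℝ × E) R
    · rw [Set.indicator_of_mem hz, map_mul (starRingEnd ℂ), Complex.conj_ofReal, mul_left_comm,
        Complex.mul_conj, norm_mul, Complex.norm_real, Complex.norm_real, Real.norm_eq_abs,
        Real.norm_eq_abs, abs_of_nonneg (by positivity), abs_of_nonneg (Complex.normSq_nonneg _)]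
      push_cast
      rfl
    · simp [Set.indicator_of_notMem hz]
  have hi : Integrable fun x => U t x * conj (cutoffDual m R U t x) :=
    ((Complex.conjLIE.integrable_comp_iff).2 (memLp_one_iff_integrable.1
      (memLp_cutoffDual hm hUm hU hD t 1))).bdd_mul hUt.aestronglyMeasurable
      (.of_forall fun x => hU t x)
  have h2 : ∫ x, U t x * conj (cutoffDual m R U t x) =
      ((∫ x, ‖U t x * conj (cutoffDual m R U t x)‖ : ℝ) : ℂ) := by
    rw [← integral_complex_ofReal]
    exact integral_congr_ae (.of_forall hreal)
  rw [h2, ← ofReal_norm, Complex.norm_real, Real.norm_eq_abs,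
    abs_of_nonneg (integral_nonneg fun x => norm_nonneg _),
    ofReal_integral_norm_eq_lintegral_enorm hi]
  refine lintegral_congr fun x => ?_
  rw [cutoffDual]
  by_cases hz : (t, x) ∈ Metric.closedBall (0 : ℝ × E) R
  · rw [Set.indicator_of_mem hz, Set.indicator_of_mem hz, map_mul (starRingEnd ℂ),
      Complex.conj_ofReal, mul_left_comm, enorm_mul, enorm_mul]
    congr 1
    · rw [← ofReal_norm, Complex.norm_real, Real.norm_eq_abs, abs_of_nonneg (by positivity)]
    · rw [← ofReal_norm (conj _), RCLike.norm_conj, ofReal_norm, pow_two]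
  · simp [Set.indicator_of_notMem hz]

theorem exists_lintegral_duhamelSolution_le [Nontrivial E] {a : E → ℝ} {m k : ℝ} (hm : 1 < m)
    (hmn : m < Module.finrank ℝ E) (hk : 0 ≤ k)
    (ha : Continuous a) (ha_hom : ∀ t : ℝ, 0 < t → ∀ ξ, a (t • ξ) = t * a ξ)
    (ha_pos : ∀ ξ, ξ ≠ 0 → 0 < a ξ) :
    ∃ C : ℝ≥0∞, C ≠ ⊤ ∧ ∀ (f : ℝ → E → ℂ) (φ ψ : E → ℝ), Continuous (Function.uncurry f) →
      (∀ s, MemLp (f s) 2) → Integrable φ → (∀ s x, ‖f s x‖ ≤ φ x) → Integrable ψ →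
      (∀ s ξ, ‖(((1 + k * ‖ξ‖ ^ 2) ^ ((m - 1) / 2) : ℝ) : ℂ) * 𝓕 (f s) ξ‖ ≤ ψ ξ) →
      ∫⁻ z : ℝ × E, ENNReal.ofReal ((1 + ‖z.2‖ ^ 2) ^ (-(m / 2))) *
        ‖duhamelSolution a m k f z.1 z.2‖ₑ ^ 2 ≤ C * weightedSq m f := by
  obtain ⟨C, hC, h₁⟩ := exists_sq_lintegral_phasePairing_le hm hmn hk ha ha_hom ha_pos
  refine ⟨C, hC, fun f φ ψ hf hf2 hφ hfφ hψ hfψ => ?_⟩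
  have hm0 : 0 ≤ m := by linarith
  have hfi : ∀ s, Integrable (f s) := fun s =>
    hφ.mono' (hf2 s).1 (.of_forall fun x => hfφ s x)
  have hG := continuous_uncurry_fourier hf hφ hfφ
  have hUm := measurable_duhamelSolution (k := k) ha hm0 hk hG
  have hU := norm_duhamelSolution_le (a := a) hk hψ hfψ
  have hD : 0 ≤ ∫ ξ, ψ ξ := integral_nonneg fun ξ => (norm_nonneg _).trans (hfψ 0 ξ)
  have hint : Measurable fun z : ℝ × E => ENNReal.ofReal ((1 + ‖z.2‖ ^ 2) ^ (-(m / 2))) *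
        ‖duhamelSolution a m k f z.1 z.2‖ₑ ^ 2 :=
    Measurable.mul (by fun_prop) (hUm.enorm.pow_const 2)
  refine le_of_tendsto ((aecover_closedBall (x := (0 : ℝ × E))
    tendsto_natCast_atTop_atTop).lintegral_tendsto_of_nat hint.aemeasurable)
    (.of_forall fun N => ?_)
  have hball : MeasurableSet (Metric.closedBall (0 : ℝ × E) N) :=
    Metric.isClosed_closedBall.measurableSet
  set h := cutoffDual m N (duhamelSolution a m k f) with hh
  have hhi : ∀ t, Integrable (h t) := fun t =>
    memLp_one_iff_integrable.1 (memLp_cutoffDual hm0 hUm hU hD t 1)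
  have hX : ∫⁻ z in Metric.closedBall (0 : ℝ × E) N,
      ENNReal.ofReal ((1 + ‖z.2‖ ^ 2) ^ (-(m / 2))) * ‖duhamelSolution a m k f z.1 z.2‖ₑ ^ 2 =
      ∫⁻ t, ∫⁻ x, (Metric.closedBall (0 : ℝ × E) N).indicator
        (fun z => ENNReal.ofReal ((1 + ‖z.2‖ ^ 2) ^ (-(m / 2))) *
          ‖duhamelSolution a m k f z.1 z.2‖ₑ ^ 2) (t, x) := by
    rw [← lintegral_indicator hball, Measure.volume_eq_prod,
      lintegral_prod _ (hint.indicator hball).aemeasurable]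
  have hfin : ∫⁻ z in Metric.closedBall (0 : ℝ × E) N,
      ENNReal.ofReal ((1 + ‖z.2‖ ^ 2) ^ (-(m / 2))) * ‖duhamelSolution a m k f z.1 z.2‖ₑ ^ 2 ≠
        ⊤ := by
    refine ((setLIntegral_mono' hball (g := fun _ => ENNReal.ofReal (((∫ ξ, ψ ξ) * N) ^ 2))
      fun z hz => ?_).trans_lt ?_).ne
    · have hz1 : |z.1| ≤ N := by
        rw [mem_closedBall_zero_iff] at hz
        exact (norm_fst_le z).trans hz
      have h2 : ‖duhamelSolution a m k f z.1 z.2‖ ≤ (∫ ξ, ψ ξ) * N :=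
        (hU z.1 z.2).trans (mul_le_mul_of_nonneg_left hz1 hD)
      have h3 : (1 + ‖z.2‖ ^ 2) ^ (-(m / 2)) ≤ 1 :=
        Real.rpow_le_one_of_one_le_of_nonpos (by nlinarith [sq_nonneg ‖z.2‖]) (by linarith)
      rw [← ofReal_norm, ← ENNReal.ofReal_pow (norm_nonneg _), ← ENNReal.ofReal_mul (by positivity)]
      refine ENNReal.ofReal_le_ofReal ((mul_le_of_le_one_left (by positivity) h3).trans ?_)
      exact pow_le_pow_left₀ (norm_nonneg _) h2 2
    · rw [setLIntegral_const]
      exact ENNReal.mul_lt_top ENNReal.ofReal_lt_top measure_closedBall_lt_top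
  have hwh : weightedSq m h = ∫⁻ z in Metric.closedBall (0 : ℝ × E) N,
      ENNReal.ofReal ((1 + ‖z.2‖ ^ 2) ^ (-(m / 2))) * ‖duhamelSolution a m k f z.1 z.2‖ₑ ^ 2 := by
    rw [hX, weightedSq]
    simp only [hh, weight_mul_enorm_cutoffDual_sq]
  have hle : ∫⁻ z in Metric.closedBall (0 : ℝ × E) N,
      ENNReal.ofReal ((1 + ‖z.2‖ ^ 2) ^ (-(m / 2))) * ‖duhamelSolution a m k f z.1 z.2‖ₑ ^ 2 ≤
      ∫⁻ t, ∫⁻ s, ‖phasePairing a m k (t - s) (f s) (h t)‖ₑ := by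
    rw [hX]
    refine lintegral_mono fun t => ?_
    rw [lintegral_indicator_eq_enorm_integral hm0 hUm hU hD t]
    exact enorm_integral_duhamelSolution_mul_conj_le ha hm0 hk hG hψ hfψ (hhi t) t
  have hsq := h₁ f h hf.measurable (measurable_cutoffDual hUm) hfi hf2 hhi
    (fun t => memLp_cutoffDual hm0 hUm hU hD t 2) fun s t => by
      simp only [← mul_assoc]
      have hw : Continuous fun ξ => (((1 + k * ‖ξ‖ ^ 2) ^ ((m - 1) / 2) : ℝ) : ℂ) * 𝓕 (f s) ξ :=
        (continuous_weight hk).mul (continuous_fourier (hfi s))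
      refine (hψ.mono' hw.aestronglyMeasurable (.of_forall fun ξ => hfψ s ξ)).mul_bdd
        (c := ∫ x, ‖h t x‖)
        (Complex.continuous_conj.comp (continuous_fourier (hhi t))).aestronglyMeasurable
        (.of_forall fun ξ => ?_)
      rw [RCLike.norm_conj]
      exact norm_fourier_le _ ξ
  rw [hwh] at hsq
  generalize (∫⁻ z in Metric.closedBall (0 : ℝ × E) N,
      ENNReal.ofReal ((1 + ‖z.2‖ ^ 2) ^ (-(m / 2))) * ‖duhamelSolution a m k f z.1 z.2‖ₑ ^ 2) = X
    at hle hsq hfin ⊢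
  rcases eq_or_ne X 0 with rfl | hX0
  · simp
  have h4 : X * X ≤ C * weightedSq m f * X := by
    rw [mul_assoc, ← pow_two]
    exact (pow_le_pow_left' hle 2).trans hsq
  exact (ENNReal.mul_le_mul_iff_left hX0 hfin).1 h4

end Duality

section Slice

variable {E : Type*} [NormedAddCommGroup E] [InnerProductSpace ℝ E] [FiniteDimensional ℝ E]
  [MeasurableSpace E] [BorelSpace E]

theorem norm_iteratedFDeriv_slice_le (f : 𝓢(ℝ × E, ℂ)) (i : ℕ) (s : ℝ) (x : E) :
    ‖iteratedFDeriv ℝ i (fun y => f (s, y)) x‖ ≤ ‖iteratedFDeriv ℝ i f (s, x)‖ := by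
  have h : (fun y => f (s, y)) =
      (fun z => f (z + (s, 0))) ∘ ContinuousLinearMap.inr ℝ ℝ E := by
    funext y
    simp
  have hf : ContDiff ℝ i fun z => f (z + (s, 0)) :=
    (f.smooth i).comp (contDiff_id.add contDiff_const)
  rw [h, ContinuousLinearMap.iteratedFDeriv_comp_right _ hf x le_rfl, iteratedFDeriv_comp_add_right]
  refine (ContinuousMultilinearMap.norm_compContinuousLinearMap_le _ _).trans ?_
  have h1 : ContinuousLinearMap.inr ℝ ℝ E x + (s, 0) = (s, x) := by simp
  rw [h1]
  exact mul_le_of_le_one_right (norm_nonneg _) (Finset.prod_le_one (fun _ _ => norm_nonneg _)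
    fun _ _ => ContinuousLinearMap.norm_inr_le_one ℝ ℝ E)

theorem exists_norm_iteratedFDeriv_slice_le (f : 𝓢(ℝ × E, ℂ)) (i N : ℕ) :
    ∃ C : ℝ, 0 ≤ C ∧ ∀ s x,
      ‖iteratedFDeriv ℝ i (fun y => f (s, y)) x‖ ≤ C * (1 + ‖x‖) ^ (-(N : ℝ)) := by
  have h := fun z => SchwartzMap.one_add_le_sup_seminorm_apply (𝕜 := ℝ) (m := (N, i)) le_rfl le_rfl f z
  refine ⟨_, le_trans (by positivity) (h 0), fun s x => ?_⟩
  have hx : 0 < 1 + ‖x‖ := by positivity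
  rw [Real.rpow_neg hx.le, Real.rpow_natCast, ← div_eq_mul_inv, le_div_iff₀ (by positivity), mul_comm]
  refine le_trans ?_ (h (s, x))
  have h1 : ‖x‖ ≤ ‖(s, x)‖ := norm_snd_le (s, x)
  exact mul_le_mul (by gcongr) (norm_iteratedFDeriv_slice_le f i s x) (norm_nonneg _) (by positivity)

theorem exists_norm_fourier_slice_le (f : 𝓢(ℝ × E, ℂ)) (N : ℕ) :
    ∃ C : ℝ, ∀ s ξ, (1 + ‖ξ‖) ^ N * ‖𝓕 (fun y => f (s, y)) ξ‖ ≤ C := by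
  set r := Module.finrank ℝ E + 1 with hr
  have hI : Integrable fun x : E => (1 + ‖x‖) ^ (-(r : ℝ)) :=
    integrable_one_add_norm (by simp [hr])
  choose C hC0 hC using fun i => exists_norm_iteratedFDeriv_slice_le f i r
  have hcd : ∀ s, ContDiff ℝ ∞ fun y => f (s, y) := fun s =>
    (f.smooth ⊤).comp (contDiff_const.prodMk contDiff_id)
  have hint : ∀ s i, Integrable fun x => ‖iteratedFDeriv ℝ i (fun y => f (s, y)) x‖ := fun s i =>
    (hI.const_mul (C i)).mono' ((hcd s).continuous_iteratedFDeriv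
      (mod_cast le_top)).norm.aestronglyMeasurable (.of_forall fun x => by
        rw [norm_norm]
        exact hC i s x)
  have hpow : ∀ j : ℕ, ∃ D : ℝ, ∀ s ξ, ‖ξ‖ ^ j * ‖𝓕 (fun y => f (s, y)) ξ‖ ≤ D := by
    intro j
    refine ⟨2 ^ j * ∑ i ∈ Finset.range (j + 1), ∫ x : E, C i * (1 + ‖x‖) ^ (-(r : ℝ)),
      fun s ξ => ?_⟩
    have h := Real.pow_mul_norm_iteratedFDeriv_fourier_le (K := 0) (N := ⊤) (f := fun y => f (s, y))
      (hcd s) (fun k i hk _ => by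
        have hk0 : k = 0 := by simpa using hk
        simpa [hk0] using hint s i) (k := 0) (n := j) le_rfl le_top ξ
    rw [norm_iteratedFDeriv_zero] at h
    refine h.trans (le_of_eq_of_le ?_ (mul_le_mul_of_nonneg_left (Finset.sum_le_sum fun i _ =>
      integral_mono (hint s i) (hI.const_mul (C i)) fun x => hC i s x) (by positivity)))
    simp
  obtain ⟨D₀, hD₀⟩ := hpow 0
  obtain ⟨D, hD⟩ := hpow N
  refine ⟨2 ^ (N - 1) * (D₀ + D), fun s ξ => ?_⟩
  have h1 := add_pow_le zero_le_one (norm_nonneg ξ) N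
  have h2 := hD₀ s ξ
  have h3 := hD s ξ
  rw [pow_zero] at h2
  calc _ ≤ 2 ^ (N - 1) * (1 ^ N + ‖ξ‖ ^ N) * ‖𝓕 (fun y => f (s, y)) ξ‖ := by gcongr
    _ = 2 ^ (N - 1) * (1 * ‖𝓕 (fun y => f (s, y)) ξ‖ + ‖ξ‖ ^ N * ‖𝓕 (fun y => f (s, y)) ξ‖) := by
      rw [one_pow]
      ring
    _ ≤ _ := by gcongr

theorem exists_integrable_forall_norm_slice_le (f : 𝓢(ℝ × E, ℂ)) :
    ∃ φ : E → ℝ, Integrable φ ∧ ∀ s x, ‖f (s, x)‖ ≤ φ x := by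
  obtain ⟨C, -, hC⟩ := exists_norm_iteratedFDeriv_slice_le f 0 (Module.finrank ℝ E + 1)
  have hI : Integrable fun x : E => (1 + ‖x‖) ^ (-((Module.finrank ℝ E + 1 : ℕ) : ℝ)) :=
    integrable_one_add_norm (by simp)
  exact ⟨_, hI.const_mul C, fun s x => by simpa using hC s x⟩

theorem exists_integrable_forall_norm_weight_mul_fourier_slice_le (f : 𝓢(ℝ × E, ℂ)) {m k : ℝ}
    (hm : 1 ≤ m) (hk : 0 ≤ k) :
    ∃ ψ : E → ℝ, Integrable ψ ∧ ∀ s ξ,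
      ‖(((1 + k * ‖ξ‖ ^ 2) ^ ((m - 1) / 2) : ℝ) : ℂ) * 𝓕 (fun y => f (s, y)) ξ‖ ≤ ψ ξ := by
  obtain ⟨M, hM⟩ := exists_nat_ge (m - 1)
  set r := Module.finrank ℝ E + 1 with hr
  obtain ⟨C, hC⟩ := exists_norm_fourier_slice_le f (M + r)
  have hI : Integrable fun x : E => (1 + ‖x‖) ^ (-(r : ℝ)) :=
    integrable_one_add_norm (by simp [hr])
  refine ⟨_, hI.const_mul ((1 + k) ^ ((m - 1) / 2) * C), fun s ξ => ?_⟩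
  have hξ : 1 ≤ 1 + ‖ξ‖ := by linarith [norm_nonneg ξ]
  have hw : (1 + k * ‖ξ‖ ^ 2) ^ ((m - 1) / 2) ≤ (1 + k) ^ ((m - 1) / 2) * (1 + ‖ξ‖) ^ M := by
    calc _ ≤ ((1 + k) * (1 + ‖ξ‖) ^ 2) ^ ((m - 1) / 2) := by
          refine Real.rpow_le_rpow (by positivity) ?_ (by linarith)
          nlinarith [norm_nonneg ξ, mul_nonneg hk (norm_nonneg ξ), sq_nonneg ‖ξ‖]
      _ = (1 + k) ^ ((m - 1) / 2) * (1 + ‖ξ‖) ^ (m - 1) := by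
          rw [Real.mul_rpow (by positivity) (by positivity), ← Real.rpow_natCast,
            ← Real.rpow_mul (by positivity)]
          congr 2
          push_cast
          ring
      _ ≤ _ := by
          rw [← Real.rpow_natCast]
          gcongr
  rw [norm_mul, Complex.norm_real, Real.norm_eq_abs, abs_of_nonneg (by positivity),
    Real.rpow_neg (by positivity), Real.rpow_natCast, ← div_eq_mul_inv, le_div_iff₀ (by positivity)]
  calc _ ≤ (1 + k) ^ ((m - 1) / 2) * (1 + ‖ξ‖) ^ M * ‖𝓕 (fun y => f (s, y)) ξ‖ * (1 + ‖ξ‖) ^ r := by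
        gcongr
    _ = (1 + k) ^ ((m - 1) / 2) * ((1 + ‖ξ‖) ^ (M + r) * ‖𝓕 (fun y => f (s, y)) ξ‖) := by
        rw [pow_add]
        ring
    _ ≤ _ := by
        gcongr
        exact hC s ξ

theorem memLp_slice (f : 𝓢(ℝ × E, ℂ)) (s : ℝ) : MemLp (fun y => f (s, y)) 2 := by
  obtain ⟨φ, hφ, hfφ⟩ := exists_integrable_forall_norm_slice_le f
  obtain ⟨C, hC0, hC⟩ := exists_norm_iteratedFDeriv_slice_le f 0 0
  have hc : Continuous fun y => f (s, y) := f.continuous.comp (Continuous.prodMk_right s)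
  refine (memLp_two_iff_integrable_sq_norm hc.aestronglyMeasurable).2
    ((hφ.const_mul C).mono' (hc.norm.pow 2).aestronglyMeasurable (.of_forall fun x => ?_))
  have h1 : ‖f (s, x)‖ ≤ C := by simpa using hC s x
  rw [norm_pow, norm_norm, sq]
  exact mul_le_mul h1 (hfφ s x) (norm_nonneg _) hC0

end Slice

section Normalization

theorem FT_two_pi_smul (n : ℕ) (f : EuclideanSpace ℝ (Fin n) → ℂ)
    (η : EuclideanSpace ℝ (Fin n)) :
    FT n f ((2 * π) • η) = ((2 * π) ^ (-(n : ℝ) / 2) : ℝ) • 𝓕 f η := by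
  rw [FT, Real.fourier_eq']
  congr 2
  funext x
  rw [smul_eq_mul, inner_smul_right]
  congr 2
  push_cast
  ring

/-- The multiplier in terms of the Fourier transform with character `exp (2πi x)`. -/
theorem mult_eq_fourierInv (n : ℕ) (q f : EuclideanSpace ℝ (Fin n) → ℂ)
    (x : EuclideanSpace ℝ (Fin n)) :
    mult n q f x = 𝓕⁻ (fun η => q ((2 * π) • η) * 𝓕 f η) x := by
  have hpi : (0 : ℝ) < 2 * π := by positivity
  have hscale := Measure.integral_comp_smul (volume : Measure (EuclideanSpace ℝ (Fin n)))
    (fun ξ => Complex.exp (Complex.I * ((⟪x, ξ⟫ : ℝ) : ℂ)) * (q ξ * FT n f ξ)) (2 * π)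
  rw [finrank_euclideanSpace_fin, abs_of_pos (by positivity), eq_inv_smul_iff₀ (by positivity)]
    at hscale
  rw [mult, IFT, ← hscale, Real.fourierInv_eq', smul_smul, ← integral_smul]
  refine integral_congr_ae (.of_forall fun η => ?_)
  have hc : (2 * π) ^ (-(n : ℝ) / 2) * (2 * π) ^ n * (2 * π) ^ (-(n : ℝ) / 2) = 1 := by
    rw [← Real.rpow_natCast, ← Real.rpow_add hpi, ← Real.rpow_add hpi]
    ring_nf
    exact Real.rpow_zero _
  have hexp : Complex.exp (Complex.I * ((⟪x, (2 * π) • η⟫ : ℝ) : ℂ)) =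
      Complex.exp (((2 * π * ⟪η, x⟫ : ℝ) : ℂ) * Complex.I) := by
    rw [inner_smul_right, real_inner_comm, mul_comm]
  have hcC := congrArg (fun r : ℝ => (r : ℂ)) hc
  simp only [FT_two_pi_smul, hexp, smul_eq_mul, Complex.real_smul] at hcC ⊢
  push_cast at hcC ⊢
  linear_combination (Complex.exp (2 * π * ⟪η, x⟫ * Complex.I) * q ((2 * π) • η) * 𝓕 f η) * hcC

end Normalization

section Duhamel

variable {E : Type*} [NormedAddCommGroup E] [InnerProductSpace ℝ E] [FiniteDimensional ℝ E]
  [MeasurableSpace E] [BorelSpace E]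

/-- The Fourier transform of an inverse Fourier transform is either the original function, or it
vanishes identically because the inner integral fails to be integrable. -/
theorem fourier_fourierInv_eq_or_eq_zero {F : E → ℂ} (hF : Continuous F) (hFi : Integrable F) :
    𝓕 (𝓕⁻ F) = F ∨ 𝓕 (𝓕⁻ F) = 0 := by
  by_cases h : Integrable (𝓕⁻ F)
  · left
    refine hF.fourier_fourierInv_eq hFi ?_
    refine h.comp_neg.congr (.of_forall fun ξ => ?_)
    simp only [Real.fourierInv_eq_fourier_neg, neg_neg]
  · right
    funext ξ
    rw [Real.fourier_eq, Pi.zero_apply]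
    refine integral_undef fun h' => h ?_
    exact (Real.fourierIntegral_convergent_iff ξ).1 h'

theorem intervalIntegral_fourierInv_phase_mul_fourier {a : E → ℝ} (ha : Continuous a) {m : ℝ}
    (hm : 0 ≤ m) {f : ℝ → E → ℂ} (hG : Continuous fun z : ℝ × E => 𝓕 (f z.1) z.2) {ψ : E → ℝ}
    (hψ : Integrable ψ) (hfψ : ∀ s ξ, ‖𝓕 (f s) ξ‖ ≤ ψ ξ) (t : ℝ) (y : E) :
    ∫ s in (0 : ℝ)..t, 𝓕⁻ (fun ξ => (𝐞 ((t - s) * a ξ ^ m) : ℂ) * 𝓕 (f s) ξ) y =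
      𝓕⁻ (duhamelSymbol a m f t) y := by
  have h := integral_duhamelSymbol_mul ha hm hG (g := fun ξ => (𝐞 ⟪ξ, y⟫ : ℂ)) (by fun_prop) hψ
    (fun s ξ => by
      rw [norm_mul, Circle.norm_coe, mul_one]
      exact hfψ s ξ) t
  simp only [Real.fourierInv_eq, Circle.smul_def, smul_eq_mul]
  rw [integral_congr_ae (.of_forall fun ξ => mul_comm (𝐞 ⟪ξ, y⟫ : ℂ) (duhamelSymbol a m f t ξ)), h]
  congr 1
  funext s
  refine integral_congr_ae (.of_forall fun ξ => ?_)
  ring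

end Duhamel

section Final

theorem exp_I_mul_rpow_two_pi_smul {E : Type*} [NormedAddCommGroup E] [InnerProductSpace ℝ E]
    {a : E → ℝ} {m : ℝ} (hm : 0 < m) (ha_hom : ∀ t : ℝ, 0 < t → ∀ ξ, a (t • ξ) = t * a ξ)
    (ha_pos : ∀ ξ, ξ ≠ 0 → 0 < a ξ) (r : ℝ) (η : E) :
    Complex.exp (Complex.I * (r : ℂ) * ((a ((2 * π) • η) ^ m : ℝ) : ℂ)) =
      (𝐞 (r * ((2 * π) ^ ((m - 1) / m) * a η) ^ m) : ℂ) := by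
  have hpi : (0 : ℝ) < 2 * π := by positivity
  have ha0 : 0 ≤ a η := by
    rcases eq_or_ne η 0 with rfl | hη
    · have h := ha_hom 2 two_pos 0
      rw [smul_zero] at h
      linarith
    · exact (ha_pos η hη).le
  have h : a ((2 * π) • η) ^ m = 2 * π * ((2 * π) ^ ((m - 1) / m) * a η) ^ m := by
    rw [ha_hom _ hpi, Real.mul_rpow hpi.le ha0, Real.mul_rpow (by positivity) ha0,
      ← Real.rpow_mul hpi.le, div_mul_cancel₀ _ hm.ne', ← mul_assoc, ← Real.rpow_one_add' hpi.le]
    · ring_nf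
    · linarith
  rw [Real.fourierChar_apply, h]
  congr 1
  push_cast
  ring

theorem sqrt_one_add_norm_two_pi_smul_rpow {E : Type*} [NormedAddCommGroup E]
    [InnerProductSpace ℝ E] (m : ℝ) (η : E) :
    √(1 + ‖(2 * π) • η‖ ^ 2) ^ (m - 1) = (1 + (2 * π) ^ 2 * ‖η‖ ^ 2) ^ ((m - 1) / 2) := by
  rw [norm_smul, mul_pow, Real.norm_eq_abs, sq_abs, Real.sqrt_eq_rpow,
    ← Real.rpow_mul (by positivity)]
  ring_nf

/-- The solution operator of the inhomogeneous problem, followed by the Bessel multiplier, is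
pointwise dominated by `duhamelSolution`. -/
theorem enorm_mult_duhamel_le {n : ℕ} {a : EuclideanSpace ℝ (Fin n) → ℝ} {m : ℝ} (hm : 1 < m)
    (ha : Continuous a) (ha_hom : ∀ t : ℝ, 0 < t → ∀ ξ, a (t • ξ) = t * a ξ)
    (ha_pos : ∀ ξ, ξ ≠ 0 → 0 < a ξ) {f : ℝ → EuclideanSpace ℝ (Fin n) → ℂ}
    (hG : Continuous fun z : ℝ × EuclideanSpace ℝ (Fin n) => 𝓕 (f z.1) z.2)
    {ψ : EuclideanSpace ℝ (Fin n) → ℝ} (hψ : Integrable ψ) (hfψ : ∀ s ξ, ‖𝓕 (f s) ξ‖ ≤ ψ ξ)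
    (t : ℝ) (x : EuclideanSpace ℝ (Fin n)) :
    ‖mult n (fun ξ => ((√(1 + ‖ξ‖ ^ 2) ^ (m - 1) : ℝ) : ℂ))
      (fun y => ∫ s in (0 : ℝ)..t,
        mult n (fun ξ => Complex.exp (Complex.I * ((t - s : ℝ) : ℂ) * ((a ξ ^ m : ℝ) : ℂ)))
          (f s) y) x‖ₑ ≤
      ‖duhamelSolution (fun ξ => (2 * π) ^ ((m - 1) / m) * a ξ) m ((2 * π) ^ 2) f t x‖ₑ := by
  have hb : Continuous fun ξ => (2 * π) ^ ((m - 1) / m) * a ξ := ha.const_mul _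
  have hm0 : 0 ≤ m := by linarith
  have hinner : (fun y => ∫ s in (0 : ℝ)..t,
        mult n (fun ξ => Complex.exp (Complex.I * ((t - s : ℝ) : ℂ) * ((a ξ ^ m : ℝ) : ℂ)))
          (f s) y) = 𝓕⁻ (duhamelSymbol (fun ξ => (2 * π) ^ ((m - 1) / m) * a ξ) m f t) := by
    funext y
    rw [← intervalIntegral_fourierInv_phase_mul_fourier hb hm0 hG hψ hfψ t y]
    simp only [mult_eq_fourierInv, exp_I_mul_rpow_two_pi_smul (zero_lt_one.trans hm) ha_hom ha_pos]
  have hFc : Continuous (duhamelSymbol (fun ξ => (2 * π) ^ ((m - 1) / m) * a ξ) m f t) :=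
    (continuous_duhamelSymbol hb hm0 hG).comp (Continuous.prodMk_right t)
  have hFi : Integrable (duhamelSymbol (fun ξ => (2 * π) ^ ((m - 1) / m) * a ξ) m f t) :=
    (hψ.mul_const |t|).mono' hFc.aestronglyMeasurable
      (.of_forall fun ξ => norm_duhamelSymbol_le fun s => hfψ s ξ)
  rw [hinner, mult_eq_fourierInv]
  simp only [sqrt_one_add_norm_two_pi_smul_rpow]
  rcases fourier_fourierInv_eq_or_eq_zero hFc hFi with h | h
  · rw [h, duhamelSolution]
  · rw [h]
    simp [Real.fourierInv_eq]

theorem eLpNorm_sqrt_rpow_mul_two {n : ℕ} (r : ℝ) (u : ℝ × EuclideanSpace ℝ (Fin n) → ℂ) :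
    eLpNorm (fun z : ℝ × EuclideanSpace ℝ (Fin n) => ((√(1 + ‖z.2‖ ^ 2) ^ r : ℝ) : ℂ) * u z) 2
      volume = (∫⁻ z : ℝ × EuclideanSpace ℝ (Fin n), ENNReal.ofReal ((1 + ‖z.2‖ ^ 2) ^ r) *
        ‖u z‖ₑ ^ 2) ^ (1 / 2 : ℝ) := by
  rw [eLpNorm_eq_lintegral_rpow_enorm_toReal two_ne_zero ENNReal.ofNat_ne_top]
  simp only [ENNReal.toReal_ofNat, ENNReal.rpow_two]
  congr 1
  refine lintegral_congr fun z => ?_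
  rw [enorm_mul, mul_pow, ← ofReal_norm, Complex.norm_real, Real.norm_eq_abs,
    abs_of_nonneg (by positivity), ← ENNReal.ofReal_pow (by positivity), Real.sqrt_eq_rpow,
    ← Real.rpow_natCast, ← Real.rpow_mul (by positivity), ← Real.rpow_mul (by positivity)]
  congr 3
  push_cast
  ring

end Final

theorem smoothing_type_II_inhomogeneous (n : ℕ) (hn : 2 ≤ n) (m : ℝ) (hm1 : 1 < m)
    (hmn : m < n)
    (a : EuclideanSpace ℝ (Fin n) → ℝ)
    (ha_cont : Continuous a)
    (ha_smooth : ContDiffOn ℝ (⊤ : ℕ∞) a {(0 : EuclideanSpace ℝ (Fin n))}ᶜ)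
    (ha_hom : ∀ t : ℝ, 0 < t → ∀ ξ, a (t • ξ) = t * a ξ)
    (ha_pos : ∀ ξ : EuclideanSpace ℝ (Fin n), ξ ≠ 0 → 0 < a ξ) :
    ∃ C > 0, ∀ f : SchwartzMap (ℝ × EuclideanSpace ℝ (Fin n)) ℂ,
      eLpNorm (fun tx : ℝ × EuclideanSpace ℝ (Fin n) =>
          ((Real.sqrt (1 + ‖tx.2‖ ^ 2) ^ (-(m / 2)) : ℝ) : ℂ) *
            mult n (fun ξ => ((Real.sqrt (1 + ‖ξ‖ ^ 2) ^ (m - 1) : ℝ) : ℂ))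
              (fun y => ∫ s in (0 : ℝ)..tx.1,
                mult n (fun ξ => Complex.exp (Complex.I * ((tx.1 - s : ℝ) : ℂ) *
                    ((a ξ ^ m : ℝ) : ℂ)))
                  (fun y' => f (s, y')) y) tx.2) 2 volume
        ≤ ENNReal.ofReal C *
            eLpNorm (fun tx : ℝ × EuclideanSpace ℝ (Fin n) =>
              ((Real.sqrt (1 + ‖tx.2‖ ^ 2) ^ (m / 2) : ℝ) : ℂ) * f tx) 2 volume := by
  have : Nonempty (Fin n) := ⟨⟨0, by omega⟩⟩
  have : Nontrivial (EuclideanSpace ℝ (Fin n)) := inferInstance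
  have hc : (0 : ℝ) < (2 * π) ^ ((m - 1) / m) := by positivity
  obtain ⟨C, hC, hmain⟩ := exists_lintegral_duhamelSolution_le (m := m) (k := (2 * π) ^ 2)
    (a := fun ξ : EuclideanSpace ℝ (Fin n) => (2 * π) ^ ((m - 1) / m) * a ξ) hm1
    (by rwa [finrank_euclideanSpace_fin]) (by positivity) (ha_cont.const_mul _)
    (fun t ht ξ => by rw [ha_hom t ht]; ring) (fun ξ hξ => mul_pos hc (ha_pos ξ hξ))
  refine ⟨C.toReal ^ (1 / 2 : ℝ) + 1, by positivity, fun f => ?_⟩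
  obtain ⟨φ, hφ, hfφ⟩ := exists_integrable_forall_norm_slice_le f
  obtain ⟨ψ₁, hψ₁, hfψ₁⟩ := exists_integrable_forall_norm_weight_mul_fourier_slice_le f
    (m := 1) (k := 0) le_rfl le_rfl
  obtain ⟨ψ, hψ, hfψ⟩ := exists_integrable_forall_norm_weight_mul_fourier_slice_le f
    (m := m) (k := (2 * π) ^ 2) hm1.le (by positivity)
  have hf : Continuous (Function.uncurry fun s y => f (s, y)) := f.continuous
  have hG := continuous_uncurry_fourier hf hφ hfφ
  have hfψ₁' : ∀ s ξ, ‖𝓕 (fun y => f (s, y)) ξ‖ ≤ ψ₁ ξ := fun s ξ => by simpa using hfψ₁ s ξ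
  have hbound := hmain (fun s y => f (s, y)) φ ψ hf (memLp_slice f) hφ hfφ hψ hfψ
  have hrhs : weightedSq m (fun s y => f (s, y)) = ∫⁻ z : ℝ × EuclideanSpace ℝ (Fin n),
      ENNReal.ofReal ((1 + ‖z.2‖ ^ 2) ^ (m / 2)) * ‖f z‖ₑ ^ 2 := by
    have hmeas : Continuous fun z : ℝ × EuclideanSpace ℝ (Fin n) => (1 + ‖z.2‖ ^ 2) ^ (m / 2) :=
      (by fun_prop : Continuous fun z : ℝ × EuclideanSpace ℝ (Fin n) =>
        1 + ‖z.2‖ ^ 2).rpow_const fun z => Or.inl (by positivity)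
    rw [Measure.volume_eq_prod, lintegral_prod _ (by
      exact (hmeas.measurable.ennreal_ofReal.mul
        (f.continuous.measurable.enorm.pow_const 2)).aemeasurable)]
    rfl
  rw [eLpNorm_sqrt_rpow_mul_two, eLpNorm_sqrt_rpow_mul_two, ← hrhs]
  calc _ ≤ (C * weightedSq m fun s y => f (s, y)) ^ (1 / 2 : ℝ) := by
        refine ENNReal.rpow_le_rpow (le_trans (lintegral_mono fun z => ?_) hbound) (by norm_num)
        gcongr
        exact enorm_mult_duhamel_le hm1 ha_cont ha_hom ha_pos hG hψ₁ hfψ₁' z.1 z.2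
    _ = C ^ (1 / 2 : ℝ) * (weightedSq m fun s y => f (s, y)) ^ (1 / 2 : ℝ) :=
        ENNReal.mul_rpow_of_nonneg _ _ (by norm_num)
    _ ≤ _ := by
        gcongr
        rw [← ENNReal.ofReal_toReal hC, ENNReal.ofReal_rpow_of_nonneg (by positivity) (by norm_num),
          ENNReal.toReal_ofReal (by positivity)]
        exact ENNReal.ofReal_le_ofReal (by linarith)
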